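/- Assume 1/(1−α) ∈ ℤ and write 1/(1−α) = m+1, where m ≥ 1 is an integer. There exists a constant C depending only on α and d (independent of ν and a) such that for every a > 0 and all t₁, t₂ ∈ [a M₁^{−2/(1+α)} ν^{(1−α)/(1+α)}, T): |x^{(m)}(t₁) − x^{(m)}(t₂)| ≤ C (a^{−m} + 1) M₁^{1/(1−α)} |t₁ − t₂| (1 − log⁻(M₁ |t₁ − t₂|)), where log⁻(s) = min(log s, 0). -/

import Mathlib

open MeasureTheory Set

noncomputable def heatKernel (d : ℕ) (s : ℝ) (y : EuclideanSpace ℝ (Fin d)) : ℝ :=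
  (4 * Real.pi * s) ^ (-(d : ℝ) / 2) * Real.exp (-(‖y‖ ^ 2) / (4 * s))

namespace Lagrangian

open scoped ContDiff SchwartzMap LineDeriv Topology

abbrev Sp (d : ℕ) := EuclideanSpace ℝ (Fin d)

section Kernels

variable {d : ℕ}

noncomputable def unit (l : Fin d) : Sp d := EuclideanSpace.single l 1

lemma norm_unit (l : Fin d) : ‖unit l‖ = 1 := by simp [unit]

noncomputable def kd (l : Fin d) (Ψ : 𝓢(Sp d, ℝ)) : 𝓢(Sp d, ℝ) := ∂_{unit l} Ψ

lemma kd_apply (l : Fin d) (Ψ : 𝓢(Sp d, ℝ)) (z : Sp d) : kd l Ψ z = fderiv ℝ Ψ z (unit l) := rfl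

lemma norm_iteratedFDeriv_exp_quarter_le (i : ℕ) (t : ℝ) :
    ‖iteratedFDeriv ℝ i (fun s : ℝ => Real.exp (-(1 / 4) * s)) t‖ ≤ Real.exp (-(1 / 4) * t) := by
  rw [norm_iteratedFDeriv_eq_norm_iteratedDeriv, iteratedDeriv_exp_const_mul]
  rw [norm_mul, norm_pow, Real.norm_eq_abs, Real.norm_eq_abs, abs_of_pos (Real.exp_pos _)]
  refine mul_le_of_le_one_left (Real.exp_pos _).le (pow_le_one₀ (abs_nonneg _) ?_)
  norm_num [abs_le]

lemma norm_iteratedFDeriv_norm_sq_le (i : ℕ) (hi : 1 ≤ i) (x : Sp d) :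
    ‖iteratedFDeriv ℝ i (fun y : Sp d => ‖y‖ ^ 2) x‖ ≤ (2 + 2 * ‖x‖) ^ i := by
  have h1 : fderiv ℝ (fun y : Sp d => ‖y‖ ^ 2) = fun y => (2 : ℝ) • innerSL ℝ y := by
    funext y
    rw [fderiv_norm_sq_apply, two_smul, two_smul]
  obtain ⟨j, rfl⟩ := Nat.exists_eq_add_of_le' hi
  rw [← norm_iteratedFDeriv_fderiv, h1]
  have hL : (fun y : Sp d => (2 : ℝ) • innerSL ℝ y)
      = fun y => ((2 : ℝ) • innerSL ℝ (E := Sp d)) y := by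
    funext y; rfl
  have hn : ‖((2 : ℝ) • innerSL ℝ (E := Sp d))‖ ≤ 2 := by
    refine ContinuousLinearMap.opNorm_le_bound _ (by norm_num) fun y => ?_
    simp [norm_smul, innerSL_apply_norm]
  rcases j with _ | _ | j
  · rw [norm_iteratedFDeriv_zero]
    simp only [norm_smul, innerSL_apply_norm]
    norm_num
  · rw [norm_iteratedFDeriv_one, hL, ContinuousLinearMap.fderiv]
    refine hn.trans ?_
    have := norm_nonneg x
    norm_num
    nlinarith
  · rw [hL, ← norm_iteratedFDeriv_fderiv]
    have : fderiv ℝ (fun y => ((2 : ℝ) • innerSL ℝ (E := Sp d)) y)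
        = fun _ => ((2 : ℝ) • innerSL ℝ (E := Sp d)) := by
      funext y; exact ContinuousLinearMap.fderiv _
    rw [this, iteratedFDeriv_const_of_ne (by omega)]
    simp only [Pi.zero_apply, norm_zero]
    positivity

lemma pow_mul_exp_bound (N : ℕ) : ∃ C : ℝ, ∀ s : ℝ, 0 ≤ s →
    (2 + 2 * s) ^ N * Real.exp (-(1 / 4) * s ^ 2) ≤ C := by
  have hc : Continuous fun s : ℝ => (2 + 2 * s) ^ N * Real.exp (-(1 / 4) * s ^ 2) := by fun_prop
  refine ⟨(N.factorial : ℝ) * Real.exp 100, fun s hs => ?_⟩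
  have h1 : (2 + 2 * s) ^ N ≤ N.factorial * Real.exp (2 + 2 * s) := by
    have := Real.pow_div_factorial_le_exp (2 + 2 * s) (by positivity) N
    rw [div_le_iff₀ (by positivity)] at this
    linarith
  calc (2 + 2 * s) ^ N * Real.exp (-(1 / 4) * s ^ 2)
      ≤ N.factorial * Real.exp (2 + 2 * s) * Real.exp (-(1 / 4) * s ^ 2) := by gcongr
    _ = N.factorial * Real.exp (2 + 2 * s + -(1 / 4) * s ^ 2) := by rw [mul_assoc, ← Real.exp_add]
    _ ≤ _ := by
      gcongr
      nlinarith [sq_nonneg (s - 4)]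

noncomputable def rawGauss (d : ℕ) : 𝓢(Sp d, ℝ) where
  toFun := (fun s : ℝ => Real.exp (-(1 / 4) * s)) ∘ fun y : Sp d => ‖y‖ ^ 2
  smooth' := by
    refine ContDiff.comp (g := fun s : ℝ => Real.exp (-(1 / 4) * s)) ?_ (contDiff_norm_sq ℝ)
    fun_prop
  decay' := by
    intro k n
    obtain ⟨C, hC⟩ := pow_mul_exp_bound (k + n)
    refine ⟨n.factorial * C, fun x => ?_⟩
    have h := norm_iteratedFDeriv_comp_le (𝕜 := ℝ) (g := fun s : ℝ => Real.exp (-(1 / 4) * s))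
      (f := fun y : Sp d => ‖y‖ ^ 2) (n := n) (N := ∞) (by fun_prop) (contDiff_norm_sq ℝ)
      (by exact_mod_cast le_top) x
      (C := Real.exp (-(1 / 4) * ‖x‖ ^ 2)) (D := 2 + 2 * ‖x‖)
      (fun i _ => norm_iteratedFDeriv_exp_quarter_le i _)
      (fun i hi _ => norm_iteratedFDeriv_norm_sq_le i hi x)
    have hx := norm_nonneg x
    have hk : ‖x‖ ^ k ≤ (2 + 2 * ‖x‖) ^ k := by gcongr; linarith
    calc _ ≤ (2 + 2 * ‖x‖) ^ k
          * (n.factorial * Real.exp (-(1 / 4) * ‖x‖ ^ 2) * (2 + 2 * ‖x‖) ^ n) := by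
          gcongr
      _ = n.factorial * ((2 + 2 * ‖x‖) ^ (k + n) * Real.exp (-(1 / 4) * ‖x‖ ^ 2)) := by ring
      _ ≤ _ := by gcongr; exact hC _ hx

lemma rawGauss_apply (z : Sp d) : rawGauss d z = Real.exp (-(1 / 4) * ‖z‖ ^ 2) := rfl

lemma integral_rawGauss_pos : 0 < ∫ z, rawGauss d z := by
  refine (integral_pos_iff_support_of_nonneg (f := rawGauss d) (fun z => (Real.exp_pos _).le)
    (rawGauss d).integrable).2 ?_
  have : Function.support (rawGauss d) = univ := by
    ext z; simp [rawGauss_apply, Real.exp_ne_zero]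
  rw [this]
  exact isOpen_univ.measure_pos _ univ_nonempty

/-- The heat kernel at unit time. -/
noncomputable def gauss (d : ℕ) : 𝓢(Sp d, ℝ) := (∫ z, rawGauss d z)⁻¹ • rawGauss d

lemma integral_gauss : ∫ z, gauss d z = 1 := by
  have : ∀ z, gauss d z = (∫ z, rawGauss d z)⁻¹ * rawGauss d z := fun z => rfl
  simp_rw [this, integral_const_mul]
  exact inv_mul_cancel₀ integral_rawGauss_pos.ne'

lemma gauss_mul_coord (l : Fin d) (z : Sp d) : gauss d z * z l = -2 * kd l (gauss d) z := by
  have hz : gauss d z = (∫ z, rawGauss d z)⁻¹ * Real.exp (-(1 / 4) * ‖z‖ ^ 2) := rfl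
  have h : HasFDerivAt (gauss d) ((∫ z, rawGauss d z)⁻¹ • (Real.exp (-(1 / 4) * ‖z‖ ^ 2) •
      ((-(1 / 4) : ℝ) • ((2 : ℝ) • innerSL ℝ z)))) z := by
    have h0 : HasFDerivAt (fun y : Sp d => ‖y‖ ^ 2) ((2 : ℝ) • innerSL ℝ z) z := by
      have := (hasStrictFDerivAt_norm_sq z).hasFDerivAt
      rwa [two_smul, ← two_smul ℝ] at this
    exact ((h0.const_mul (-(1 / 4) : ℝ)).exp).const_mul _
  rw [kd_apply, h.fderiv, hz]
  simp [unit, EuclideanSpace.inner_single_right]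
  ring

/-- Weighted `L¹` norm of a kernel. -/
noncomputable def kw (Ψ : 𝓢(Sp d, ℝ)) (n : ℕ) : ℝ := ∫ z, |Ψ z| * (1 + ‖z‖) ^ n

lemma integrable_kw (Ψ : 𝓢(Sp d, ℝ)) (n : ℕ) : Integrable fun z => |Ψ z| * (1 + ‖z‖) ^ n := by
  have h0 := Ψ.integrable_pow_mul volume 0
  have h1 := Ψ.integrable_pow_mul volume n
  refine ((h0.add h1).const_mul (2 ^ n)).mono' (by fun_prop) (ae_of_all _ fun z => ?_)
  have hz := norm_nonneg z
  rw [Real.norm_of_nonneg (by positivity)]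
  have : (1 + ‖z‖) ^ n ≤ 2 ^ n * (1 + ‖z‖ ^ n) := by
    calc (1 + ‖z‖) ^ n ≤ (2 * max 1 ‖z‖) ^ n := by
          gcongr
          linarith [le_max_left 1 ‖z‖, le_max_right 1 ‖z‖]
      _ = 2 ^ n * (max 1 ‖z‖) ^ n := mul_pow _ _ _
      _ ≤ _ := by
          gcongr
          rcases max_cases 1 ‖z‖ with h | h <;> rw [h.1] <;> simp
  simp only [Pi.add_apply, pow_zero, one_mul, Real.norm_eq_abs]
  nlinarith [abs_nonneg (Ψ z)]

lemma kw_nonneg (Ψ : 𝓢(Sp d, ℝ)) (n : ℕ) : 0 ≤ kw Ψ n :=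
  integral_nonneg fun z => by positivity

end Kernels

abbrev Pt (d : ℕ) := ℝ × Sp d

def slab (d : ℕ) (T : ℝ) : Set (Pt d) := Ioo 0 T ×ˢ univ

noncomputable def lat {d : ℕ} (n : Fin d → ℤ) : Sp d :=
  (EuclideanSpace.equiv (Fin d) ℝ).symm fun i => (n i : ℝ)

section Fields

variable {d : ℕ} {T : ℝ} {V W : Type*} [NormedAddCommGroup V] [NormedSpace ℝ V]
  [NormedAddCommGroup W] [NormedSpace ℝ W]

lemma isOpen_slab : IsOpen (slab d T) := isOpen_Ioo.prod isOpen_univ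

lemma mem_slab {q : Pt d} : q ∈ slab d T ↔ q.1 ∈ Ioo 0 T := by simp [slab]

lemma add_mem_slab {q : Pt d} (hq : q ∈ slab d T) (z : Sp d) : q + (0, z) ∈ slab d T := by
  simpa [mem_slab] using hq

lemma slab_mem_nhds {q : Pt d} (hq : q ∈ slab d T) : slab d T ∈ 𝓝 q := isOpen_slab.mem_nhds hq

lemma exists_lat (x : Sp d) : ∃ n : Fin d → ℤ, ‖x + lat n‖ ≤ d := by
  refine ⟨fun i => -⌊x i⌋, ?_⟩
  have h : ∀ i, ‖(x + lat fun i => -⌊x i⌋) i‖ ≤ 1 := fun i => by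
    have : (x + lat fun i => -⌊x i⌋) i = Int.fract (x i) := by
      simp [lat, Int.fract, sub_eq_add_neg]
    rw [this, Real.norm_of_nonneg (Int.fract_nonneg _)]
    exact (Int.fract_lt_one _).le
  calc ‖x + lat fun i => -⌊x i⌋‖ ≤ √(∑ i : Fin d, 1) := by
        rw [EuclideanSpace.norm_eq]
        refine Real.sqrt_le_sqrt (Finset.sum_le_sum fun i _ => ?_)
        exact pow_le_one₀ (norm_nonneg _) (h i)
    _ ≤ d := by
        rw [Finset.sum_const, Finset.card_univ, Fintype.card_fin, nsmul_eq_mul, mul_one]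
        refine Real.sqrt_le_iff.2 ⟨by positivity, ?_⟩
        rcases Nat.eq_zero_or_pos d with h | h
        · simp [h]
        · have : (1 : ℝ) ≤ d := by exact_mod_cast h
          nlinarith

/-- Spatially periodic functions on space-time that are smooth on the open slab. -/
structure IsField (T : ℝ) (F : Pt d → V) : Prop where
  smooth : ContDiffOn ℝ ∞ F (slab d T)
  periodic : ∀ (q : Pt d) (n : Fin d → ℤ), F (q + (0, lat n)) = F q

namespace IsField

variable {F : Pt d → V}

lemma contDiffAt (hF : IsField T F) {q : Pt d} (hq : q ∈ slab d T) : ContDiffAt ℝ ∞ F q :=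
  hF.smooth.contDiffAt (slab_mem_nhds hq)

lemma differentiableAt (hF : IsField T F) {q : Pt d} (hq : q ∈ slab d T) :
    DifferentiableAt ℝ F q := (hF.contDiffAt hq).differentiableAt (by simp)

lemma const (c : V) : IsField (d := d) T fun _ => c := ⟨contDiffOn_const, fun _ _ => rfl⟩

lemma fderiv (hF : IsField T F) : IsField T (fderiv ℝ F) := by
  refine ⟨hF.smooth.fderiv_of_isOpen isOpen_slab (by simp), fun q n => ?_⟩
  rw [← fderiv_comp_add_right]
  congr 1
  funext q
  exact hF.periodic q n

lemma clm_apply {L : Pt d → V →L[ℝ] W} (hL : IsField T L) (hF : IsField T F) :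
    IsField T fun q => L q (F q) :=
  ⟨hL.smooth.clm_apply hF.smooth, fun q n => by rw [hL.periodic, hF.periodic]⟩

lemma clm_comp (hF : IsField T F) (L : V →L[ℝ] W) : IsField T fun q => L (F q) :=
  (const L).clm_apply hF

lemma prodMk {G : Pt d → W} (hF : IsField T F) (hG : IsField T G) : IsField T fun q => (F q, G q) :=
  ⟨hF.smooth.prodMk hG.smooth, fun q n => by rw [hF.periodic, hG.periodic]⟩

lemma sub {G : Pt d → V} (hF : IsField T F) (hG : IsField T G) : IsField T fun q => F q - G q :=
  ⟨hF.smooth.sub hG.smooth, fun q n => by rw [hF.periodic, hG.periodic]⟩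

lemma mul {a b : Pt d → ℝ} (ha : IsField T a) (hb : IsField T b) : IsField T fun q => a q * b q :=
  ⟨ha.smooth.mul hb.smooth, fun q n => by rw [ha.periodic, hb.periodic]⟩

lemma sum {ι : Type*} {s : Finset ι} {G : ι → Pt d → V} (hG : ∀ i, IsField T (G i)) :
    IsField T fun q => ∑ i ∈ s, G i q :=
  ⟨ContDiffOn.sum fun i _ => (hG i).smooth,
    fun q n => Finset.sum_congr rfl fun i _ => (hG i).periodic q n⟩

lemma bounded (hF : IsField T F) {c e : ℝ} (hc : 0 < c) (he : e < T) :
    ∃ B : ℝ, 0 ≤ B ∧ ∀ q : Pt d, q.1 ∈ Icc c e → ‖F q‖ ≤ B := by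
  have hK : IsCompact (Icc c e ×ˢ Metric.closedBall (0 : Sp d) d) :=
    isCompact_Icc.prod (isCompact_closedBall _ _)
  have hsub : Icc c e ×ˢ Metric.closedBall (0 : Sp d) d ⊆ slab d T := fun q hq =>
    mem_slab.2 ⟨hc.trans_le hq.1.1, hq.1.2.trans_lt he⟩
  obtain ⟨B, hB⟩ := hK.exists_bound_of_continuousOn (hF.smooth.continuousOn.mono hsub)
  refine ⟨max B 0, le_max_right _ _, fun q hq => ?_⟩
  obtain ⟨n, hn⟩ := exists_lat q.2
  rw [← hF.periodic q n]
  refine (hB _ ⟨by simpa using hq, ?_⟩).trans (le_max_left _ _)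
  simpa using hn

end IsField

/-- Spatial increment. -/
def dl (F : Pt d → V) (q : Pt d) (z : Sp d) : V := F (q + (0, z)) - F q

lemma IsField.norm_dl_le (F : Pt d → V) (hF : IsField T F) {c e : ℝ} (hc : 0 < c) (he : e < T) :
    ∃ B : ℝ, 0 ≤ B ∧ ∀ q : Pt d, q.1 ∈ Icc c e → ∀ z, ‖dl F q z‖ ≤ B * min 1 ‖z‖ := by
  obtain ⟨B₀, h0, hB₀⟩ := hF.bounded hc he
  obtain ⟨B₁, h1, hB₁⟩ := hF.fderiv.bounded hc he
  refine ⟨max (2 * B₀) B₁, by positivity, fun q hq z => ?_⟩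
  have hA : ‖dl F q z‖ ≤ 2 * B₀ := by
    refine (norm_sub_le _ _).trans ?_
    linarith [hB₀ q hq, hB₀ (q + (0, z)) (by simpa using hq)]
  have hD : ‖dl F q z‖ ≤ B₁ * ‖z‖ := by
    have hconv : Convex ℝ (Icc c e ×ˢ (univ : Set (Sp d))) := (convex_Icc c e).prod convex_univ
    have hm := hconv.norm_image_sub_le_of_norm_fderiv_le (𝕜 := ℝ) (f := F) (C := B₁)
      (fun y hy => hF.differentiableAt (mem_slab.2 ⟨hc.trans_le hy.1.1, hy.1.2.trans_lt he⟩))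
      (fun y hy => hB₁ y hy.1) (x := q) (y := q + (0, z)) ⟨hq, mem_univ _⟩
      ⟨by simpa using hq, mem_univ _⟩
    simpa [dl, Prod.norm_def] using hm
  rcases le_total 1 ‖z‖ with h | h
  · rw [min_eq_left h, mul_one]
    exact hA.trans (le_max_left _ _)
  · rw [min_eq_right h]
    exact hD.trans (by gcongr; exact le_max_right _ _)

/-- Spatial partial derivative. -/
noncomputable def pd (l : Fin d) (F : Pt d → V) (q : Pt d) : V := fderiv ℝ F q (0, unit l)

lemma IsField.pd {F : Pt d → V} (hF : IsField T F) (l : Fin d) : IsField T (pd l F) :=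
  hF.fderiv.clm_apply (.const _)

lemma fderiv_fderiv_apply {F : Pt d → V} (hF : IsField T F) {X : Pt d → Pt d} (hX : IsField T X)
    {q : Pt d} (hq : q ∈ slab d T) (w : Pt d) :
    fderiv ℝ (fun q => fderiv ℝ F q (X q)) q w
      = fderiv ℝ (fderiv ℝ F) q w (X q) + fderiv ℝ F q (fderiv ℝ X q w) := by
  rw [fderiv_clm_apply (hF.fderiv.differentiableAt hq) (hX.differentiableAt hq)]
  simp [add_comm]

lemma fderiv_pd {F : Pt d → V} (hF : IsField T F) (l : Fin d)
    {q : Pt d} (hq : q ∈ slab d T) (w : Pt d) :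
    fderiv ℝ (pd l F) q w = fderiv ℝ (fderiv ℝ F) q w (0, unit l) := by
  have := fderiv_fderiv_apply hF (IsField.const ((0 : ℝ), unit l)) hq w
  change fderiv ℝ (fun q => fderiv ℝ F q (0, unit l)) q w = _
  simpa using this

lemma fderiv_fderiv_comm {F : Pt d → V} (hF : IsField T F) {q : Pt d} (hq : q ∈ slab d T)
    (v w : Pt d) : fderiv ℝ (fderiv ℝ F) q v w = fderiv ℝ (fderiv ℝ F) q w v :=
  (hF.contDiffAt hq).isSymmSndFDerivAt
    (by rw [minSmoothness_of_isRCLikeNormedField]; exact WithTop.coe_le_coe.2 le_top) v w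

lemma pd_comm {F : Pt d → V} (hF : IsField T F) (l k : Fin d) {q : Pt d} (hq : q ∈ slab d T) :
    pd l (pd k F) q = pd k (pd l F) q := by
  rw [pd, fderiv_pd hF k hq, fderiv_fderiv_comm hF hq, ← fderiv_pd hF l hq, pd]

lemma pd_congr {F G : Pt d → V} (h : ∀ q ∈ slab d T, F q = G q) (l : Fin d) {q : Pt d}
    (hq : q ∈ slab d T) : pd l F q = pd l G q := by
  rw [pd, pd, Filter.EventuallyEq.fderiv_eq]
  filter_upwards [slab_mem_nhds hq] with y hy using h y hy

lemma pd_mul {a b : Pt d → ℝ} (ha : IsField T a) (hb : IsField T b) (l : Fin d) {q : Pt d}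
    (hq : q ∈ slab d T) : pd l (fun q => a q * b q) q = pd l a q * b q + a q * pd l b q := by
  rw [pd, fderiv_fun_mul (ha.differentiableAt hq) (hb.differentiableAt hq)]
  simp [pd]
  ring

lemma pd_sum {ι : Type*} {s : Finset ι} {G : ι → Pt d → V} (hG : ∀ i, IsField T (G i)) (l : Fin d)
    {q : Pt d} (hq : q ∈ slab d T) : pd l (fun q => ∑ i ∈ s, G i q) q = ∑ i ∈ s, pd l (G i) q := by
  rw [pd, fderiv_fun_sum fun i _ => (hG i).differentiableAt hq]
  simp [pd]

lemma apply_zero_right (L : Pt d →L[ℝ] V) (v : Sp d) : L (0, v) = ∑ l, v l • L (0, unit l) := by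
  have hv : v = ∑ l, v l • unit l := by
    ext i
    simp [unit, Finset.sum_apply, Pi.single_apply]
  have : ((0 : ℝ), v) = ∑ l, v l • ((0 : ℝ), unit l) := by
    ext1
    · simp [Prod.fst_sum]
    · simp only [Prod.snd_sum, Prod.smul_snd]; exact hv
  rw [this, map_sum]
  simp_rw [map_smul]

end Fields

/-- The data of the theorem, with velocity and pressure as functions on space-time. -/
structure Flow (d : ℕ) (α : ℝ) where
  T : ℝ
  ν : ℝ
  M : ℝ
  u : Pt d → Sp d
  p : Pt d → ℝ
  ν_pos : 0 < ν
  M_pos : 0 < M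
  field_u : IsField T u
  field_p : IsField T p
  momentum : ∀ i, ∀ q ∈ slab d T, fderiv ℝ (fun q => u q i) q (1, u q) + pd i p q
    = ν * ∑ j, pd j (pd j fun q => u q i) q
  divergence : ∀ q ∈ slab d T, ∑ i, pd i (fun q => u q i) q = 0
  holder : ∀ q ∈ slab d T, ∀ z, ‖u (q + (0, z)) - u q‖ ≤ M * ‖z‖ ^ α

section Flow

variable {d : ℕ} {α : ℝ} (S : Flow d α)

def uc (i : Fin d) (S : Flow d α) (q : Pt d) : ℝ := S.u q i

/-- Material derivative. -/
noncomputable def md (S : Flow d α) (F : Pt d → ℝ) (q : Pt d) : ℝ := fderiv ℝ F q (1, S.u q)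

lemma field_uc (i : Fin d) : IsField S.T (uc i S) :=
  S.field_u.clm_comp (EuclideanSpace.proj i)

lemma field_dir : IsField S.T fun q => ((1 : ℝ), S.u q) := (IsField.const 1).prodMk S.field_u

variable {S}

lemma IsField.md {F : Pt d → ℝ} (hF : IsField S.T F) : IsField S.T (md S F) :=
  hF.fderiv.clm_apply (field_dir S)

lemma md_congr {F G : Pt d → ℝ} (h : ∀ q ∈ slab d S.T, F q = G q) {q : Pt d}
    (hq : q ∈ slab d S.T) : md S F q = md S G q := by
  rw [md, md, Filter.EventuallyEq.fderiv_eq]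
  filter_upwards [slab_mem_nhds hq] with y hy using h y hy

lemma md_pd {F : Pt d → ℝ} (hF : IsField S.T F) (l : Fin d) {q : Pt d} (hq : q ∈ slab d S.T) :
    md S (pd l F) q = pd l (md S F) q - ∑ j, pd l (uc j S) q * pd j F q := by
  have h1 : pd l (md S F) q = fderiv ℝ (fun q => fderiv ℝ F q (1, S.u q)) q (0, unit l) := rfl
  have h2 : fderiv ℝ (fun q => ((1 : ℝ), S.u q)) q (0, unit l) = (0, pd l S.u q) := by
    rw [DifferentiableAt.fderiv_prodMk (by fun_prop) (S.field_u.differentiableAt hq)]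
    simp [pd]
  have h3 : ∀ j, pd l S.u q j = pd l (uc j S) q := fun j => by
    have : HasFDerivAt (uc j S) ((EuclideanSpace.proj j : Sp d →L[ℝ] ℝ).comp (fderiv ℝ S.u q)) q :=
      (EuclideanSpace.proj j : Sp d →L[ℝ] ℝ).hasFDerivAt.comp q
        (S.field_u.differentiableAt hq).hasFDerivAt
    rw [pd, pd, this.fderiv]
    rfl
  rw [h1, fderiv_fderiv_apply hF (field_dir S) hq, h2, apply_zero_right (fderiv ℝ F q), md,
    fderiv_pd hF l hq, fderiv_fderiv_comm hF hq]
  simp_rw [h3]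
  simp [pd]

lemma md_uc (i : Fin d) {q : Pt d} (hq : q ∈ slab d S.T) :
    md S (uc i S) q = S.ν * ∑ j, pd j (pd j (uc i S)) q - pd i S.p q := by
  have := S.momentum i q hq
  exact eq_sub_of_add_eq this

lemma laplacian_pressure {q : Pt d} (hq : q ∈ slab d S.T) :
    ∑ i, pd i (pd i S.p) q = -∑ i, ∑ j, pd i (uc j S) q * pd j (uc i S) q := by
  have hu := fun i => field_uc S i
  have hpi : ∀ i, pd i (pd i S.p) q = S.ν * ∑ j, pd j (pd j (pd i (uc i S))) q
      - md S (pd i (uc i S)) q - ∑ j, pd i (uc j S) q * pd j (uc i S) q := fun i => by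
    have h1 : ∀ q ∈ slab d S.T, pd i S.p q
        = (S.ν * ∑ j, pd j (pd j (uc i S)) q) - md S (uc i S) q := fun q hq => by
      rw [md_uc i hq]; ring
    have hL : IsField S.T fun q => ∑ j, pd j (pd j (uc i S)) q := .sum fun j => ((hu i).pd j).pd j
    rw [pd_congr h1 i hq]
    have h2 : pd i (fun q => (S.ν * ∑ j, pd j (pd j (uc i S)) q) - md S (uc i S) q) q
        = S.ν * pd i (fun q => ∑ j, pd j (pd j (uc i S)) q) q - pd i (md S (uc i S)) q := by
      rw [pd, fderiv_fun_sub ((hL.differentiableAt hq).const_mul _)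
        ((hu i).md.differentiableAt hq), fderiv_const_mul (hL.differentiableAt hq)]
      simp [pd]
    rw [h2, pd_sum (fun j => ((hu i).pd j).pd j) i hq, md_pd (hu i) i hq]
    have h3 : ∀ j, pd i (pd j (pd j (uc i S))) q = pd j (pd j (pd i (uc i S))) q := fun j => by
      rw [pd_comm ((hu i).pd j) i j hq]
      exact pd_congr (fun q hq => pd_comm (hu i) i j hq) j hq
    simp_rw [h3]
    ring
  have hdiv : ∀ q ∈ slab d S.T, ∑ i, pd i (uc i S) q = 0 := S.divergence
  have hzero : ∀ F : Pt d → ℝ, (∀ q ∈ slab d S.T, F q = 0) → ∀ q ∈ slab d S.T,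
      fderiv ℝ F q = 0 := fun F hF q hq => by
    have : F =ᶠ[𝓝 q] fun _ => 0 := by filter_upwards [slab_mem_nhds hq] with y hy using hF y hy
    rw [this.fderiv_eq]
    simp
  have hd1 : ∀ j, ∀ q ∈ slab d S.T, ∑ i, pd j (pd i (uc i S)) q = 0 := fun j q hq => by
    rw [← pd_sum (fun i => (hu i).pd i) j hq, pd, hzero _ hdiv q hq]; rfl
  have hd2 : ∀ j, ∑ i, pd j (pd j (pd i (uc i S))) q = 0 := fun j => by
    rw [← pd_sum (fun i => ((hu i).pd i).pd j) j hq, pd, hzero _ (hd1 j) q hq]; rfl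
  have hd3 : ∑ i, md S (pd i (uc i S)) q = 0 := by
    have : md S (fun q => ∑ i, pd i (uc i S) q) q = ∑ i, md S (pd i (uc i S)) q := by
      rw [md, fderiv_fun_sum fun i _ => ((hu i).pd i).differentiableAt hq]
      simp [md]
    rw [← this, md, hzero _ hdiv q hq]; rfl
  simp_rw [hpi, Finset.sum_sub_distrib, ← Finset.mul_sum]
  rw [Finset.sum_comm, hd3]
  simp [hd2]

end Flow

section Words

variable {d : ℕ} {α : ℝ}

/-- Components of the velocity with `k` material and `j` spatial derivatives applied. -/
inductive Word : ℕ → ℕ → (Flow d α → Pt d → ℝ) → Prop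
  | base (i : Fin d) : Word 0 0 (uc i)
  | md {k j : ℕ} {F : Flow d α → Pt d → ℝ} : Word k j F → Word (k + 1) j fun S => md S (F S)
  | pd {k j : ℕ} {F : Flow d α → Pt d → ℝ} (l : Fin d) :
      Word k j F → Word k (j + 1) fun S => pd l (F S)

lemma Word.isField {k j : ℕ} {F : Flow d α → Pt d → ℝ} (hF : Word k j F) (S : Flow d α) :
    IsField S.T (F S) := by
  induction hF with
  | base i => exact field_uc S i
  | md _ ih => exact ih.md
  | pd l _ ih => exact ih.pd l

/-- Sums of products of `n` increments of words with `k` material and `j` spatial derivatives in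
total. -/
inductive Inc : ℕ → ℕ → ℕ → (Flow d α → Pt d → Sp d → ℝ) → Prop
  | one {k j : ℕ} {F : Flow d α → Pt d → ℝ} : Word k j F → Inc 1 k j fun S => dl (F S)
  | mul {n k j n' k' j' : ℕ} {g g' : Flow d α → Pt d → Sp d → ℝ} : Inc n k j g → Inc n' k' j' g' →
      Inc (n + n') (k + k') (j + j') fun S q z => g S q z * g' S q z
  | add {n k j : ℕ} {g g' : Flow d α → Pt d → Sp d → ℝ} : Inc n k j g → Inc n k j g' →
      Inc n k j fun S q z => g S q z + g' S q z

end Words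

section Regularity

variable {d : ℕ} {T : ℝ}

/-- Smooth kernels vanishing to order `n` at the origin, uniformly on compact time intervals. -/
structure IncReg (T : ℝ) (n : ℕ) (g : Pt d → Sp d → ℝ) : Prop where
  smooth : ContDiffOn ℝ ∞ (fun p : Pt d × Sp d => g p.1 p.2) (slab d T ×ˢ univ)
  bound : ∀ c e : ℝ, 0 < c → e < T → ∃ B : ℝ, 0 ≤ B ∧ ∀ q : Pt d, q.1 ∈ Icc c e → ∀ z,
    |g q z| ≤ B * min 1 ‖z‖ ^ n ∧ ‖fderiv ℝ (fun q => g q z) q‖ ≤ B * min 1 ‖z‖ ^ n ∧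
      ‖fderiv ℝ (g q) z‖ ≤ B

lemma slab_subset {c e : ℝ} (hc : 0 < c) (he : e < T) {q : Pt d} (hq : q.1 ∈ Icc c e) :
    q ∈ slab d T := mem_slab.2 ⟨hc.trans_le hq.1, hq.2.trans_lt he⟩

namespace IncReg

variable {n n' : ℕ} {g g' : Pt d → Sp d → ℝ}

lemma contDiffAt (hg : IncReg T n g) {q : Pt d} (hq : q ∈ slab d T) (z : Sp d) :
    ContDiffAt ℝ ∞ (fun p : Pt d × Sp d => g p.1 p.2) (q, z) :=
  hg.smooth.contDiffAt ((isOpen_slab.prod isOpen_univ).mem_nhds ⟨hq, mem_univ _⟩)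

lemma differentiableAt_left (hg : IncReg T n g) {q : Pt d} (hq : q ∈ slab d T) (z : Sp d) :
    DifferentiableAt ℝ (fun q => g q z) q :=
  ((hg.contDiffAt hq z).differentiableAt (by simp)).comp (f := fun q => (q, z)) q (by fun_prop)

lemma contDiff_right (hg : IncReg T n g) {q : Pt d} (hq : q ∈ slab d T) :
    ContDiff ℝ ∞ (g q) :=
  contDiff_iff_contDiffAt.2 fun z =>
    (hg.contDiffAt hq z).comp (f := fun z => (q, z)) z (by fun_prop)

lemma differentiable_right (hg : IncReg T n g) {q : Pt d} (hq : q ∈ slab d T) :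
    Differentiable ℝ (g q) := (hg.contDiff_right hq).differentiable (by simp)

lemma continuousOn_fderiv (hg : IncReg T n g) {q : Pt d} (hq : q ∈ slab d T) :
    Continuous fun z => fderiv ℝ (fun q => g q z) q := by
  have h : ∀ z, fderiv ℝ (fun q => g q z) q
      = (fderiv ℝ (fun p : Pt d × Sp d => g p.1 p.2) (q, z)).comp (.inl ℝ (Pt d) (Sp d)) :=
    fun z => by
    have h1 : HasFDerivAt (fun q : Pt d => (q, z)) (.inl ℝ (Pt d) (Sp d)) q :=
      hasFDerivAt_prodMk_left q z
    exact (((hg.contDiffAt hq z).differentiableAt (by simp)).hasFDerivAt.comp q h1).fderiv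
  simp_rw [h]
  have h2 : ContinuousOn (fderiv ℝ (fun p : Pt d × Sp d => g p.1 p.2)) (slab d T ×ˢ univ) :=
    hg.smooth.continuousOn_fderiv_of_isOpen (isOpen_slab.prod isOpen_univ) (by simp)
  have h3 : Continuous fun z : Sp d => fderiv ℝ (fun p : Pt d × Sp d => g p.1 p.2) (q, z) :=
    h2.comp_continuous (by fun_prop) fun z => ⟨hq, mem_univ _⟩
  exact h3.clm_comp continuous_const

lemma dl_isField {F : Pt d → ℝ} (hF : IsField T F) : IncReg T 1 (dl F) := by
  refine ⟨?_, fun c e hc he => ?_⟩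
  · refine ContDiffOn.sub (hF.smooth.comp (by fun_prop) fun p hp => ?_)
      (hF.smooth.comp (by fun_prop) fun p hp => hp.1)
    exact add_mem_slab hp.1 _
  obtain ⟨B₀, h0, hB₀⟩ := hF.norm_dl_le F hc he
  obtain ⟨B₁, h1, hB₁⟩ := hF.fderiv.norm_dl_le _ hc he
  obtain ⟨B₂, h2, hB₂⟩ := hF.fderiv.bounded hc he
  refine ⟨B₀ + B₁ + B₂, by positivity, fun q hq z => ?_⟩
  have hz : 0 ≤ min 1 ‖z‖ := by positivity
  have hs := slab_subset hc he hq
  have hd : HasFDerivAt (fun q => dl F q z) (dl (fderiv ℝ F) q z) q := by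
    refine HasFDerivAt.sub ?_ (hF.differentiableAt hs).hasFDerivAt
    exact (hasFDerivAt_comp_add_right _).2 (hF.differentiableAt (add_mem_slab hs z)).hasFDerivAt
  have hd' : HasFDerivAt (dl F q) ((fderiv ℝ F (q + (0, z))).comp (.inr ℝ ℝ (Sp d))) z := by
    have h3 : HasFDerivAt (fun z : Sp d => q + ((0 : ℝ), z)) (.inr ℝ ℝ (Sp d)) z :=
      (hasFDerivAt_prodMk_right (0 : ℝ) z).const_add q
    exact ((hF.differentiableAt (add_mem_slab hs z)).hasFDerivAt.comp z h3).sub_const _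
  refine ⟨?_, ?_, ?_⟩
  · rw [pow_one]
    refine (hB₀ q hq z).trans ?_
    gcongr
    linarith
  · rw [hd.fderiv, pow_one]
    refine (hB₁ q hq z).trans ?_
    gcongr
    linarith
  · rw [hd'.fderiv]
    refine (ContinuousLinearMap.opNorm_comp_le _ _).trans ?_
    have h4 := ContinuousLinearMap.norm_inr_le_one ℝ ℝ (Sp d)
    have h5 := hB₂ (q + (0, z)) (by simpa using hq)
    calc _ ≤ B₂ * 1 := by gcongr
      _ ≤ _ := by linarith

lemma mul (hg : IncReg T n g) (hg' : IncReg T n' g') :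
    IncReg T (n + n') fun q z => g q z * g' q z := by
  refine ⟨hg.smooth.mul hg'.smooth, fun c e hc he => ?_⟩
  obtain ⟨B, h, hB⟩ := hg.bound c e hc he
  obtain ⟨B', h', hB'⟩ := hg'.bound c e hc he
  refine ⟨2 * (B * B'), by positivity, fun q hq z => ?_⟩
  obtain ⟨b1, b2, b3⟩ := hB q hq z
  obtain ⟨c1, c2, c3⟩ := hB' q hq z
  have hs := slab_subset hc he hq
  set m := min 1 ‖z‖ with hm
  have hm0 : 0 ≤ m := by positivity
  have hm1 : m ≤ 1 := min_le_left _ _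
  refine ⟨?_, ?_, ?_⟩
  · rw [abs_mul, pow_add]
    calc _ ≤ (B * m ^ n) * (B' * m ^ n') := by gcongr
      _ ≤ _ := by
        have : 0 ≤ B * B' * (m ^ n * m ^ n') := by positivity
        nlinarith
  · rw [fderiv_fun_mul (hg.differentiableAt_left hs z) (hg'.differentiableAt_left hs z)]
    refine (norm_add_le _ _).trans ?_
    rw [norm_smul, norm_smul, Real.norm_eq_abs, Real.norm_eq_abs, pow_add]
    calc _ ≤ (B * m ^ n) * (B' * m ^ n') + (B' * m ^ n') * (B * m ^ n) := by gcongr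
      _ = _ := by ring
  · rw [show (fun z => g q z * g' q z) = fun z => g q z * g' q z from rfl,
      fderiv_fun_mul (hg.differentiable_right hs z) (hg'.differentiable_right hs z)]
    refine (norm_add_le _ _).trans ?_
    rw [norm_smul, norm_smul, Real.norm_eq_abs, Real.norm_eq_abs]
    have e1 : |g q z| ≤ B := b1.trans (mul_le_of_le_one_right h (pow_le_one₀ hm0 hm1))
    have e2 : |g' q z| ≤ B' := c1.trans (mul_le_of_le_one_right h' (pow_le_one₀ hm0 hm1))
    calc _ ≤ B * B' + B' * B := by gcongr
      _ = _ := by ring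

lemma add (hg : IncReg T n g) (hg' : IncReg T n g') :
    IncReg T n fun q z => g q z + g' q z := by
  refine ⟨hg.smooth.add hg'.smooth, fun c e hc he => ?_⟩
  obtain ⟨B, h, hB⟩ := hg.bound c e hc he
  obtain ⟨B', h', hB'⟩ := hg'.bound c e hc he
  refine ⟨B + B', by positivity, fun q hq z => ?_⟩
  obtain ⟨b1, b2, b3⟩ := hB q hq z
  obtain ⟨c1, c2, c3⟩ := hB' q hq z
  have hs := slab_subset hc he hq
  refine ⟨?_, ?_, ?_⟩
  · rw [add_mul]
    exact (abs_add_le _ _).trans (add_le_add b1 c1)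
  · rw [fderiv_fun_add (hg.differentiableAt_left hs z) (hg'.differentiableAt_left hs z), add_mul]
    exact (norm_add_le _ _).trans (add_le_add b2 c2)
  · rw [fderiv_fun_add (hg.differentiable_right hs z) (hg'.differentiable_right hs z)]
    exact (norm_add_le _ _).trans (add_le_add b3 c3)

end IncReg

end Regularity

section Increments

variable {d : ℕ} {α : ℝ} {n k j : ℕ} {g : Flow d α → Pt d → Sp d → ℝ}

lemma Inc.reg (hg : Inc n k j g) (S : Flow d α) : IncReg S.T n (g S) := by
  induction hg with
  | one hF => exact .dl_isField (hF.isField S)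
  | mul _ _ h h' => exact h.mul h'
  | add _ _ h h' => exact h.add h'

lemma Inc.pos (hg : Inc n k j g) : 1 ≤ n := by
  induction hg with
  | one hF => rfl
  | mul _ _ h h' => omega
  | add _ _ h h' => exact h

lemma fderiv_dl_left {T : ℝ} {F : Pt d → ℝ} (hF : IsField T F) {q : Pt d} (hq : q ∈ slab d T)
    (z : Sp d) (v : Pt d) :
    fderiv ℝ (fun q => dl F q z) q v = fderiv ℝ F (q + (0, z)) v - fderiv ℝ F q v := by
  have hd : HasFDerivAt (fun q => dl F q z) (fderiv ℝ F (q + (0, z)) - fderiv ℝ F q) q := by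
    refine HasFDerivAt.sub ?_ (hF.differentiableAt hq).hasFDerivAt
    exact (hasFDerivAt_comp_add_right _).2 (hF.differentiableAt (add_mem_slab hq z)).hasFDerivAt
  rw [hd.fderiv]
  rfl

lemma fderiv_dl_right {T : ℝ} {F : Pt d → ℝ} (hF : IsField T F) {q : Pt d} (hq : q ∈ slab d T)
    (z v : Sp d) : fderiv ℝ (dl F q) z v = fderiv ℝ F (q + (0, z)) (0, v) := by
  have hd' : HasFDerivAt (dl F q) ((fderiv ℝ F (q + (0, z))).comp (.inr ℝ ℝ (Sp d))) z := by
    have h3 : HasFDerivAt (fun z : Sp d => q + ((0 : ℝ), z)) (.inr ℝ ℝ (Sp d)) z :=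
      (hasFDerivAt_prodMk_right (0 : ℝ) z).const_add q
    exact ((hF.differentiableAt (add_mem_slab hq z)).hasFDerivAt.comp z h3).sub_const _
  rw [hd'.fderiv]
  simp

lemma Inc.pd (hg : Inc n k j g) (l : Fin d) : ∃ g', Inc n k (j + 1) g' ∧ ∀ S : Flow d α,
    ∀ q ∈ slab d S.T, ∀ z, fderiv ℝ (fun q => g S q z) q (0, unit l) = g' S q z := by
  induction hg with
  | one hF =>
    exact ⟨_, .one (hF.pd l), fun S q hq z => fderiv_dl_left (hF.isField S) hq z _⟩
  | @mul n k j n' k' j' g g' hg hg' h h' =>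
    obtain ⟨f, hf, e⟩ := h
    obtain ⟨f', hf', e'⟩ := h'
    have h1 : Inc (n + n') (k + k') (j + j' + 1) fun S q z => f S q z * g' S q z := by
      have := hf.mul hg'
      rwa [show j + 1 + j' = j + j' + 1 by ring] at this
    refine ⟨_, h1.add (hg.mul hf'), fun S q hq z => ?_⟩
    rw [fderiv_fun_mul ((hg.reg S).differentiableAt_left hq z)
      ((hg'.reg S).differentiableAt_left hq z)]
    simp [e S q hq z, e' S q hq z]
    ring
  | @add n k j g g' hg hg' h h' =>
    obtain ⟨f, hf, e⟩ := h
    obtain ⟨f', hf', e'⟩ := h'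
    refine ⟨_, hf.add hf', fun S q hq z => ?_⟩
    rw [fderiv_fun_add ((hg.reg S).differentiableAt_left hq z)
      ((hg'.reg S).differentiableAt_left hq z)]
    simp [e S q hq z, e' S q hq z]

lemma Inc.md (hg : Inc n k j g) : ∃ g', Inc n (k + 1) j g' ∧ ∀ S : Flow d α,
    ∀ q ∈ slab d S.T, ∀ z, fderiv ℝ (fun q => g S q z) q (1, S.u q)
      = g' S q z - ∑ l, dl (uc l S) q z * fderiv ℝ (g S q) z (unit l) := by
  induction hg with
  | @one k j F hF =>
    refine ⟨_, .one hF.md, fun S q hq z => ?_⟩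
    have hf := hF.isField S
    rw [fderiv_dl_left hf hq]
    have h1 : ((1 : ℝ), S.u (q + (0, z))) = (1, S.u q) + (0, S.u (q + (0, z)) - S.u q) := by simp
    have h2 : Lagrangian.md S (F S) (q + (0, z)) = fderiv ℝ (F S) (q + (0, z)) (1, S.u q)
        + ∑ l, dl (uc l S) q z * fderiv ℝ (dl (F S) q) z (unit l) := by
      rw [Lagrangian.md, h1, map_add, apply_zero_right]
      simp_rw [fderiv_dl_right hf hq]
      rfl
    rw [dl, h2, Lagrangian.md]
    ring
  | @mul n k j n' k' j' g g' hg hg' h h' =>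
    obtain ⟨f, hf, e⟩ := h
    obtain ⟨f', hf', e'⟩ := h'
    have h1 : Inc (n + n') (k + k' + 1) (j + j') fun S q z => f S q z * g' S q z := by
      have := hf.mul hg'
      rwa [show k + 1 + k' = k + k' + 1 by ring] at this
    refine ⟨_, h1.add (hg.mul hf'), fun S q hq z => ?_⟩
    have h2 : ∀ l, fderiv ℝ (fun z => g S q z * g' S q z) z (unit l)
        = g S q z * fderiv ℝ (g' S q) z (unit l) + g' S q z * fderiv ℝ (g S q) z (unit l) :=
      fun l => by
        rw [fderiv_fun_mul ((hg.reg S).differentiable_right hq z)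
          ((hg'.reg S).differentiable_right hq z)]
        simp
    rw [fderiv_fun_mul ((hg.reg S).differentiableAt_left hq z)
      ((hg'.reg S).differentiableAt_left hq z)]
    simp only [h2, add_apply, smul_apply, smul_eq_mul, e S q hq z,
      e' S q hq z, mul_sub, mul_add, Finset.sum_add_distrib, Finset.mul_sum]
    simp_rw [mul_left_comm]
    ring
  | @add n k j g g' hg hg' h h' =>
    obtain ⟨f, hf, e⟩ := h
    obtain ⟨f', hf', e'⟩ := h'
    refine ⟨_, hf.add hf', fun S q hq z => ?_⟩
    have h2 : ∀ l, fderiv ℝ (fun z => g S q z + g' S q z) z (unit l)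
        = fderiv ℝ (g S q) z (unit l) + fderiv ℝ (g' S q) z (unit l) :=
      fun l => by
        rw [fderiv_fun_add ((hg.reg S).differentiable_right hq z)
          ((hg'.reg S).differentiable_right hq z)]
        simp
    rw [fderiv_fun_add ((hg.reg S).differentiableAt_left hq z)
      ((hg'.reg S).differentiableAt_left hq z)]
    simp only [h2, add_apply, e S q hq z, e' S q hq z, mul_add,
      Finset.sum_add_distrib]
    ring

end Increments

section Scale

variable {d : ℕ} {T : ℝ}

/-- The measure `dλ dζ` on scales above `ℓ`. -/
noncomputable def scale (d : ℕ) (ℓ : ℝ) : Measure (ℝ × Sp d) :=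
  (volume.restrict (Ioi ℓ)).prod volume

lemma scale_eq (ℓ : ℝ) : scale d ℓ = volume.restrict (Ioi ℓ ×ˢ univ) := by
  rw [scale, Measure.volume_eq_prod, ← Measure.prod_restrict, Measure.restrict_univ]

lemma ae_scale (ℓ : ℝ) : ∀ᵐ p ∂scale d ℓ, ℓ < p.1 := by
  rw [scale_eq]
  filter_upwards [ae_restrict_mem (measurableSet_Ioi.prod MeasurableSet.univ)] with p hp using hp.1

lemma aestronglyMeasurable_scale {V : Type*} [TopologicalSpace V]
    [TopologicalSpace.PseudoMetrizableSpace V] {f : ℝ × Sp d → V} {ℓ : ℝ} (hℓ : 0 ≤ ℓ)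
    (hf : ContinuousOn f (Ioi 0 ×ˢ univ)) : AEStronglyMeasurable f (scale d ℓ) := by
  rw [scale_eq]
  exact (hf.mono (prod_mono (Ioi_subset_Ioi hℓ) subset_rfl)).aestronglyMeasurable
    (measurableSet_Ioi.prod MeasurableSet.univ)

/-- Conditions under which the `n`-linear integral with weight `λ⁻ᴺ` converges. -/
def Conv (N : ℕ) (ℓ : ℝ) (n : ℕ) : Prop := 0 ≤ ℓ ∧ 2 ≤ N ∧ (0 < ℓ ∨ N ≤ n)

lemma integrableOn_inv_sq {c : ℝ} (hc : 0 < c) : IntegrableOn (fun s : ℝ => (s ^ 2)⁻¹) (Ioi c) := by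
  have := integrableOn_Ioi_rpow_of_lt (a := -2) (by norm_num) hc
  refine this.congr_fun (fun s hs => ?_) measurableSet_Ioi
  have hs' : 0 < s := hc.trans hs
  simp only
  rw [Real.rpow_neg hs'.le]
  norm_cast

lemma Conv.integrableOn {N n : ℕ} {ℓ : ℝ} (h : Conv N ℓ n) :
    IntegrableOn (fun s : ℝ => (s ^ N)⁻¹ * min 1 s ^ n) (Ioi ℓ) := by
  obtain ⟨h0, hN, h⟩ := h
  have hcont : ContinuousOn (fun s : ℝ => (s ^ N)⁻¹ * min 1 s ^ n) (Ioi 0) := by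
    refine ContinuousOn.mul (ContinuousOn.inv₀ (by fun_prop) fun s hs => ?_) (by fun_prop)
    exact pow_ne_zero _ (ne_of_gt hs)
  have key : ∀ c > 0, IntegrableOn (fun s : ℝ => (s ^ N)⁻¹ * min 1 s ^ n) (Ioi c) := fun c hc => by
    refine ((integrableOn_inv_sq hc).const_mul ((c ^ (N - 2))⁻¹)).mono'
      ((hcont.mono (Ioi_subset_Ioi hc.le)).aestronglyMeasurable measurableSet_Ioi) ?_
    filter_upwards [ae_restrict_mem measurableSet_Ioi] with s hs
    have hs' : c < s := hs
    have hs0 : 0 < s := hc.trans hs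
    rw [Real.norm_of_nonneg (by positivity), ← mul_inv]
    calc (s ^ N)⁻¹ * min 1 s ^ n ≤ (s ^ N)⁻¹ * 1 := by
          gcongr
          exact pow_le_one₀ (by positivity) (min_le_left _ _)
      _ ≤ _ := by
          rw [mul_one]
          gcongr
          calc c ^ (N - 2) * s ^ 2 ≤ s ^ (N - 2) * s ^ 2 := by gcongr
            _ = s ^ N := by rw [← pow_add]; congr 1; omega
  rcases h with h | h
  · exact key ℓ h
  · have h1 : IntegrableOn (fun s : ℝ => (s ^ N)⁻¹ * min 1 s ^ n) (Ioc 0 1) := by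
      refine (integrableOn_const (C := (1 : ℝ)) (by simp)).mono'
        ((hcont.mono fun s hs => hs.1).aestronglyMeasurable measurableSet_Ioc) ?_
      filter_upwards [ae_restrict_mem measurableSet_Ioc] with s hs
      have hs0 : 0 < s := hs.1
      rw [Real.norm_of_nonneg (by positivity), min_eq_right hs.2, inv_mul_le_iff₀ (by positivity),
        mul_one]
      exact pow_le_pow_of_le_one hs0.le hs.2 h
    refine (h1.union (key 1 one_pos)).mono_set fun s hs => ?_
    have hs : 0 < s := h0.trans_lt hs
    rcases le_total s 1 with h | h
    · exact .inl ⟨hs, h⟩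
    · rcases h.lt_or_eq with h | h
      · exact .inr h
      · exact .inl ⟨hs, h.ge⟩

lemma integrable_scale_weight {ℓ : ℝ} {w : ℝ → ℝ} (hw : IntegrableOn w (Ioi ℓ)) (Ψ : 𝓢(Sp d, ℝ))
    (n : ℕ) : Integrable (fun p : ℝ × Sp d => w p.1 * (|Ψ p.2| * (1 + ‖p.2‖) ^ n)) (scale d ℓ) :=
  hw.mul_prod (integrable_kw Ψ n)

/-- Bound for an integral over scales by the product of one-dimensional integrals. -/
lemma abs_integral_scale_le {ℓ : ℝ} {w : ℝ → ℝ} (hw : IntegrableOn w (Ioi ℓ)) (Ψ : 𝓢(Sp d, ℝ))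
    (n : ℕ) {f : ℝ × Sp d → ℝ}
    (hf : ∀ s, ℓ < s → ∀ z, |f (s, z)| ≤ w s * (|Ψ z| * (1 + ‖z‖) ^ n)) :
    |∫ p, f p ∂scale d ℓ| ≤ (∫ s in Ioi ℓ, w s) * kw Ψ n := by
  rw [kw, ← integral_prod_mul (μ := volume.restrict (Ioi ℓ)) (ν := volume) w
    (fun z => |Ψ z| * (1 + ‖z‖) ^ n)]
  refine norm_integral_le_of_norm_le (f := f) (integrable_scale_weight hw Ψ n) ?_
  filter_upwards [ae_scale ℓ] with p hp using hf p.1 hp p.2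

lemma min_one_norm_smul_le {s : ℝ} (hs : 0 < s) (z : Sp d) :
    min 1 ‖s • z‖ ≤ min 1 s * (1 + ‖z‖) := by
  have hz := norm_nonneg z
  rw [norm_smul, Real.norm_of_nonneg hs.le]
  rcases le_total 1 s with h | h
  · rw [min_eq_left h]
    exact (min_le_left _ _).trans (by linarith)
  · rw [min_eq_right h]
    refine (min_le_right _ _).trans ?_
    nlinarith

lemma exists_time_nhds {q : Pt d} (hq : q ∈ slab d T) : ∃ c e : ℝ, 0 < c ∧ e < T ∧
    q.1 ∈ Icc c e ∧ {q' : Pt d | q'.1 ∈ Icc c e} ∈ 𝓝 q := by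
  obtain ⟨h0, h1⟩ := mem_slab.1 hq
  refine ⟨q.1 / 2, (q.1 + T) / 2, by linarith, by linarith, ⟨by linarith, by linarith⟩, ?_⟩
  exact continuous_fst.continuousAt (Icc_mem_nhds (by linarith) (by linarith))

/-- The multilinear singular integral with weight `λ⁻ᴺ` over scales `λ > ℓ`. -/
noncomputable def scaleInt (N : ℕ) (ℓ : ℝ) (Ψ : 𝓢(Sp d, ℝ)) (g : Pt d → Sp d → ℝ) (q : Pt d) : ℝ :=
  ∫ p, (p.1 ^ N)⁻¹ * Ψ p.2 * g q (p.1 • p.2) ∂scale d ℓ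

lemma abs_kernel_le {N n : ℕ} (Ψ : 𝓢(Sp d, ℝ)) {s B x : ℝ} {z : Sp d} (hs : 0 < s)
    (hx : |x| ≤ B * min 1 ‖s • z‖ ^ n) (hB : 0 ≤ B) :
    |(s ^ N)⁻¹ * Ψ z * x| ≤ B * ((s ^ N)⁻¹ * min 1 s ^ n * (|Ψ z| * (1 + ‖z‖) ^ n)) := by
  rw [abs_mul, abs_mul, abs_of_nonneg (by positivity : 0 ≤ (s ^ N)⁻¹)]
  calc _ ≤ (s ^ N)⁻¹ * |Ψ z| * (B * (min 1 s * (1 + ‖z‖)) ^ n) := by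
        gcongr
        refine hx.trans ?_
        gcongr
        exact min_one_norm_smul_le hs z
    _ = _ := by rw [mul_pow]; ring

variable {N n : ℕ} {ℓ : ℝ} {g : Pt d → Sp d → ℝ} {q : Pt d}

namespace IncReg

lemma continuousOn_kernel (Ψ : 𝓢(Sp d, ℝ)) (hg : IncReg T n g) (hq : q ∈ slab d T) :
    ContinuousOn (fun p : ℝ × Sp d => (p.1 ^ N)⁻¹ * Ψ p.2 * g q (p.1 • p.2)) (Ioi 0 ×ˢ univ) := by
  refine ContinuousOn.mul (ContinuousOn.mul (ContinuousOn.inv₀ (by fun_prop) fun p hp => ?_)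
    (Ψ.continuous.comp continuous_snd).continuousOn)
    ((hg.contDiff_right hq).continuous.comp (by fun_prop)).continuousOn
  exact pow_ne_zero _ (ne_of_gt hp.1)

lemma integrable (Ψ : 𝓢(Sp d, ℝ)) (hg : IncReg T n g) (hc : Conv N ℓ n) (hq : q ∈ slab d T) :
    Integrable (fun p : ℝ × Sp d => (p.1 ^ N)⁻¹ * Ψ p.2 * g q (p.1 • p.2)) (scale d ℓ) := by
  obtain ⟨c, e, h0, h1, h2, -⟩ := exists_time_nhds hq
  obtain ⟨B, hB0, hB⟩ := hg.bound c e h0 h1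
  refine ((integrable_scale_weight hc.integrableOn Ψ n).const_mul B).mono'
    (aestronglyMeasurable_scale hc.1 (hg.continuousOn_kernel Ψ hq)) ?_
  filter_upwards [ae_scale ℓ] with p hp
  exact abs_kernel_le Ψ (hc.1.trans_lt hp) (hB q h2 _).1 hB0

lemma hasFDerivAt_scaleInt (Ψ : 𝓢(Sp d, ℝ)) (hg : IncReg T n g) (hc : Conv N ℓ n)
    (hq : q ∈ slab d T) :
    DifferentiableAt ℝ (scaleInt N ℓ Ψ g) q ∧ ∀ v, fderiv ℝ (scaleInt N ℓ Ψ g) q v =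
      ∫ p, (p.1 ^ N)⁻¹ * Ψ p.2 * fderiv ℝ (fun q => g q (p.1 • p.2)) q v ∂scale d ℓ ∧
      Integrable (fun p : ℝ × Sp d => (p.1 ^ N)⁻¹ * Ψ p.2 *
        fderiv ℝ (fun q => g q (p.1 • p.2)) q v) (scale d ℓ) := by
  obtain ⟨c, e, h0, h1, h2, h3⟩ := exists_time_nhds hq
  obtain ⟨B, hB0, hB⟩ := hg.bound c e h0 h1
  set F' : Pt d → ℝ × Sp d → Pt d →L[ℝ] ℝ := fun q p =>
    ((p.1 ^ N)⁻¹ * Ψ p.2) • fderiv ℝ (fun q => g q (p.1 • p.2)) q with hF'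
  have hmeas : AEStronglyMeasurable (F' q) (scale d ℓ) := by
    refine aestronglyMeasurable_scale hc.1 ?_
    refine ContinuousOn.smul (ContinuousOn.mul (ContinuousOn.inv₀ (by fun_prop) fun p hp => ?_)
      (Ψ.continuous.comp continuous_snd).continuousOn)
      ((hg.continuousOn_fderiv hq).comp
        (by fun_prop : Continuous fun p : ℝ × Sp d => p.1 • p.2)).continuousOn
    exact pow_ne_zero _ (ne_of_gt hp.1)
  have hbd : ∀ᵐ p ∂scale d ℓ, ∀ q ∈ {q' : Pt d | q'.1 ∈ Icc c e}, ‖F' q p‖ ≤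
      B * ((p.1 ^ N)⁻¹ * min 1 p.1 ^ n * (|Ψ p.2| * (1 + ‖p.2‖) ^ n)) := by
    filter_upwards [ae_scale ℓ] with p hp q hq
    have := abs_kernel_le (N := N) Ψ (hc.1.trans_lt hp)
      (x := ‖fderiv ℝ (fun q => g q (p.1 • p.2)) q‖)
      (by rw [abs_norm]; exact (hB q hq _).2.1) hB0
    rw [abs_mul, abs_norm] at this
    rwa [hF', norm_smul, Real.norm_eq_abs]
  have h_int := (integrable_scale_weight hc.integrableOn Ψ n).const_mul B
  have hF'int : Integrable (F' q) (scale d ℓ) :=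
    h_int.mono' hmeas (by filter_upwards [hbd] with p hp using hp q h2)
  have key : HasFDerivAt (scaleInt N ℓ Ψ g) (∫ p, F' q p ∂scale d ℓ) q := by
    refine hasFDerivAt_integral_of_dominated_of_fderiv_le (F' := F') h3 ?_
      (hg.integrable Ψ hc hq) hmeas hbd h_int ?_
    · filter_upwards [slab_mem_nhds hq] with q hq
      exact aestronglyMeasurable_scale hc.1 (hg.continuousOn_kernel Ψ hq)
    · refine ae_of_all _ fun p q hq => ?_
      exact (hg.differentiableAt_left (slab_subset h0 h1 hq) _).hasFDerivAt.const_mul _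
  refine ⟨key.differentiableAt, fun v => ⟨?_, hF'int.apply_continuousLinearMap v⟩⟩
  rw [key.fderiv, ContinuousLinearMap.integral_apply hF'int]
  rfl

end IncReg

/-- Integration by parts against a Schwartz kernel. -/
lemma integral_mul_fderiv_eq (Ψ : 𝓢(Sp d, ℝ)) {h : Sp d → ℝ} (hh : ContDiff ℝ 1 h) {B : ℝ}
    (hB : ∀ z, |h z| ≤ B) (hB' : ∀ z, ‖fderiv ℝ h z‖ ≤ B) (l : Fin d) :
    ∫ z, Ψ z * fderiv ℝ h z (unit l) = -∫ z, kd l Ψ z * h z := by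
  have hc := hh.continuous
  have hc' : Continuous fun z => fderiv ℝ h z (unit l) :=
    (hh.continuous_fderiv (by simp)).clm_apply continuous_const
  have hb : ∀ z, ‖fderiv ℝ h z (unit l)‖ ≤ B := fun z => by
    refine ((fderiv ℝ h z).le_opNorm _).trans ?_
    rw [norm_unit, mul_one]
    exact hB' z
  refine integral_mul_fderiv_eq_neg_fderiv_mul_of_integrable ?_ ?_ ?_
    (fun z _ => Ψ.differentiableAt) (fun z _ => hh.differentiable (by simp) z)
  · exact (kd l Ψ).integrable.mul_bdd hc.aestronglyMeasurable (ae_of_all _ hB)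
  · exact Ψ.integrable.mul_bdd hc'.aestronglyMeasurable (ae_of_all _ hb)
  · exact Ψ.integrable.mul_bdd hc.aestronglyMeasurable (ae_of_all _ hB)

end Scale

section Transport

variable {d : ℕ} {α : ℝ} {n : ℕ} {S : Flow d α} {g : Pt d → Sp d → ℝ} {q : Pt d}

lemma abs_le_of_incReg_bound {B x : ℝ} {z : Sp d} (hB : 0 ≤ B) (h : |x| ≤ B * min 1 ‖z‖ ^ n) :
    |x| ≤ B :=
  h.trans (mul_le_of_le_one_right hB (pow_le_one₀ (by positivity) (min_le_left _ _)))

/-- Integration by parts of the relative transport term, using incompressibility. -/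
lemma integral_transport (Ψ : 𝓢(Sp d, ℝ)) (hg : IncReg S.T n g) (hq : q ∈ slab d S.T) {s : ℝ}
    (hs : 0 < s) :
    ∫ z, Ψ z * ∑ l, dl (uc l S) q (s • z) * fderiv ℝ (g q) (s • z) (unit l)
      = -(s⁻¹ * ∑ l, ∫ z, kd l Ψ z * (g q (s • z) * dl (uc l S) q (s • z))) := by
  obtain ⟨c, e, h0, h1, h2, -⟩ := exists_time_nhds hq
  have hreg : ∀ l, IncReg S.T (n + 1) fun q z => g q z * dl (uc l S) q z := fun l =>
    hg.mul (.dl_isField (field_uc S l))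
  have hd : ∀ l z, fderiv ℝ (fun z => g q (s • z) * dl (uc l S) q (s • z)) z (unit l)
      = s * (dl (uc l S) q (s • z) * fderiv ℝ (g q) (s • z) (unit l)
        + g q (s • z) * pd l (uc l S) (q + (0, s • z))) := fun l z => by
    have h3 : HasFDerivAt (fun z : Sp d => s • z) (s • ContinuousLinearMap.id ℝ (Sp d)) z :=
      (hasFDerivAt_id z).const_smul s
    have h4 := ((hreg l).differentiable_right hq (s • z)).hasFDerivAt.comp z h3
    have h5 : HasFDerivAt (fun z => g q (s • z) * dl (uc l S) q (s • z)) _ z := h4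
    rw [h5.fderiv, fderiv_fun_mul (hg.differentiable_right hq _)
      ((IncReg.dl_isField (field_uc S l)).differentiable_right hq _)]
    simp [fderiv_dl_right (field_uc S l) hq, pd]
    ring
  have hibp : ∀ l, ∫ z, Ψ z * fderiv ℝ (fun z => g q (s • z) * dl (uc l S) q (s • z)) z (unit l)
      = -∫ z, kd l Ψ z * (g q (s • z) * dl (uc l S) q (s • z)) := fun l => by
    obtain ⟨B, hB0, hB⟩ := (hreg l).bound c e h0 h1
    refine integral_mul_fderiv_eq Ψ (B := B * max 1 s) ?_ (fun z => ?_) (fun z => ?_) l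
    · exact (((hreg l).contDiff_right hq).of_le (by exact_mod_cast le_top)).comp
        (contDiff_const_smul s)
    · refine (abs_le_of_incReg_bound hB0 (hB q h2 (s • z)).1).trans ?_
      exact le_mul_of_one_le_right hB0 (le_max_left _ _)
    · have h3 : HasFDerivAt (fun z : Sp d => s • z) (s • ContinuousLinearMap.id ℝ (Sp d)) z :=
        (hasFDerivAt_id z).const_smul s
      have h4 := ((hreg l).differentiable_right hq (s • z)).hasFDerivAt.comp z h3
      have h5 : HasFDerivAt (fun z => g q (s • z) * dl (uc l S) q (s • z)) _ z := h4
      rw [h5.fderiv]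
      refine (ContinuousLinearMap.opNorm_comp_le _ _).trans ?_
      rw [norm_smul, Real.norm_of_nonneg hs.le]
      have := ContinuousLinearMap.norm_id_le (𝕜 := ℝ) (E := Sp d)
      have h6 := (hB q h2 (s • z)).2.2
      calc _ ≤ B * (s * 1) := by gcongr
        _ ≤ _ := by
          rw [mul_one]
          gcongr
          exact le_max_right _ _
  have h_int : ∀ l, Integrable fun z =>
      Ψ z * fderiv ℝ (fun z => g q (s • z) * dl (uc l S) q (s • z)) z (unit l) := fun l => by
    obtain ⟨B, hB0, hB⟩ := (hreg l).bound c e h0 h1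
    have hcd : ContDiff ℝ 1 fun z => g q (s • z) * dl (uc l S) q (s • z) :=
      (((hreg l).contDiff_right hq).of_le (by exact_mod_cast le_top)).comp (contDiff_const_smul s)
    refine Ψ.integrable.mul_bdd (c := B * s)
      ((hcd.continuous_fderiv (by simp)).clm_apply continuous_const).aestronglyMeasurable
      (ae_of_all _ fun z => ?_)
    have h3 : HasFDerivAt (fun z : Sp d => s • z) (s • ContinuousLinearMap.id ℝ (Sp d)) z :=
      (hasFDerivAt_id z).const_smul s
    have h4 := ((hreg l).differentiable_right hq (s • z)).hasFDerivAt.comp z h3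
    have h5 : HasFDerivAt (fun z => g q (s • z) * dl (uc l S) q (s • z)) _ z := h4
    rw [h5.fderiv]
    refine (ContinuousLinearMap.le_opNorm _ _).trans ?_
    rw [norm_unit, mul_one]
    refine (ContinuousLinearMap.opNorm_comp_le _ _).trans ?_
    rw [norm_smul, Real.norm_of_nonneg hs.le]
    have := ContinuousLinearMap.norm_id_le (𝕜 := ℝ) (E := Sp d)
    have h6 := (hB q h2 (s • z)).2.2
    calc _ ≤ B * (s * 1) := by gcongr
      _ = _ := by rw [mul_one]
  have hpt : ∀ z, Ψ z * ∑ l, dl (uc l S) q (s • z) * fderiv ℝ (g q) (s • z) (unit l)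
      = s⁻¹ * ∑ l, Ψ z * fderiv ℝ (fun z => g q (s • z) * dl (uc l S) q (s • z)) z (unit l) :=
    fun z => by
      have hdiv := S.divergence _ (add_mem_slab hq (s • z))
      have hdiv' : ∑ l, pd l (uc l S) (q + (0, s • z)) = 0 := hdiv
      simp_rw [hd, ← Finset.mul_sum, Finset.sum_add_distrib, ← Finset.mul_sum, hdiv']
      field_simp
      ring
  simp_rw [hpt]
  rw [integral_const_mul, integral_finsetSum _ fun l _ => h_int l]
  simp_rw [hibp]
  rw [Finset.sum_neg_distrib]
  ring

lemma scaleInt_eq_iterated {N : ℕ} {ℓ : ℝ} (Ψ : 𝓢(Sp d, ℝ)) (hg : IncReg S.T n g)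
    (hc : Conv N ℓ n) (hq : q ∈ slab d S.T) :
    scaleInt N ℓ Ψ g q = ∫ s in Ioi ℓ, (s ^ N)⁻¹ * ∫ z, Ψ z * g q (s • z) := by
  rw [scaleInt, scale, integral_prod _ (hg.integrable Ψ hc hq)]
  simp_rw [mul_assoc, integral_const_mul]

lemma Conv.succ {N : ℕ} {ℓ : ℝ} (hc : Conv N ℓ n) : Conv (N + 1) ℓ (n + 1) :=
  ⟨hc.1, by linarith [hc.2.1], hc.2.2.imp_right (by omega)⟩

lemma integral_scale_transport {N : ℕ} {ℓ : ℝ} (Ψ : 𝓢(Sp d, ℝ)) (hg : IncReg S.T n g)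
    (hc : Conv N ℓ n) (hq : q ∈ slab d S.T)
    (h_int : Integrable (fun p : ℝ × Sp d => (p.1 ^ N)⁻¹ * Ψ p.2 *
      ∑ l, dl (uc l S) q (p.1 • p.2) * fderiv ℝ (g q) (p.1 • p.2) (unit l)) (scale d ℓ)) :
    ∫ p, (p.1 ^ N)⁻¹ * Ψ p.2 *
      ∑ l, dl (uc l S) q (p.1 • p.2) * fderiv ℝ (g q) (p.1 • p.2) (unit l) ∂scale d ℓ
      = -∑ l, scaleInt (N + 1) ℓ (kd l Ψ) (fun q z => g q z * dl (uc l S) q z) q := by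
  have hreg : ∀ l, IncReg S.T (n + 1) fun q z => g q z * dl (uc l S) q z := fun l =>
    hg.mul (.dl_isField (field_uc S l))
  simp_rw [fun l => scaleInt_eq_iterated (kd l Ψ) (hreg l) hc.succ hq]
  rw [scale] at h_int ⊢
  rw [integral_prod _ h_int, ← integral_finsetSum, ← integral_neg]
  · refine setIntegral_congr_fun measurableSet_Ioi fun s hs => ?_
    have hs' : 0 < s := hc.1.trans_lt hs
    simp only [mul_assoc, integral_const_mul]
    rw [integral_transport Ψ hg hq hs', ← Finset.mul_sum, pow_succ, mul_inv]
    ring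
  · intro l _
    have := ((hreg l).integrable (kd l Ψ) hc.succ hq).integral_prod_left
    simpa only [mul_assoc, integral_const_mul] using this

end Transport

section Singular

variable {d : ℕ} {α : ℝ}

/-- Combinations of multilinear singular integrals, truncated at scale `ℓ`, with `K` material and
`j` spatial derivatives; the excess `e` counts the derivatives moved onto the kernel. -/
inductive Sing (e : ℕ) : ℕ → ℕ → (Flow d α → ℝ → Pt d → ℝ) → Prop
  | zero {K j : ℕ} : Sing e K j fun _ _ _ => 0
  | base {n k K j : ℕ} {g : Flow d α → Pt d → Sp d → ℝ} (Ψ : 𝓢(Sp d, ℝ)) (hg : Inc n k j g)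
      (hn : 2 ≤ n) (hK : k + n = K + 2) : Sing e K j fun S ℓ => scaleInt (n + e) ℓ Ψ (g S)
  | add {K j : ℕ} {P P' : Flow d α → ℝ → Pt d → ℝ} (hP : Sing e K j P) (hP' : Sing e K j P') :
      Sing e K j fun S ℓ q => P S ℓ q + P' S ℓ q

namespace Sing

variable {e K j : ℕ}

lemma sum {ι : Type*} {s : Finset ι} {P : ι → Flow d α → ℝ → Pt d → ℝ}
    (hP : ∀ i, Sing e K j (P i)) : Sing e K j fun S ℓ q => ∑ i ∈ s, P i S ℓ q := by
  classical
  induction s using Finset.induction_on with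
  | empty => simpa using Sing.zero
  | insert a s ha ih => simpa [Finset.sum_insert ha] using (hP a).add ih

lemma smul {P : Flow d α → ℝ → Pt d → ℝ} (c : ℝ) (hP : Sing e K j P) :
    Sing e K j fun S ℓ q => c * P S ℓ q := by
  induction hP with
  | zero => simpa using Sing.zero
  | @base n k K j g Ψ hg hn hK =>
    have : (fun S ℓ q => c * scaleInt (n + e) ℓ Ψ (g S) q)
        = fun S ℓ => scaleInt (n + e) ℓ (c • Ψ) (g S) := by
      funext S ℓ q
      rw [scaleInt, scaleInt, ← integral_const_mul]
      congr 1
      funext p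
      simp only [smul_apply, smul_eq_mul]
      ring
    rw [this]
    exact .base _ hg hn hK
  | add _ _ h h' =>
    simp_rw [mul_add]
    exact h.add h'

lemma conv {n : ℕ} (hn : 2 ≤ n) {ℓ : ℝ} (hℓ : 0 ≤ ℓ) (he : 0 < ℓ ∨ e = 0) : Conv (n + e) ℓ n :=
  ⟨hℓ, by omega, he.imp_right (by omega)⟩

lemma pd {P : Flow d α → ℝ → Pt d → ℝ} (hP : Sing e K j P) (l : Fin d) :
    ∃ P', Sing e K (j + 1) P' ∧ ∀ S : Flow d α, ∀ ℓ, 0 ≤ ℓ → (0 < ℓ ∨ e = 0) → ∀ q ∈ slab d S.T,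
      DifferentiableAt ℝ (P S ℓ) q ∧ fderiv ℝ (P S ℓ) q (0, unit l) = P' S ℓ q := by
  induction hP with
  | zero => exact ⟨_, .zero, fun S ℓ _ _ q _ => ⟨by fun_prop, by simp⟩⟩
  | @base n k K j g Ψ hg hn hK =>
    obtain ⟨g', hg', h⟩ := hg.pd l
    refine ⟨_, .base Ψ hg' hn hK, fun S ℓ hℓ he q hq => ?_⟩
    obtain ⟨h1, h2⟩ := (hg.reg S).hasFDerivAt_scaleInt Ψ (conv hn hℓ he) hq
    refine ⟨h1, ?_⟩
    rw [(h2 _).1, scaleInt]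
    simp_rw [h S q hq]
  | add _ _ h h' =>
    obtain ⟨f, hf, h⟩ := h
    obtain ⟨f', hf', h'⟩ := h'
    refine ⟨_, hf.add hf', fun S ℓ hℓ he q hq => ?_⟩
    obtain ⟨h1, h2⟩ := h S ℓ hℓ he q hq
    obtain ⟨h1', h2'⟩ := h' S ℓ hℓ he q hq
    refine ⟨h1.add h1', ?_⟩
    rw [fderiv_fun_add h1 h1', add_apply, h2, h2']

lemma md {P : Flow d α → ℝ → Pt d → ℝ} (hP : Sing e K j P) :
    ∃ P', Sing e (K + 1) j P' ∧ ∀ S : Flow d α, ∀ ℓ, 0 ≤ ℓ → (0 < ℓ ∨ e = 0) → ∀ q ∈ slab d S.T,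
      DifferentiableAt ℝ (P S ℓ) q ∧ fderiv ℝ (P S ℓ) q (1, S.u q) = P' S ℓ q := by
  induction hP with
  | zero => exact ⟨_, .zero, fun S ℓ _ _ q _ => ⟨by fun_prop, by simp⟩⟩
  | @base n k K j g Ψ hg hn hK =>
    obtain ⟨g', hg', h⟩ := hg.md
    have hl : ∀ l, Sing (d := d) (α := α) e (K + 1) j fun S ℓ =>
        scaleInt (n + 1 + e) ℓ (kd l Ψ) (fun q z => g S q z * dl (uc l S) q z) := fun l =>
      .base _ (hg.mul (.one (.base l))) (by omega) (by omega)
    refine ⟨_, (Sing.base Ψ hg' hn (by omega)).add (Sing.sum (s := Finset.univ) hl),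
      fun S ℓ hℓ he q hq => ?_⟩
    have hc := conv (e := e) hn hℓ he
    obtain ⟨h1, h2⟩ := (hg.reg S).hasFDerivAt_scaleInt Ψ hc hq
    refine ⟨h1, ?_⟩
    obtain ⟨h3, h4⟩ := h2 (1, S.u q)
    rw [h3]
    have hi := (hg'.reg S).integrable Ψ hc hq
    have hpt : ∀ p : ℝ × Sp d, (p.1 ^ (n + e))⁻¹ * Ψ p.2 *
        ∑ l, dl (uc l S) q (p.1 • p.2) * fderiv ℝ (g S q) (p.1 • p.2) (unit l)
        = (p.1 ^ (n + e))⁻¹ * Ψ p.2 * g' S q (p.1 • p.2) - (p.1 ^ (n + e))⁻¹ * Ψ p.2 *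
          fderiv ℝ (fun q => g S q (p.1 • p.2)) q (1, S.u q) := fun p => by
      rw [h S q hq]
      ring
    have hi' : Integrable (fun p : ℝ × Sp d => (p.1 ^ (n + e))⁻¹ * Ψ p.2 *
        ∑ l, dl (uc l S) q (p.1 • p.2) * fderiv ℝ (g S q) (p.1 • p.2) (unit l)) (scale d ℓ) := by
      simp_rw [hpt]
      exact hi.sub h4
    have h5 := integral_scale_transport Ψ (hg.reg S) hc hq hi'
    have h6 : scaleInt (n + e) ℓ Ψ (g' S) q - ∫ p, (p.1 ^ (n + e))⁻¹ * Ψ p.2 *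
        fderiv ℝ (fun q => g S q (p.1 • p.2)) q (1, S.u q) ∂scale d ℓ
        = -∑ l, scaleInt (n + e + 1) ℓ (kd l Ψ) (fun q z => g S q z * dl (uc l S) q z) q := by
      rw [← h5, scaleInt, ← integral_sub hi h4]
      simp_rw [hpt]
    rw [show n + 1 + e = n + e + 1 by ring]
    linarith
  | add _ _ h h' =>
    obtain ⟨f, hf, h⟩ := h
    obtain ⟨f', hf', h'⟩ := h'
    refine ⟨_, hf.add hf', fun S ℓ hℓ he q hq => ?_⟩
    obtain ⟨h1, h2⟩ := h S ℓ hℓ he q hq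
    obtain ⟨h1', h2'⟩ := h' S ℓ hℓ he q hq
    refine ⟨h1.add h1', ?_⟩
    rw [fderiv_fun_add h1 h1', add_apply, h2, h2']

end Sing

end Singular

section Mollification

variable {d : ℕ} {T : ℝ} {f : Pt d → ℝ} {q : Pt d}

/-- Spatial average of `f` around `q` at scale `s`. -/
noncomputable def moll (Ψ : 𝓢(Sp d, ℝ)) (s : ℝ) (f : Pt d → ℝ) (q : Pt d) : ℝ :=
  ∫ z, Ψ z * f (q + (0, s • z))

lemma continuous_shift {V : Type*} [NormedAddCommGroup V] [NormedSpace ℝ V] {F : Pt d → V}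
    (hF : IsField T F) (hq : q ∈ slab d T) (s : ℝ) : Continuous fun z => F (q + (0, s • z)) :=
  hF.smooth.continuousOn.comp_continuous (by fun_prop) fun _ => add_mem_slab hq _

lemma integrable_moll (Ψ : 𝓢(Sp d, ℝ)) (hf : IsField T f) (hq : q ∈ slab d T) (s : ℝ) :
    Integrable fun z => Ψ z * f (q + (0, s • z)) := by
  obtain ⟨c, e, h0, h1, h2, -⟩ := exists_time_nhds hq
  obtain ⟨B, -, hB⟩ := hf.bounded h0 h1
  exact Ψ.integrable.mul_bdd (c := B) (continuous_shift hf hq s).aestronglyMeasurable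
    (ae_of_all _ fun z => hB _ (by simpa using h2))

/-- The linear map `(v, σ) ↦ v + (0, σ z)`. -/
noncomputable def shift (z : Sp d) : Pt d × ℝ →L[ℝ] Pt d :=
  .fst ℝ (Pt d) ℝ + (ContinuousLinearMap.inr ℝ ℝ (Sp d)).comp
    ((ContinuousLinearMap.toSpanSingleton ℝ z).comp (.snd ℝ (Pt d) ℝ))

lemma shift_apply (z : Sp d) (v : Pt d) (σ : ℝ) : shift z (v, σ) = v + (0, σ • z) := by
  simp [shift]

lemma norm_shift_le (z : Sp d) : ‖shift z‖ ≤ 1 + ‖z‖ := by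
  refine ContinuousLinearMap.opNorm_le_bound _ (by positivity) fun r => ?_
  obtain ⟨v, σ⟩ := r
  rw [shift_apply]
  have h1 : ‖v‖ ≤ ‖(v, σ)‖ := norm_fst_le (v, σ)
  have h2 : ‖σ‖ ≤ ‖(v, σ)‖ := norm_snd_le (v, σ)
  have h3 : ‖((0 : ℝ), σ • z)‖ = ‖σ‖ * ‖z‖ := by
    rw [Prod.norm_def, norm_smul, norm_zero]
    exact max_eq_right (by positivity)
  calc _ ≤ ‖v‖ + ‖σ‖ * ‖z‖ := (norm_add_le _ _).trans_eq (by rw [h3])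
    _ ≤ ‖(v, σ)‖ + ‖(v, σ)‖ * ‖z‖ := by gcongr
    _ = _ := by ring

lemma continuous_shift_map : Continuous (shift (d := d)) := by
  unfold shift
  refine continuous_const.add (continuous_const.clm_comp (Continuous.clm_comp ?_ continuous_const))
  exact (ContinuousLinearMap.toSpanSingletonLE ℝ ℝ
    (Sp d)).toLinearMap.continuous_of_finiteDimensional

lemma moll_hasFDerivAt (Ψ : 𝓢(Sp d, ℝ)) (hf : IsField T f) (hq : q ∈ slab d T) (s : ℝ) :
    ∃ L : Pt d × ℝ →L[ℝ] ℝ, HasFDerivAt (fun r : Pt d × ℝ => moll Ψ r.2 f r.1) L (q, s) ∧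
      ∀ v σ, Integrable (fun z => Ψ z * fderiv ℝ f (q + (0, s • z)) (v + (0, σ • z))) ∧
        L (v, σ) = ∫ z, Ψ z * fderiv ℝ f (q + (0, s • z)) (v + (0, σ • z)) := by
  obtain ⟨c, e, h0, h1, h2, h3⟩ := exists_time_nhds hq
  obtain ⟨B, hB0, hB⟩ := hf.fderiv.bounded h0 h1
  set F' : Pt d × ℝ → Sp d → Pt d × ℝ →L[ℝ] ℝ := fun r z =>
    Ψ z • (fderiv ℝ f (r.1 + (0, r.2 • z))).comp (shift z) with hF'
  have hmeas : AEStronglyMeasurable (F' (q, s)) volume :=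
    (Ψ.continuous.smul ((continuous_shift hf.fderiv hq s).clm_comp
      continuous_shift_map)).aestronglyMeasurable
  have hbd : ∀ z, ∀ r ∈ {r : Pt d × ℝ | r.1.1 ∈ Icc c e}, ‖F' r z‖ ≤
      B * (|Ψ z| * (1 + ‖z‖) ^ 1) := fun z r hr => by
    rw [hF', norm_smul, Real.norm_eq_abs, pow_one]
    calc _ ≤ |Ψ z| * (‖fderiv ℝ f (r.1 + (0, r.2 • z))‖ * ‖shift z‖) := by
          gcongr
          exact ContinuousLinearMap.opNorm_comp_le _ _
      _ ≤ |Ψ z| * (B * (1 + ‖z‖)) := by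
          gcongr
          · exact hB _ (by simpa using hr)
          · exact norm_shift_le z
      _ = _ := by ring
  have h_int := (integrable_kw Ψ 1).const_mul B
  have hF'int : Integrable (F' (q, s)) := h_int.mono' hmeas (ae_of_all _ fun z => hbd z (q, s) h2)
  have hs : {r : Pt d × ℝ | r.1.1 ∈ Icc c e} ∈ 𝓝 (q, s) :=
    (continuous_fst (X := Pt d) (Y := ℝ)).continuousAt.preimage_mem_nhds
      (x := (q, s)) (t := {q' : Pt d | q'.1 ∈ Icc c e}) h3
  refine ⟨_, hasFDerivAt_integral_of_dominated_of_fderiv_le (F' := F') hs ?_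
    (integrable_moll Ψ hf hq s) hmeas (ae_of_all _ hbd) h_int (ae_of_all _ fun z r hr => ?_),
    fun v σ => ?_⟩
  · filter_upwards [hs] with r hr
    exact (integrable_moll Ψ hf (slab_subset h0 h1 hr) _).aestronglyMeasurable
  · refine HasFDerivAt.const_smul ?_ (Ψ z)
    have h4 : HasFDerivAt (fun r : Pt d × ℝ => r.1 + ((0 : ℝ), r.2 • z)) (shift z) r := by
      have h5 : (fun r : Pt d × ℝ => r.1 + ((0 : ℝ), r.2 • z)) = shift z := by
        funext r; exact (shift_apply z r.1 r.2).symm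
      rw [h5]
      exact (shift z).hasFDerivAt
    exact (hf.differentiableAt (add_mem_slab (slab_subset h0 h1 hr) _)).hasFDerivAt.comp r h4
  · have h6 : ∀ z, F' (q, s) z (v, σ)
        = Ψ z * fderiv ℝ f (q + (0, s • z)) (v + (0, σ • z)) := fun z => by
      simp [hF', shift_apply]
    rw [ContinuousLinearMap.integral_apply hF'int]
    have h7 := hF'int.apply_continuousLinearMap (v, σ)
    simp_rw [h6] at h7 ⊢
    exact ⟨h7, trivial⟩

lemma moll_hasDerivAt (Ψ : 𝓢(Sp d, ℝ)) (hf : IsField T f) {γ : ℝ → Pt d} {r : ℝ → ℝ} {t σ : ℝ}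
    {v : Pt d} (hq : γ t ∈ slab d T) (hγ : HasDerivAt γ v t) (hr : HasDerivAt r σ t) :
    HasDerivAt (fun t => moll Ψ (r t) f (γ t))
      (∫ z, Ψ z * fderiv ℝ f (γ t + (0, r t • z)) (v + (0, σ • z))) t := by
  obtain ⟨L, hL, h⟩ := moll_hasFDerivAt Ψ hf hq (r t)
  rw [← (h v σ).2]
  exact hL.comp_hasDerivAt t (hγ.prodMk hr)

lemma pd_moll (Ψ : 𝓢(Sp d, ℝ)) (hf : IsField T f) (hq : q ∈ slab d T) (s : ℝ) (l : Fin d) :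
    pd l (moll Ψ s f) q = moll Ψ s (pd l f) q := by
  obtain ⟨L, hL, h⟩ := moll_hasFDerivAt Ψ hf hq s
  have h1 : HasFDerivAt (moll Ψ s f) (L.comp (.inl ℝ (Pt d) ℝ)) q :=
    HasFDerivAt.comp (f := fun q => (q, s)) (g := fun r : Pt d × ℝ => moll Ψ r.2 f r.1) q hL
      (hasFDerivAt_prodMk_left (𝕜 := ℝ) q s)
  rw [pd, h1.fderiv]
  simpa [moll, pd] using (h (0, unit l) 0).2

/-- Integration by parts for averages. -/
lemma moll_kd (Ψ : 𝓢(Sp d, ℝ)) (hf : IsField T f) (hq : q ∈ slab d T) (s : ℝ) (l : Fin d) :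
    moll (kd l Ψ) s f q = -s * moll Ψ s (pd l f) q := by
  obtain ⟨c, e, h0, h1, h2, h3⟩ := exists_time_nhds hq
  obtain ⟨B, hB0, hB⟩ := hf.bounded h0 h1
  obtain ⟨B', hB0', hB'⟩ := hf.fderiv.bounded h0 h1
  have hd : ∀ z, HasFDerivAt (fun z => f (q + (0, s • z)))
      ((fderiv ℝ f (q + (0, s • z))).comp (s • .inr ℝ ℝ (Sp d))) z := fun z => by
    have h4 : HasFDerivAt (fun z : Sp d => q + ((0 : ℝ), s • z)) (s • .inr ℝ ℝ (Sp d)) z := by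
      have h5 : HasFDerivAt (fun z : Sp d => s • ((0 : ℝ), z)) (s • .inr ℝ ℝ (Sp d)) z :=
        (hasFDerivAt_prodMk_right (0 : ℝ) z).const_smul s
      simpa using h5.const_add q
    exact (hf.differentiableAt (add_mem_slab hq _)).hasFDerivAt.comp z h4
  have hcd : ContDiff ℝ 1 fun z => f (q + (0, s • z)) := contDiff_iff_contDiffAt.2 fun z =>
    ((hf.contDiffAt (add_mem_slab hq _)).of_le (by exact_mod_cast le_top)).comp z (by fun_prop)
  have h := integral_mul_fderiv_eq Ψ hcd (B := B + B' * |s|) (fun z => ?_) (fun z => ?_) l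
  · rw [moll, moll, ← integral_const_mul, ← neg_eq_iff_eq_neg.2 h, ← integral_neg]
    congr 1
    funext z
    rw [(hd z).fderiv]
    have : (s • ContinuousLinearMap.inr ℝ ℝ (Sp d)) (unit l) = s • (0, unit l) := by simp
    rw [ContinuousLinearMap.comp_apply, this, map_smul, pd, smul_eq_mul]
    ring
  · have := hB (q + (0, s • z)) (by simpa using h2)
    rw [Real.norm_eq_abs] at this
    have : 0 ≤ B' * |s| := by positivity
    linarith
  · rw [(hd z).fderiv]
    refine (ContinuousLinearMap.opNorm_comp_le _ _).trans ?_
    have h4 := ContinuousLinearMap.norm_inr_le_one ℝ ℝ (Sp d)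
    have h5 := hB' (q + (0, s • z)) (by simpa using h2)
    rw [norm_smul, Real.norm_eq_abs]
    calc _ ≤ B' * (|s| * 1) := by gcongr
      _ ≤ _ := by linarith

lemma moll_gauss_scale (hf : IsField T f) (hq : q ∈ slab d T) (s σ : ℝ) :
    ∫ z, gauss d z * fderiv ℝ f (q + (0, s • z)) (0, σ • z)
      = 2 * s * σ * ∑ l, moll (gauss d) s (pd l (pd l f)) q := by
  have h1 : ∀ z, gauss d z * fderiv ℝ f (q + (0, s • z)) (0, σ • z)
      = ∑ l, -2 * σ * (kd l (gauss d) z * pd l f (q + (0, s • z))) := fun z => by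
    have : ((0 : ℝ), σ • z) = σ • ((0 : ℝ), z) := by simp
    rw [this, map_smul, apply_zero_right, smul_eq_mul, Finset.mul_sum, Finset.mul_sum]
    refine Finset.sum_congr rfl fun l _ => ?_
    rw [smul_eq_mul, ← pd]
    linear_combination σ * pd l f (q + (0, s • z)) * gauss_mul_coord l z
  simp_rw [h1]
  rw [integral_finsetSum _ fun l _ => (integrable_moll (kd l (gauss d)) (hf.pd l) hq s).const_mul _,
    Finset.mul_sum]
  refine Finset.sum_congr rfl fun l _ => ?_
  rw [integral_const_mul, ← moll, moll_kd _ (hf.pd l) hq]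
  ring

lemma moll_gauss_zero : moll (gauss d) 0 f q = f q := by
  have : q + ((0 : ℝ), (0 : Sp d)) = q := add_zero q
  simp [moll, integral_mul_const, integral_gauss, this]

lemma moll_congr {h : Pt d → ℝ} (hfh : ∀ q ∈ slab d T, f q = h q) (Ψ : 𝓢(Sp d, ℝ))
    (hq : q ∈ slab d T) (s : ℝ) : moll Ψ s f q = moll Ψ s h q := by
  rw [moll, moll]
  congr 1
  funext z
  rw [hfh _ (add_mem_slab hq _)]

lemma moll_sum {ι : Type*} {A : Finset ι} {F : ι → Pt d → ℝ} (hF : ∀ i, IsField T (F i))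
    (Ψ : 𝓢(Sp d, ℝ)) (hq : q ∈ slab d T) (s : ℝ) :
    moll Ψ s (fun q => ∑ i ∈ A, F i q) q = ∑ i ∈ A, moll Ψ s (F i) q := by
  simp_rw [moll, Finset.mul_sum]
  exact integral_finsetSum _ fun i _ => integrable_moll Ψ (hF i) hq s

lemma moll_add {h : Pt d → ℝ} (hf : IsField T f) (hh : IsField T h) (Ψ : 𝓢(Sp d, ℝ))
    (hq : q ∈ slab d T) (s : ℝ) :
    moll Ψ s (fun q => f q + h q) q = moll Ψ s f q + moll Ψ s h q := by
  simp_rw [moll, mul_add]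
  exact integral_add (integrable_moll Ψ hf hq s) (integrable_moll Ψ hh hq s)

lemma moll_const_mul (Ψ : 𝓢(Sp d, ℝ)) (s c : ℝ) :
    moll Ψ s (fun q => c * f q) q = c * moll Ψ s f q := by
  simp_rw [moll, mul_left_comm, integral_const_mul]

lemma abs_moll_le {c : ℝ} (Ψ : 𝓢(Sp d, ℝ)) {F : Sp d → ℝ} (n : ℕ)
    (h : ∀ z, |F z| ≤ c * (1 + ‖z‖) ^ n) : |∫ z, Ψ z * F z| ≤ c * kw Ψ n := by
  rw [kw, ← integral_const_mul]
  refine norm_integral_le_of_norm_le (f := fun z => Ψ z * F z) ((integrable_kw Ψ n).const_mul c)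
    (ae_of_all _ fun z => ?_)
  rw [Real.norm_eq_abs, abs_mul]
  calc _ ≤ |Ψ z| * (c * (1 + ‖z‖) ^ n) := by gcongr; exact h z
    _ = _ := by ring

/-- Transport of an average by the velocity at its centre. -/
lemma moll_transport {α : ℝ} {S : Flow d α} (Ψ : 𝓢(Sp d, ℝ)) (hf : IsField S.T f)
    (hq : q ∈ slab d S.T) {s : ℝ} (hs : 0 < s) :
    ∫ z, Ψ z * fderiv ℝ f (q + (0, s • z)) (1, S.u q) = moll Ψ s (md S f) q
      + s⁻¹ * ∑ l, ∫ z, kd l Ψ z * (dl f q (s • z) * dl (uc l S) q (s • z)) := by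
  have h1 : ∀ z, Ψ z * ∑ l, dl (uc l S) q (s • z) * fderiv ℝ (dl f q) (s • z) (unit l)
      = Ψ z * md S f (q + (0, s • z)) - Ψ z * fderiv ℝ f (q + (0, s • z)) (1, S.u q) := fun z => by
    have h2 : ((1 : ℝ), S.u (q + (0, s • z)))
        = (1, S.u q) + (0, S.u (q + (0, s • z)) - S.u q) := by simp
    rw [md, h2, map_add, apply_zero_right]
    simp_rw [fderiv_dl_right hf hq, mul_add, smul_eq_mul]
    simp [dl, uc]
  have h3 := integral_transport Ψ (IncReg.dl_isField hf) hq hs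
  obtain ⟨L, hL, h4⟩ := moll_hasFDerivAt Ψ hf hq s
  have h5 := (h4 (1, S.u q) 0).1
  simp only [zero_smul, Prod.mk_zero_zero, add_zero] at h5
  simp_rw [h1] at h3
  rw [integral_sub (integrable_moll Ψ hf.md hq s) h5, ← moll] at h3
  linarith

end Mollification

section Pressure

variable {d : ℕ} {T α : ℝ}

/-- Iterated spatial derivative along a list of directions, the head being applied last. -/
noncomputable def pdl (V : List (Fin d)) (F : Pt d → ℝ) : Pt d → ℝ := V.foldr pd F

/-- Iterated derivative of a kernel along a list of directions, the head being applied first. -/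
noncomputable def kdl (V : List (Fin d)) (Ψ : 𝓢(Sp d, ℝ)) : 𝓢(Sp d, ℝ) :=
  V.foldl (fun Φ l => kd l Φ) Ψ

lemma IsField.pdl {F : Pt d → ℝ} (hF : IsField T F) (V : List (Fin d)) : IsField T (pdl V F) := by
  induction V with
  | nil => exact hF
  | cons l V ih => exact ih.pd l

lemma pdl_congr {F G : Pt d → ℝ} (h : ∀ q ∈ slab d T, F q = G q) (V : List (Fin d)) :
    ∀ q ∈ slab d T, pdl V F q = pdl V G q := by
  induction V with
  | nil => exact h
  | cons l V ih => exact fun q hq => pd_congr ih l hq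

lemma pdl_sum {ι : Type*} {s : Finset ι} {G : ι → Pt d → ℝ} (hG : ∀ i, IsField T (G i))
    (V : List (Fin d)) :
    ∀ q ∈ slab d T, pdl V (fun q => ∑ i ∈ s, G i q) q = ∑ i ∈ s, pdl V (G i) q := by
  induction V with
  | nil => exact fun q _ => rfl
  | cons l V ih =>
    intro q hq
    change pd l (pdl V _) q = _
    rw [pd_congr ih l hq, pd_sum (fun i => (hG i).pdl V) l hq]
    rfl

lemma pd_neg (F : Pt d → ℝ) (l : Fin d) (q : Pt d) : pd l (fun q => -F q) q = -pd l F q := by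
  simp [pd, fderiv_fun_neg]

lemma pdl_neg (F : Pt d → ℝ) (V : List (Fin d)) :
    pdl V (fun q => -F q) = fun q => -pdl V F q := by
  induction V with
  | nil => rfl
  | cons l V ih =>
    change pd l (pdl V _) = _
    rw [ih]
    funext q
    exact pd_neg _ _ _

lemma pd_pdl {F : Pt d → ℝ} (hF : IsField T F) (l : Fin d) (V : List (Fin d)) :
    ∀ q ∈ slab d T, pd l (pdl V F) q = pdl V (pd l F) q := by
  induction V with
  | nil => exact fun q _ => rfl
  | cons k V ih =>
    intro q hq
    change pd l (pd k (pdl V F)) q = pd k (pdl V (pd l F)) q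
    rw [pd_comm (hF.pdl V) l k hq, pd_congr ih k hq]

lemma laplacian_pdl {F : Pt d → ℝ} (hF : IsField T F) (V : List (Fin d)) {q : Pt d}
    (hq : q ∈ slab d T) :
    ∑ l, pd l (pd l (pdl V F)) q = pdl V (fun q => ∑ l, pd l (pd l F) q) q := by
  rw [pdl_sum (fun l => (hF.pd l).pd l) V q hq]
  refine Finset.sum_congr rfl fun l _ => ?_
  rw [pd_congr (pd_pdl hF l V) l hq, pd_pdl (hF.pd l) l V q hq]

lemma moll_kdl {F : Pt d → ℝ} (hF : IsField T F) {q : Pt d} (hq : q ∈ slab d T) (s : ℝ)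
    (V : List (Fin d)) (Ψ : 𝓢(Sp d, ℝ)) :
    moll (kdl V Ψ) s F q = (-s) ^ V.length * moll Ψ s (pdl V F) q := by
  induction V generalizing Ψ with
  | nil => simp [kdl, pdl]
  | cons l V ih =>
    change moll (kdl V (kd l Ψ)) s F q = (-s) ^ (V.length + 1) * moll Ψ s (pd l (pdl V F)) q
    rw [ih, moll_kd Ψ (hF.pdl V) hq]
    ring

/-- Averages of a derivative decay at large scales. -/
lemma tendsto_moll_pd {F : Pt d → ℝ} (hF : IsField T F) {q : Pt d} (hq : q ∈ slab d T)
    (Ψ : 𝓢(Sp d, ℝ)) (l : Fin d) :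
    Filter.Tendsto (fun s => moll Ψ s (pd l F) q) Filter.atTop (𝓝 0) := by
  obtain ⟨c, e, h0, h1, h2, -⟩ := exists_time_nhds hq
  obtain ⟨B, hB0, hB⟩ := hF.bounded h0 h1
  refine squeeze_zero_norm' (a := fun s : ℝ => s⁻¹ * (B * kw (kd l Ψ) 0)) ?_ ?_
  · filter_upwards [Filter.eventually_gt_atTop 0] with s hs
    have h3 : moll Ψ s (pd l F) q = -(s⁻¹ * moll (kd l Ψ) s F q) := by
      rw [moll_kd Ψ hF hq]
      field_simp
    rw [h3, norm_neg, norm_mul, Real.norm_eq_abs, Real.norm_eq_abs, abs_of_pos (inv_pos.2 hs)]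
    gcongr
    exact abs_moll_le _ 0 fun z => by simpa using hB _ (by simpa using h2)
  · simpa using tendsto_inv_atTop_zero.mul_const (B * kw (kd l Ψ) 0)

lemma hasDerivAt_moll_gauss {F : Pt d → ℝ} (hF : IsField T F) {q : Pt d} (hq : q ∈ slab d T)
    (s : ℝ) : HasDerivAt (fun s => moll (gauss d) s F q)
      (2 * s * ∑ l, moll (gauss d) s (pd l (pd l F)) q) s := by
  have h := moll_hasDerivAt (gauss d) hF (γ := fun _ => q) (r := fun s => s) (t := s) hq
    (hasDerivAt_const s q) (hasDerivAt_id s)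
  simp_rw [zero_add] at h
  rwa [moll_gauss_scale hF hq, mul_one] at h

lemma pd_sub_const {F : Pt d → ℝ} (c : ℝ) (l : Fin d) : pd l (fun q => F q - c) = pd l F := by
  funext q
  rw [pd, pd, fderiv_sub_const]

lemma laplacian_pressure_quadratic {S : Flow d α} (c : Sp d) {q : Pt d} (hq : q ∈ slab d S.T) :
    ∑ l, pd l (pd l S.p) q
      = -∑ i, ∑ j, pd i (pd j fun q => (uc i S q - c i) * (uc j S q - c j)) q := by
  have hu := fun i => field_uc S i
  have hU : ∀ i, IsField S.T fun q => uc i S q - c i := fun i => (hu i).sub (.const _)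
  have hdiv : ∀ q ∈ slab d S.T, ∑ i, pd i (uc i S) q = 0 := S.divergence
  have h1 : ∀ i, ∀ q ∈ slab d S.T, ∑ j, pd j (fun q => (uc i S q - c i) * (uc j S q - c j)) q
      = ∑ j, pd j (uc i S) q * (uc j S q - c j) := fun i q hq => by
    simp_rw [fun j => pd_mul (hU i) (hU j) j hq, pd_sub_const, Finset.sum_add_distrib,
      ← Finset.mul_sum, hdiv q hq, mul_zero, add_zero]
  have h2 : ∀ i, ∑ j, pd i (pd j fun q => (uc i S q - c i) * (uc j S q - c j)) q
      = ∑ j, (pd i (pd j (uc i S)) q * (uc j S q - c j) + pd i (uc j S) q * pd j (uc i S) q) :=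
    fun i => by
    rw [← pd_sum (fun j => ((hU i).mul (hU j)).pd j) i hq, pd_congr (h1 i) i hq,
      pd_sum (fun j => ((hu i).pd j).mul (hU j)) i hq]
    refine Finset.sum_congr rfl fun j _ => ?_
    rw [pd_mul ((hu i).pd j) (hU j) i hq, pd_sub_const]
    ring
  have h3 : ∑ i, ∑ j, pd i (pd j (uc i S)) q * (uc j S q - c j) = 0 := by
    rw [Finset.sum_comm]
    refine Finset.sum_eq_zero fun j _ => ?_
    rw [← Finset.sum_mul]
    simp_rw [fun i => pd_comm (hu i) i j hq]
    rw [← pd_sum (fun i => (hu i).pd i) j hq, pd_congr (G := fun _ => 0) hdiv j hq]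
    simp [pd]
  rw [laplacian_pressure hq]
  simp_rw [h2, Finset.sum_add_distrib, h3, zero_add]

/-- The averaged derivatives of the pressure are singular integrals of velocity increments. -/
lemma exists_sing_pressure (e : ℕ) (V : List (Fin d)) (hV : V.length = e + 1) :
    ∃ P, Sing (α := α) e 0 0 P ∧ ∀ S : Flow d α, ∀ ℓ, 0 ≤ ℓ → (0 < ℓ ∨ e = 0) → ∀ q ∈ slab d S.T,
      moll (gauss d) ℓ (pdl V S.p) q = P S ℓ q := by
  set K : Fin d → Fin d → 𝓢(Sp d, ℝ) := fun i j => kdl (V ++ [i, j]) (gauss d) with hK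
  set g : Fin d → Fin d → Flow d α → Pt d → Sp d → ℝ :=
    fun i j S q z => dl (uc i S) q z * dl (uc j S) q z with hg
  have hI : ∀ i j, Inc 2 0 0 (g i j) := fun i j => .mul (.one (.base i)) (.one (.base j))
  refine ⟨fun S ℓ q => ∑ i, ∑ j, 2 * (-1) ^ (e + 1) * scaleInt (2 + e) ℓ (K i j) (g i j S) q,
    Sing.sum fun i => Sing.sum fun j => Sing.smul _ (.base _ (hI i j) le_rfl rfl),
    fun S ℓ hℓ he q hq => ?_⟩
  have hu := fun i => field_uc S i
  set f := pdl V S.p with hf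
  have hfF : IsField S.T f := S.field_p.pdl V
  have hc : Conv (2 + e) ℓ 2 := Sing.conv le_rfl hℓ he
  have hlim : Filter.Tendsto (fun s => moll (gauss d) s f q) Filter.atTop (𝓝 0) := by
    obtain ⟨l, V', rfl⟩ := List.exists_cons_of_ne_nil (l := V) (by rintro rfl; simp at hV)
    exact tendsto_moll_pd (S.field_p.pdl V') hq _ l
  have hder : ∀ s, 0 < s → 2 * s * ∑ l, moll (gauss d) s (pd l (pd l f)) q
      = -∑ i, ∑ j, 2 * (-1) ^ (e + 1) * ((s ^ (2 + e))⁻¹ * ∫ z, K i j z * g i j S q (s • z)) := by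
    intro s hs
    have hH : ∀ i j, IsField S.T fun q' => (uc i S q' - S.u q i) * (uc j S q' - S.u q j) :=
      fun i j => ((hu i).sub (.const _)).mul ((hu j).sub (.const _))
    have h1 : ∑ l, moll (gauss d) s (pd l (pd l f)) q = moll (gauss d) s
        (fun q' => -∑ i, ∑ j, pdl (V ++ [i, j])
          (fun q' => (uc i S q' - S.u q i) * (uc j S q' - S.u q j)) q') q := by
      rw [← moll_sum (fun l => (hfF.pd l).pd l) _ hq]
      refine moll_congr (fun q' hq' => ?_) _ hq s
      rw [laplacian_pdl S.field_p V hq', pdl_congr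
        (fun r hr => laplacian_pressure_quadratic (S.u q) hr) V q' hq', pdl_neg]
      beta_reduce
      rw [pdl_sum (fun i => .sum fun j => ((hH i j).pd j).pd i) V q' hq']
      congr 1
      refine Finset.sum_congr rfl fun i _ => ?_
      rw [pdl_sum (fun j => ((hH i j).pd j).pd i) V q' hq']
      refine Finset.sum_congr rfl fun j _ => ?_
      simp [pdl, List.foldr_append]
    have h2 : ∀ i j, moll (gauss d) s (pdl (V ++ [i, j])
        (fun q' => (uc i S q' - S.u q i) * (uc j S q' - S.u q j))) q
        = ((-s) ^ (e + 3))⁻¹ * ∫ z, K i j z * g i j S q (s • z) := fun i j => by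
      have h3 := moll_kdl (hH i j) hq s (V ++ [i, j]) (gauss d)
      have h4 : (V ++ [i, j]).length = e + 3 := by simp [hV]
      rw [h4] at h3
      have h5 : (-s) ^ (e + 3) ≠ 0 := pow_ne_zero _ (by linarith)
      rw [eq_inv_mul_iff_mul_eq₀ h5, ← h3]
      rfl
    have h6 := moll_const_mul (gauss d) s (-1) (q := q) (f := fun q' => ∑ i, ∑ j, pdl (V ++ [i, j])
          (fun q' => (uc i S q' - S.u q i) * (uc j S q' - S.u q j)) q')
    simp only [neg_mul, one_mul] at h6
    rw [h1, h6, moll_sum (fun i => .sum fun j => (hH i j).pdl _) _ hq]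
    have h7 := fun i => moll_sum (A := Finset.univ) (fun j => (hH i j).pdl (V ++ [i, j])) (gauss d)
      hq s
    simp_rw [h7, h2, mul_neg, Finset.mul_sum]
    rw [neg_inj]
    refine Finset.sum_congr rfl fun i _ => Finset.sum_congr rfl fun j _ => ?_
    rw [neg_pow, mul_inv, ← inv_pow]
    have : s ^ (e + 3) = s ^ (2 + e) * s := by ring
    rw [this]
    field_simp
    ring
  have h_int : ∀ i j, IntegrableOn (fun s => 2 * (-1) ^ (e + 1) *
      ((s ^ (2 + e))⁻¹ * ∫ z, K i j z * g i j S q (s • z))) (Ioi ℓ) := fun i j => by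
    have h3 := ((hI i j).reg S).integrable (K i j) hc hq
    rw [scale] at h3
    have h4 := h3.integral_prod_left
    refine (h4.const_mul (2 * (-1) ^ (e + 1))).congr (ae_of_all _ fun s => ?_)
    simp only [mul_assoc, integral_const_mul]
  have hI0 : IntegrableOn (fun s => ∑ i, ∑ j, 2 * (-1) ^ (e + 1) *
      ((s ^ (2 + e))⁻¹ * ∫ z, K i j z * g i j S q (s • z))) (Ioi ℓ) :=
    integrable_finsetSum _ fun i _ => integrable_finsetSum _ fun j _ => h_int i j
  have hFTC := integral_Ioi_of_hasDerivAt_of_tendsto (a := ℓ)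
    (f := fun s => moll (gauss d) s f q) (f' := fun s => -∑ i, ∑ j, 2 * (-1) ^ (e + 1) *
      ((s ^ (2 + e))⁻¹ * ∫ z, K i j z * g i j S q (s • z)))
    (hasDerivAt_moll_gauss hfF hq ℓ).continuousAt.continuousWithinAt
    (fun s hs => by rw [← hder s (hℓ.trans_lt hs)]; exact hasDerivAt_moll_gauss hfF hq s)
    hI0.neg hlim
  rw [integral_neg, zero_sub, neg_inj] at hFTC
  rw [← hFTC, integral_finsetSum _ fun i _ => integrable_finsetSum _ fun j _ => h_int i j]
  refine Finset.sum_congr rfl fun i _ => ?_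
  rw [integral_finsetSum _ fun j _ => h_int i j]
  refine Finset.sum_congr rfl fun j _ => ?_
  rw [integral_const_mul, scaleInt_eq_iterated _ ((hI i j).reg S) hc hq]

end Pressure

section Expansion

variable {d : ℕ} {α : ℝ}

lemma exists_sing_pdl_pressure (e : ℕ) (W : List (Fin d)) (hW : W.length = e + 1)
    (V : List (Fin d)) :
    ∃ P, Sing (α := α) e 0 V.length P ∧
      ∀ S : Flow d α, ∀ ℓ, 0 ≤ ℓ → (0 < ℓ ∨ e = 0) → ∀ q ∈ slab d S.T,
        moll (gauss d) ℓ (pdl V (pdl W S.p)) q = P S ℓ q := by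
  induction V with
  | nil => exact exists_sing_pressure e W hW
  | cons l V ih =>
    obtain ⟨P, hP, h⟩ := ih
    obtain ⟨P', hP', h'⟩ := hP.pd l
    refine ⟨P', hP', fun S ℓ hℓ he q hq => ?_⟩
    change moll (gauss d) ℓ (pd l (pdl V (pdl W S.p))) q = _
    rw [← pd_moll _ ((S.field_p.pdl W).pdl V) hq, pd_congr (h S ℓ hℓ he) l hq]
    exact (h' S ℓ hℓ he q hq).2

/-- Sums of products of two words with spatial derivatives and, if `v` holds, of viscous terms. -/
inductive NP (v : Prop) : ℕ → ℕ → (Flow d α → Pt d → ℝ) → Prop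
  | zero {k j : ℕ} : NP v k j fun _ _ => 0
  | visc {k j : ℕ} {F : Flow d α → Pt d → ℝ} (hv : v) (hF : Word k (j + 2) F) :
      NP v k j fun S q => S.ν * F S q
  | prod {k k' K j j' J : ℕ} {F G : Flow d α → Pt d → ℝ} (hF : Word k j F) (hG : Word k' j' G)
      (hj : 1 ≤ j) (hj' : 1 ≤ j') (hK : k + k' = K) (hJ : j + j' = J + 1) :
      NP v K J fun S q => F S q * G S q
  | add {k j : ℕ} {N N' : Flow d α → Pt d → ℝ} : NP v k j N → NP v k j N' →
      NP v k j fun S q => N S q + N' S q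
  | neg {k j : ℕ} {N : Flow d α → Pt d → ℝ} : NP v k j N → NP v k j fun S q => -N S q

namespace NP

variable {v : Prop} {k j : ℕ} {N : Flow d α → Pt d → ℝ}

lemma isField (hN : NP v k j N) (S : Flow d α) : IsField S.T (N S) := by
  induction hN with
  | zero => exact .const 0
  | visc hv hF => exact (IsField.const S.ν).mul (hF.isField S)
  | prod hF hG => exact (hF.isField S).mul (hG.isField S)
  | add _ _ ih ih' =>
    have := ih.sub (((IsField.const (-1 : ℝ))).mul ih')
    simpa using this
  | neg _ ih => simpa using (IsField.const (-1 : ℝ)).mul ih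

lemma of_false (hN : NP False k j N) : NP v k j N := by
  induction hN with
  | zero => exact .zero
  | visc hv _ => exact hv.elim
  | prod hF hG h1 h2 h3 h4 => exact .prod hF hG h1 h2 h3 h4
  | add _ _ ih ih' => exact .add ih ih'
  | neg _ ih => exact .neg ih

lemma sum {ι : Type*} {s : Finset ι} {N : ι → Flow d α → Pt d → ℝ} (hN : ∀ i, NP v k j (N i)) :
    NP v k j fun S q => ∑ i ∈ s, N i S q := by
  classical
  induction s using Finset.induction_on with
  | empty => simpa using NP.zero
  | insert a s ha ih =>
    simp_rw [Finset.sum_insert ha]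
    exact (hN a).add ih

lemma fderiv_apply (X : Flow d α → Pt d → Pt d) {a b : ℕ}
    (hX : ∀ {k j F}, Word (d := d) (α := α) k j F →
      Word (k + a) (j + b) fun S q => fderiv ℝ (F S) q (X S q)) (hN : NP v k j N) :
    ∃ N', NP v (k + a) (j + b) N' ∧
      ∀ S : Flow d α, ∀ q ∈ slab d S.T, fderiv ℝ (N S) q (X S q) = N' S q := by
  induction hN with
  | zero => exact ⟨_, .zero, fun S q _ => by simp⟩
  | @visc k j F hv hF =>
    have h := hX hF
    rw [show j + 2 + b = j + b + 2 by omega] at h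
    refine ⟨_, .visc hv h, fun S q hq => ?_⟩
    rw [fderiv_const_mul ((hF.isField S).differentiableAt hq)]
    simp
  | @prod k k' K j j' J F G hF hG hj hj' hK hJ =>
    refine ⟨_, .add (.prod (hX hF) hG (by omega) hj' (by omega) (by omega))
      (.prod hF (hX hG) hj (by omega) (by omega) (by omega)), fun S q hq => ?_⟩
    rw [fderiv_fun_mul ((hF.isField S).differentiableAt hq) ((hG.isField S).differentiableAt hq)]
    simp
    ring
  | add h₁ h₂ ih ih' =>
    obtain ⟨N₁, hN₁, h⟩ := ih
    obtain ⟨N₂, hN₂, h'⟩ := ih'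
    refine ⟨_, hN₁.add hN₂, fun S q hq => ?_⟩
    rw [fderiv_fun_add ((h₁.isField S).differentiableAt hq) ((h₂.isField S).differentiableAt hq),
      add_apply, h S q hq, h' S q hq]
  | neg h₁ ih =>
    obtain ⟨N₁, hN₁, h⟩ := ih
    refine ⟨_, hN₁.neg, fun S q hq => ?_⟩
    rw [fderiv_fun_neg, neg_apply, h S q hq]

lemma pd (hN : NP v k j N) (l : Fin d) : ∃ N', NP v k (j + 1) N' ∧
    ∀ S : Flow d α, ∀ q ∈ slab d S.T, Lagrangian.pd l (N S) q = N' S q :=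
  hN.fderiv_apply (a := 0) (b := 1) (fun _ _ => (0, unit l)) fun hF => hF.pd l

lemma md (hN : NP v k j N) : ∃ N', NP v (k + 1) j N' ∧
    ∀ S : Flow d α, ∀ q ∈ slab d S.T, Lagrangian.md S (N S) q = N' S q :=
  hN.fderiv_apply (a := 1) (b := 0) (fun S q => (1, S.u q)) fun hF => hF.md

end NP

/-- The momentum equation differentiated in space. -/
lemma Word.md_eq {j : ℕ} {F : Flow d α → Pt d → ℝ} (hF : Word 0 j F) :
    ∃ (i : Fin d) (V : List (Fin d)) (N : Flow d α → Pt d → ℝ), V.length = j ∧ NP False 0 j N ∧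
      ∀ S : Flow d α, ∀ q ∈ slab d S.T,
        Lagrangian.md S (F S) q = S.ν * ∑ l, Lagrangian.pd l (Lagrangian.pd l (F S)) q
          - pdl V (Lagrangian.pd i S.p) q + N S q := by
  generalize hk : (0 : ℕ) = k at hF
  induction hF with
  | base i => exact ⟨i, [], _, rfl, .zero, fun S q hq => by rw [md_uc i hq]; simp [pdl]⟩
  | md => omega
  | @pd k j F l hF ih =>
    subst hk
    obtain ⟨i, V, N, rfl, hN, h⟩ := ih rfl
    obtain ⟨N', hN', h'⟩ := hN.pd l
    refine ⟨i, l :: V, _, rfl, hN'.add (NP.neg (NP.sum (s := Finset.univ)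
      fun m : Fin d => .prod (.pd l (.base m)) (.pd m hF) le_rfl (by omega) rfl
      (by omega))), fun S q hq => ?_⟩
    have hf := hF.isField S
    have hL : IsField S.T fun q => ∑ m, Lagrangian.pd m (Lagrangian.pd m (F S)) q :=
      .sum fun m => (hf.pd m).pd m
    have h1 : Lagrangian.pd l (fun q => S.ν * ∑ m, Lagrangian.pd m (Lagrangian.pd m (F S)) q
        - pdl V (Lagrangian.pd i S.p) q + N S q) q
        = S.ν * ∑ m, Lagrangian.pd m (Lagrangian.pd m (Lagrangian.pd l (F S))) q
        - pdl (l :: V) (Lagrangian.pd i S.p) q + N' S q := by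
      have h2 : ∑ m, Lagrangian.pd m (Lagrangian.pd m (Lagrangian.pd l (F S))) q
          = Lagrangian.pd l (fun q => ∑ m, Lagrangian.pd m (Lagrangian.pd m (F S)) q) q := by
        rw [pd_sum (fun m => (hf.pd m).pd m) l hq]
        refine Finset.sum_congr rfl fun m _ => ?_
        rw [pd_comm (hf.pd m) l m hq]
        exact pd_congr (fun q hq => pd_comm hf m l hq) m hq
      have hp := ((S.field_p.pd i).pdl V).differentiableAt hq
      rw [h2, ← h' S q hq, Lagrangian.pd, fderiv_fun_add
        (((hL.differentiableAt hq).const_mul _).fun_sub hp) ((hN.isField S).differentiableAt hq),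
        fderiv_fun_sub ((hL.differentiableAt hq).const_mul _) hp,
        fderiv_const_mul (hL.differentiableAt hq)]
      simp [pdl, Lagrangian.pd]
    rw [md_pd hf l hq, pd_congr (h S) l hq, h1]
    ring

/-- Every word with a material derivative is the sum of a singular integral and of products. -/
lemma Word.exists_eq {k j : ℕ} {F : Flow d α → Pt d → ℝ} (hF : Word (k + 1) j F) :
    ∃ P N, Sing 0 k j P ∧ NP True k j N ∧
      ∀ S : Flow d α, ∀ q ∈ slab d S.T, F S q = P S 0 q + N S q := by
  generalize hk : k + 1 = k' at hF
  induction hF generalizing k with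
  | base => omega
  | @pd k' j F l hF ih =>
    obtain ⟨P, N, hP, hN, h⟩ := ih hk
    obtain ⟨P', hP', h1⟩ := hP.pd l
    obtain ⟨N', hN', h2⟩ := hN.pd l
    refine ⟨P', N', hP', hN', fun S q hq => ?_⟩
    have h3 := h1 S 0 le_rfl (.inr rfl) q hq
    beta_reduce
    rw [pd_congr (h S) l hq, ← h3.2, ← h2 S q hq, Lagrangian.pd,
      fderiv_fun_add h3.1 ((hN.isField S).differentiableAt hq)]
    rfl
  | @md k' j F hF ih =>
    obtain rfl : k = k' := by omega
    rcases k with - | k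
    · obtain ⟨i, V, N, rfl, hN, h⟩ := hF.md_eq
      obtain ⟨P, hP, h1⟩ := exists_sing_pdl_pressure (α := α) 0 [i] rfl V
      refine ⟨_, _, hP.smul (-1), hN.of_false.add (NP.sum (s := Finset.univ) fun m : Fin d =>
        .visc trivial (.pd m (.pd m hF))), fun S q hq => ?_⟩
      beta_reduce
      rw [h S q hq, ← h1 S 0 le_rfl (.inr rfl) q hq, moll_gauss_zero, Finset.mul_sum]
      simp [pdl]
      ring
    · obtain ⟨P, N, hP, hN, h⟩ := ih rfl
      obtain ⟨P', hP', h1⟩ := hP.md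
      obtain ⟨N', hN', h2⟩ := hN.md
      refine ⟨P', N', hP', hN', fun S q hq => ?_⟩
      have h3 := h1 S 0 le_rfl (.inr rfl) q hq
      beta_reduce
      rw [md_congr (h S) hq, ← h3.2, ← h2 S q hq, Lagrangian.md,
        fderiv_fun_add h3.1 ((hN.isField S).differentiableAt hq)]
      rfl

end Expansion

section Trajectory

variable {d : ℕ} {α : ℝ}

lemma exists_trajectory (S : Flow d α) {q : Pt d} (hq : q ∈ slab d S.T) {c : ℝ} (hc : 0 < c)
    (hcq : c ≤ q.1) : ∃ γ : ℝ → Sp d, γ q.1 = q.2 ∧ ContinuousOn γ (Icc c q.1) ∧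
      ∀ s ∈ Ioo c q.1, HasDerivAt γ (S.u (s, γ s)) s := by
  have hT := (mem_slab.1 hq).2
  obtain ⟨L, hL0, hL⟩ := S.field_u.bounded hc hT
  obtain ⟨K, hK0, hK⟩ := S.field_u.norm_dl_le S.u hc hT
  have hPL : IsPicardLindelof (fun s x => S.u (s, x)) (⟨q.1, hcq, le_rfl⟩ : Icc c q.1) q.2
      (L * (q.1 - c)).toNNReal 0 L.toNNReal K.toNNReal := by
    refine ⟨fun s hs => ?_, fun x _ => ?_, fun s hs x _ => ?_, ?_⟩
    · refine LipschitzOnWith.of_dist_le_mul fun x _ y _ => ?_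
      have := hK (s, y) hs (x - y)
      rw [dl, show (s, y) + ((0 : ℝ), x - y) = (s, x) by simp] at this
      rw [dist_eq_norm, dist_eq_norm, Real.coe_toNNReal _ hK0]
      exact this.trans (by gcongr; exact min_le_right _ _)
    · refine S.field_u.smooth.continuousOn.comp (by fun_prop) fun s hs => ?_
      exact slab_subset hc hT hs
    · rw [Real.coe_toNNReal _ hL0]
      exact hL (s, x) hs
    · rw [Real.coe_toNNReal _ hL0, Real.coe_toNNReal _ (mul_nonneg hL0 (by linarith))]
      simp only [sub_self, NNReal.coe_zero, sub_zero]
      rw [max_eq_right (by linarith)]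
  obtain ⟨γ, h0, h1⟩ := hPL.exists_eq_forall_mem_Icc_hasDerivWithinAt₀
  exact ⟨γ, h0, fun s hs => (h1 s hs).continuousWithinAt,
    fun s hs => (h1 s ⟨hs.1.le, hs.2.le⟩).hasDerivAt (Icc_mem_nhds hs.1 hs.2)⟩

end Trajectory

section Derivative

variable {d : ℕ} {α : ℝ} {S : Flow d α} {q : Pt d}

lemma abs_dl_le_of_pd {T : ℝ} {F : Pt d → ℝ} (hF : IsField T F) (hq : q ∈ slab d T) {B : ℝ}
    (hB : ∀ z l, |pd l F (q + (0, z))| ≤ B) (z : Sp d) : |dl F q z| ≤ d * B * ‖z‖ := by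
  have hr := IncReg.dl_isField hF
  have h := (convex_univ (𝕜 := ℝ) (E := Sp d)).norm_image_sub_le_of_norm_fderiv_le (𝕜 := ℝ)
    (f := dl F q) (C := d * B) (fun z _ => hr.differentiable_right hq z) (fun z _ => ?_)
    (mem_univ 0) (mem_univ z)
  · have h0 : dl F q 0 = 0 := by
      have : q + ((0 : ℝ), (0 : Sp d)) = q := add_zero q
      simp [dl, this]
    simpa [h0] using h
  · have hB0 : 0 ≤ d * B := by
      rcases Nat.eq_zero_or_pos d with h | h
      · simp [h]
      · exact mul_nonneg (by positivity) ((abs_nonneg _).trans (hB 0 ⟨0, h⟩))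
    refine ContinuousLinearMap.opNorm_le_bound _ hB0 fun v => ?_
    rw [fderiv_dl_right hF hq, apply_zero_right]
    refine (norm_sum_le _ _).trans ?_
    calc ∑ l, ‖v l • fderiv ℝ F (q + (0, z)) (0, unit l)‖ ≤ ∑ l : Fin d, ‖v‖ * B := by
          refine Finset.sum_le_sum fun l _ => ?_
          rw [norm_smul]
          exact mul_le_mul (PiLp.norm_apply_le v l) (hB z l) (norm_nonneg _) (norm_nonneg _)
      _ = d * B * ‖v‖ := by simp; ring

lemma integral_gauss_transport_pd {a : Pt d → ℝ} (ha : IsField S.T a) (w : Fin d)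
    (hq : q ∈ slab d S.T) {s : ℝ} (hs : 0 < s) :
    ∫ z, gauss d z * fderiv ℝ (pd w a) (q + (0, s • z)) (1, S.u q)
      = -(s⁻¹ * moll (kd w (gauss d)) s (md S a) q) - (s ^ 2)⁻¹ * ∑ l,
        ∫ z, kd l (kd w (gauss d)) z * (dl a q (s • z) * dl (uc l S) q (s • z)) := by
  set h : Pt d → ℝ := fun q' => fderiv ℝ a q' (1, S.u q) with hh
  have hf : IsField S.T h := ha.fderiv.clm_apply (.const _)
  have h1 : ∀ q' ∈ slab d S.T, pd w h q' = fderiv ℝ (pd w a) q' (1, S.u q) := fun q' hq' => by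
    have := fderiv_fderiv_apply ha (IsField.const ((1 : ℝ), S.u q)) hq' (0, unit w)
    rw [fderiv_pd ha w hq', fderiv_fderiv_comm ha hq', pd, hh, this]
    simp
  have h2 : ∫ z, gauss d z * fderiv ℝ (pd w a) (q + (0, s • z)) (1, S.u q)
      = moll (gauss d) s (pd w h) q := by
    rw [moll]
    congr 1
    funext z
    rw [h1 _ (add_mem_slab hq _)]
  have h3 := moll_kd (gauss d) hf hq s w
  have h4 : moll (kd w (gauss d)) s h q = _ := moll_transport (kd w (gauss d)) ha hq hs
  rw [h4] at h3
  rw [h2]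
  have h5 : moll (gauss d) s (pd w h) q = -(s⁻¹) * (-s * moll (gauss d) s (pd w h) q) := by
    field_simp
  rw [h5, ← h3]
  field_simp
  ring

/-- Along trajectories, the viscous terms cancel if the square of the scale decreases at rate
`ν`. -/
lemma hasDerivAt_smoothing {a N : Pt d → ℝ} (ha : IsField S.T a) (hN : IsField S.T N)
    {i : Fin d} {V : List (Fin d)}
    (hmd : ∀ q ∈ slab d S.T, md S a q = S.ν * ∑ l, pd l (pd l a) q - pdl V (pd i S.p) q + N q)
    (w : Fin d) {γ : ℝ → Sp d} {r : ℝ → ℝ} {t : ℝ} (hq : (t, γ t) ∈ slab d S.T) (hr0 : 0 < r t)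
    (hγ : HasDerivAt γ (S.u (t, γ t)) t) (hr : HasDerivAt r (-S.ν / (2 * r t)) t) :
    HasDerivAt (fun t => moll (gauss d) (r t) (pd w a) (t, γ t))
      (-(((r t) ^ 2)⁻¹ * ∑ l, ∫ z, kd l (kd w (gauss d)) z *
          (dl a (t, γ t) (r t • z) * dl (uc l S) (t, γ t) (r t • z)))
        - moll (gauss d) (r t) (pdl V (pdl [w, i] S.p)) (t, γ t)
        - (r t)⁻¹ * moll (kd w (gauss d)) (r t) N (t, γ t)) t := by
  have hγ' : HasDerivAt (fun t => (t, γ t)) (1, S.u (t, γ t)) t := (hasDerivAt_id t).prodMk hγ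
  have h := moll_hasDerivAt (gauss d) (ha.pd w) hq hγ' hr
  convert h using 1
  obtain ⟨L, -, hL⟩ := moll_hasFDerivAt (gauss d) (ha.pd w) hq (r t)
  have hI := (hL (1, S.u (t, γ t)) 0).1
  have hI' := (hL 0 (-S.ν / (2 * r t))).1
  simp only [zero_smul, Prod.mk_zero_zero, add_zero, zero_add] at hI hI'
  simp_rw [map_add, mul_add]
  rw [integral_add hI hI', integral_gauss_transport_pd ha w hq hr0,
    moll_gauss_scale (ha.pd w) hq]
  have hΔ : IsField S.T fun q => ∑ l, pd l (pd l a) q := .sum fun l => (ha.pd l).pd l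
  have hP : IsField S.T (pdl V (pd i S.p)) := (S.field_p.pd i).pdl V
  have e1 : moll (kd w (gauss d)) (r t) (md S a) (t, γ t)
      = S.ν * moll (kd w (gauss d)) (r t) (fun q => ∑ l, pd l (pd l a) q) (t, γ t)
        + -1 * moll (kd w (gauss d)) (r t) (pdl V (pd i S.p)) (t, γ t)
        + moll (kd w (gauss d)) (r t) N (t, γ t) := by
    rw [moll_congr (h := fun q => (S.ν * (∑ l, pd l (pd l a) q) + -1 * pdl V (pd i S.p) q) + N q)
      (fun q hq => by rw [hmd q hq]; ring) _ hq]
    have f1 : IsField S.T fun q => S.ν * ∑ l, pd l (pd l a) q := (IsField.const S.ν).mul hΔ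
    have f2 : IsField S.T fun q => -1 * pdl V (pd i S.p) q := (IsField.const (-1)).mul hP
    have f3 : IsField S.T fun q => S.ν * (∑ l, pd l (pd l a) q) + -1 * pdl V (pd i S.p) q := by
      simpa [sub_eq_add_neg] using f1.sub hP
    rw [moll_add f3 hN _ hq, moll_add f1 f2 _ hq,
      moll_const_mul, moll_const_mul]
  have e2 : moll (gauss d) (r t) (pd w fun q => ∑ l, pd l (pd l a) q) (t, γ t)
      = ∑ l, moll (gauss d) (r t) (pd l (pd l (pd w a))) (t, γ t) := by
    rw [← moll_sum (A := Finset.univ) (fun l => ((ha.pd w).pd l).pd l) _ hq]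
    refine moll_congr (fun q hq => ?_) _ hq _
    rw [pd_sum (fun l => (ha.pd l).pd l) w hq]
    refine Finset.sum_congr rfl fun l _ => ?_
    rw [pd_comm (ha.pd l) w l hq]
    exact pd_congr (fun q hq => pd_comm ha w l hq) l hq
  have e3 : moll (gauss d) (r t) (pd w (pdl V (pd i S.p))) (t, γ t)
      = moll (gauss d) (r t) (pdl V (pdl [w, i] S.p)) (t, γ t) :=
    moll_congr (fun q hq => pd_pdl (S.field_p.pd i) w V q hq) _ hq _
  rw [e1, moll_kd (gauss d) hΔ hq, moll_kd (gauss d) hP hq, e2, e3]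
  field_simp
  ring

end Derivative

open Asymptotics Filter

/-- `y ^ b * x ≤ x ^ b * y` for `x ≤ y` and `b ≤ 1`. -/
lemma rpow_mul_le_rpow_mul {x y b : ℝ} (hx : 0 ≤ x) (hxy : x ≤ y) (hb : b ≤ 1) :
    y ^ b * x ≤ x ^ b * y := by
  rcases hx.eq_or_lt with rfl | hx
  · simpa using mul_nonneg (Real.rpow_nonneg le_rfl b) hxy
  have hy := hx.trans_le hxy
  have h1 : x = x ^ b * x ^ (1 - b) := by rw [← Real.rpow_add hx]; simp
  have h2 : y = y ^ b * y ^ (1 - b) := by rw [← Real.rpow_add hy]; simp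
  calc y ^ b * x = y ^ b * (x ^ b * x ^ (1 - b)) := by rw [← h1]
    _ ≤ y ^ b * (x ^ b * y ^ (1 - b)) := by
        gcongr
    _ = x ^ b * (y ^ b * y ^ (1 - b)) := by ring
    _ = _ := by rw [← h2]

lemma rpow_le_one_add {x b : ℝ} (hx : 0 ≤ x) (hb0 : 0 ≤ b) (hb : b ≤ 1) : x ^ b ≤ 1 + x := by
  rcases le_total x 1 with h | h
  · exact (Real.rpow_le_one hx h hb0).trans (by linarith)
  · exact (Real.rpow_le_rpow_of_exponent_le h hb).trans (by rw [Real.rpow_one]; linarith)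

lemma isBigO_principal_iff {X : Type*} {s : Set X} {f g : X → ℝ} (hg : ∀ x ∈ s, 0 ≤ g x) :
    f =O[𝓟 s] g ↔ ∃ C : ℝ, 0 ≤ C ∧ ∀ x ∈ s, |f x| ≤ C * g x := by
  constructor
  · intro h
    obtain ⟨C, hC, h⟩ := h.exists_nonneg
    refine ⟨C, hC, fun x hx => ?_⟩
    have := isBigOWith_principal.1 h x hx
    rwa [Real.norm_eq_abs, Real.norm_of_nonneg (hg x hx)] at this
  · rintro ⟨C, -, h⟩
    refine isBigO_principal.2 ⟨C, fun x hx => ?_⟩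
    rw [Real.norm_eq_abs, Real.norm_of_nonneg (hg x hx)]
    exact h x hx

/-- The parameters of the estimates. -/
structure Cfg (d : ℕ) (α : ℝ) where
  S : Flow d α
  R : ℝ
  κ : ℝ
  ℓ : ℝ
  q : Pt d
  z : Sp d
  y : Sp d

section Smoothing

variable {d : ℕ} {α : ℝ}

/-- Admissible length scales for smoothing by `j` derivatives. -/
def Heat (d : ℕ) (α : ℝ) (j : ℕ) : Set (Cfg d α) :=
  {x | 0 < x.R ∧ x.S.M * x.R ^ (1 + α) ≤ x.S.ν ∧ x.q ∈ slab d x.S.T ∧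
    (j + 1) * x.R ^ 2 ≤ x.S.ν * x.q.1}

lemma Heat.mono {i j : ℕ} (h : i ≤ j) : Heat d α j ⊆ Heat d α i := fun x hx =>
  ⟨hx.1, hx.2.1, hx.2.2.1, le_trans (by gcongr) hx.2.2.2⟩

/-- Words with `i` spatial derivatives satisfy the heat smoothing estimate. -/
def Smooth (d : ℕ) (α : ℝ) (i : ℕ) : Prop :=
  ∀ F, Word (d := d) (α := α) 0 i F →
    (fun x : Cfg d α => F x.S x.q) =O[𝓟 (Heat d α i)] fun x => x.S.M * (x.R ^ α / x.R ^ i)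

lemma isBigO_dl_of_isBigO {s : Set (Cfg d α)} {F : Flow d α → Pt d → ℝ}
    {w : Cfg d α → ℝ} (hw : ∀ x ∈ s, 0 ≤ w x)
    (hs : ∀ x ∈ s, ∀ z, {x with q := x.q + (0, z)} ∈ s)
    (hwz : ∀ x z, w {x with q := x.q + (0, z)} = w x)
    (h : (fun x : Cfg d α => F x.S x.q) =O[𝓟 s] w) :
    (fun x : Cfg d α => dl (F x.S) x.q x.z) =O[𝓟 s] w := by
  obtain ⟨C, hC, h⟩ := (isBigO_principal_iff hw).1 h
  refine (isBigO_principal_iff hw).2 ⟨2 * C, by positivity, fun x hx => ?_⟩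
  have h1 := h _ (hs x hx x.z)
  rw [hwz] at h1
  have h2 := h x hx
  rw [dl]
  refine (abs_sub _ _).trans ?_
  linarith

lemma isBigO_dl_of_pd {s : Set (Cfg d α)} {F : Flow d α → Pt d → ℝ}
    (hF : ∀ S, IsField S.T (F S)) {w : Cfg d α → ℝ} (hw : ∀ x ∈ s, 0 ≤ w x)
    (hq : ∀ x ∈ s, x.q ∈ slab d x.S.T)
    (hs : ∀ x ∈ s, ∀ z, {x with q := x.q + (0, z)} ∈ s)
    (hwz : ∀ x z, w {x with q := x.q + (0, z)} = w x)
    (h : ∀ l, (fun x : Cfg d α => pd l (F x.S) x.q) =O[𝓟 s] w) :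
    (fun x : Cfg d α => dl (F x.S) x.q x.z) =O[𝓟 s] fun x => w x * ‖x.z‖ := by
  have h' := fun l => (isBigO_principal_iff hw).1 (h l)
  choose C hC h' using h'
  refine (isBigO_principal_iff fun x hx => mul_nonneg (hw x hx) (norm_nonneg _)).2
    ⟨d * ∑ l, C l, mul_nonneg (by positivity) (Finset.sum_nonneg fun l _ => hC l), fun x hx => ?_⟩
  refine (abs_dl_le_of_pd (hF x.S) (hq x hx) (B := (∑ l, C l) * w x) (fun z l => ?_)
    x.z).trans (by apply le_of_eq; ring)
  have h1 := h' l _ (hs x hx z)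
  rw [hwz] at h1
  refine h1.trans ?_
  have := hw x hx
  gcongr
  exact Finset.single_le_sum (f := C) (fun l _ => hC l) (Finset.mem_univ l)

lemma Heat.translate {j : ℕ} : ∀ x ∈ Heat d α j, ∀ z : Sp d,
    {x with q := x.q + (0, z)} ∈ Heat d α j :=
  fun _ hx z => ⟨hx.1, hx.2.1, add_mem_slab hx.2.2.1 z, by simpa using hx.2.2.2⟩

lemma isBigO_dl_uc (i : Fin d) {s : Set (Cfg d α)} (hq : ∀ x ∈ s, x.q ∈ slab d x.S.T) :
    (fun x : Cfg d α => dl (uc i x.S) x.q x.z) =O[𝓟 s] fun x => x.S.M * ‖x.z‖ ^ α := by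
  refine (isBigO_principal_iff fun x _ => mul_nonneg x.S.M_pos.le (by positivity)).2
    ⟨1, zero_le_one, fun x hx => ?_⟩
  rw [one_mul]
  exact (PiLp.norm_apply_le (x.S.u (x.q + (0, x.z)) - x.S.u x.q) i).trans
    (x.S.holder x.q (hq x hx) x.z)

lemma Word.eq_uc {F : Flow d α → Pt d → ℝ} (hF : Word 0 0 F) : ∃ i, F = uc i := by
  cases hF with
  | base i => exact ⟨i, rfl⟩

lemma isBigO_dl_weak {i j : ℕ} (hi : i ≤ j) (hsm : 1 ≤ i → Smooth d α i)
    {F : Flow d α → Pt d → ℝ} (hF : Word 0 i F) :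
    (fun x : Cfg d α => dl (F x.S) x.q x.z) =O[𝓟 (Heat d α j)]
      fun x => x.S.M * ((‖x.z‖ ^ α + x.R ^ α) / x.R ^ i) := by
  have hw : ∀ x ∈ Heat d α j, 0 ≤ x.S.M * ((‖x.z‖ ^ α + x.R ^ α) / x.R ^ i) := fun x hx => by
    have := x.S.M_pos
    have := hx.1
    positivity
  rcases Nat.eq_zero_or_pos i with rfl | hi0
  · obtain ⟨l, rfl⟩ := hF.eq_uc
    refine (isBigO_dl_uc l fun x hx => hx.2.2.1).trans ?_
    refine (isBigO_principal_iff hw).2 ⟨1, zero_le_one, fun x hx => ?_⟩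
    have := x.S.M_pos
    have := hx.1
    rw [abs_of_nonneg (by positivity), one_mul, pow_zero, div_one]
    gcongr
    linarith [Real.rpow_nonneg hx.1.le α]
  · have h := (hsm hi0 F hF).mono (principal_mono.2 (Heat.mono hi))
    refine (isBigO_dl_of_isBigO (fun x hx => ?_) Heat.translate (fun _ _ => rfl) h).trans ?_
    · have := x.S.M_pos
      have := hx.1
      positivity
    refine (isBigO_principal_iff hw).2 ⟨1, zero_le_one, fun x hx => ?_⟩
    have := x.S.M_pos
    have := hx.1
    rw [abs_of_nonneg (by positivity), one_mul]
    gcongr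
    linarith [Real.rpow_nonneg (norm_nonneg x.z) α]

lemma isBigO_dl_strong (hα : 0 < α) (hα1 : α < 1) {i j : ℕ} (hi : i < j)
    (hsm : ∀ i, 1 ≤ i → i ≤ j → Smooth d α i) {F : Flow d α → Pt d → ℝ} (hF : Word 0 i F) :
    (fun x : Cfg d α => dl (F x.S) x.q x.z) =O[𝓟 (Heat d α j)]
      fun x => x.S.M * (‖x.z‖ ^ α / x.R ^ i) := by
  have hw : ∀ x ∈ Heat d α j, 0 ≤ x.S.M * (‖x.z‖ ^ α / x.R ^ i) := fun x hx => by
    have := x.S.M_pos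
    have := hx.1
    positivity
  have hw' : ∀ x ∈ Heat d α j, 0 ≤ x.S.M * (x.R ^ α / x.R ^ (i + 1)) := fun x hx => by
    have := x.S.M_pos
    have := hx.1
    positivity
  have h1 := isBigO_dl_of_pd hF.isField hw' (fun x hx => hx.2.2.1) Heat.translate (fun _ _ => rfl)
    fun l => (hsm (i + 1) (by omega) hi _ (hF.pd l)).mono (principal_mono.2 (Heat.mono hi))
  obtain ⟨C₁, hC₁, h1⟩ := (isBigO_principal_iff fun x hx =>
    mul_nonneg (hw' x hx) (norm_nonneg _)).1 h1
  obtain ⟨C₂, hC₂, h2⟩ := (isBigO_principal_iff fun x hx => by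
    have := x.S.M_pos
    have := hx.1
    positivity).1 (isBigO_dl_weak hi.le (fun h => hsm i h hi.le) hF)
  refine (isBigO_principal_iff hw).2 ⟨C₁ + 2 * C₂, by positivity, fun x hx => ?_⟩
  have hM := x.S.M_pos
  have hR := hx.1
  have hz := norm_nonneg x.z
  rw [add_mul]
  rcases le_total ‖x.z‖ x.R with h | h
  · refine (h1 x hx).trans (le_trans ?_ (le_add_of_nonneg_right (by positivity)))
    have h3 := rpow_mul_le_rpow_mul hz h hα1.le
    rw [mul_assoc x.S.M]
    gcongr
    calc x.R ^ α / x.R ^ (i + 1) * ‖x.z‖ = (x.R ^ α * ‖x.z‖) / x.R ^ (i + 1) := by ring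
      _ ≤ (‖x.z‖ ^ α * x.R) / x.R ^ (i + 1) := by gcongr
      _ = _ := by rw [pow_succ]; field_simp
  · refine (h2 x hx).trans (le_trans ?_ (le_add_of_nonneg_left (by positivity)))
    have h3 := Real.rpow_le_rpow hR.le h hα.le
    calc C₂ * (x.S.M * ((‖x.z‖ ^ α + x.R ^ α) / x.R ^ i))
        ≤ C₂ * (x.S.M * ((‖x.z‖ ^ α + ‖x.z‖ ^ α) / x.R ^ i)) := by gcongr
      _ = _ := by ring

lemma Inc.isBigO_one {k j : ℕ} {s : Set (Cfg d α)} {w : Cfg d α → ℝ}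
    (h : ∀ F, Word k j F → (fun x : Cfg d α => dl (F x.S) x.q x.z) =O[𝓟 s] w)
    {g : Flow d α → Pt d → Sp d → ℝ} (hg : Inc 1 k j g) :
    (fun x : Cfg d α => g x.S x.q x.z) =O[𝓟 s] w := by
  generalize hn : (1 : ℕ) = n at hg
  induction hg with
  | one hF => exact h _ hF
  | mul hg hg' => have := hg.pos; have := hg'.pos; omega
  | add _ _ ih ih' => exact (ih h hn).add (ih' h hn)

lemma isBigO_inc_two (hα : 0 < α) (hα1 : α < 1) {j : ℕ}
    (hsm : ∀ i, 1 ≤ i → i ≤ j → Smooth d α i) {g : Flow d α → Pt d → Sp d → ℝ}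
    (hg : Inc 2 0 j g) :
    (fun x : Cfg d α => g x.S x.q x.z) =O[𝓟 (Heat d α j)]
      fun x => x.S.M ^ 2 / x.R ^ j * (‖x.z‖ ^ α * (‖x.z‖ ^ α + x.R ^ α)) := by
  generalize hn : (2 : ℕ) = n at hg
  generalize hk : (0 : ℕ) = k at hg
  induction hg with
  | one => omega
  | add _ _ ih ih' => exact (ih hsm hn hk).add (ih' hsm hn hk)
  | @mul n k i n' k' i' g g' hg hg' =>
    have := hg.pos
    have := hg'.pos
    obtain rfl : n = 1 := by omega
    obtain rfl : n' = 1 := by omega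
    obtain rfl : k = 0 := by omega
    obtain rfl : k' = 0 := by omega
    have weak : ∀ {a g}, a ≤ i + i' → Inc 1 0 a g → (fun x : Cfg d α => g x.S x.q x.z)
        =O[𝓟 (Heat d α (i + i'))] fun x => x.S.M * ((‖x.z‖ ^ α + x.R ^ α) / x.R ^ a) :=
      fun {a g} ha hg => hg.isBigO_one fun F hF => isBigO_dl_weak ha (fun h => hsm _ h ha) hF
    have strong : ∀ {a g}, (a < i + i' ∨ a = 0) → Inc 1 0 a g → (fun x : Cfg d α => g x.S x.q x.z)
        =O[𝓟 (Heat d α (i + i'))] fun x => x.S.M * (‖x.z‖ ^ α / x.R ^ a) := fun {a g} ha hg => by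
      refine hg.isBigO_one fun F hF => ?_
      rcases ha with ha | rfl
      · exact isBigO_dl_strong hα hα1 ha hsm hF
      · obtain ⟨l, rfl⟩ := hF.eq_uc
        simpa using isBigO_dl_uc l fun x hx => hx.2.2.1
    rcases Nat.eq_zero_or_pos i with rfl | hi
    · refine ((strong (by omega) hg).mul (weak (by omega) hg')).congr_right fun x => ?_
      rw [pow_add x.R]
      field_simp
      ring
    · refine ((weak (by omega) hg).mul (strong (by omega) hg')).congr_right fun x => ?_
      rw [pow_add x.R]
      field_simp
      ring

lemma NP.isBigO_heat {j : ℕ} (hsm : ∀ i, 1 ≤ i → i ≤ j → Smooth d α i)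
    {N : Flow d α → Pt d → ℝ} (hN : NP False 0 j N) :
    (fun x : Cfg d α => N x.S x.q) =O[𝓟 (Heat d α j)]
      fun x => x.S.M ^ 2 * (x.R ^ α * x.R ^ α / x.R ^ (j + 1)) := by
  generalize hk : (0 : ℕ) = k at hN
  induction hN with
  | zero => exact isBigO_zero _ _
  | visc hv _ => exact hv.elim
  | add _ _ ih ih' => exact (ih hsm hk).add (ih' hsm hk)
  | neg _ ih => exact (ih hsm hk).neg_left
  | @prod k k' K j j' J F G hF hG hj hj' hK hJ =>
    obtain rfl : k = 0 := by omega
    obtain rfl : k' = 0 := by omega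
    refine (((hsm j hj (by omega) F hF).mono (principal_mono.2 (Heat.mono (by omega)))).mul
      ((hsm j' hj' (by omega) G hG).mono (principal_mono.2 (Heat.mono (by omega))))).congr_right
      fun x => ?_
    rw [← hJ, pow_add x.R]
    field_simp

end Smoothing

section Smoothing

variable {d : ℕ} {α : ℝ}

lemma norm_smul_rpow {s : ℝ} (hs : 0 < s) (z : Sp d) (b : ℝ) : ‖s • z‖ ^ b = s ^ b * ‖z‖ ^ b := by
  rw [norm_smul, Real.norm_of_nonneg hs.le, Real.mul_rpow hs.le (norm_nonneg _)]

/-- The truncated pressure term in the smoothing estimate. -/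
lemma Sing.isBigO_heat (hα : 0 < α) (hα1 : α < 1) {j : ℕ}
    (hsm : ∀ i, 1 ≤ i → i ≤ j → Smooth d α i) {P : Flow d α → ℝ → Pt d → ℝ} (hP : Sing 1 0 j P) :
    (fun x : Cfg d α => P x.S x.ℓ x.q) =O[𝓟 (Heat d α j ∩ {x | 0 < x.ℓ ∧ x.ℓ ≤ x.R})]
      fun x => x.S.M ^ 2 / x.R ^ j * (x.R ^ α * x.ℓ ^ (α - 2)) := by
  have hP' : ∃ K, 0 = K ∧ Sing 1 K j P := ⟨0, rfl, hP⟩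
  clear hP
  obtain ⟨K, hK, hP⟩ := hP'
  induction hP with
  | zero => exact isBigO_zero _ _
  | add _ _ ih ih' => exact (ih hsm hK).add (ih' hsm hK)
  | @base n k K j g Ψ hg hn hk =>
    obtain rfl : n = 2 := by omega
    obtain rfl : k = 0 := by omega
    obtain ⟨C, hC, h⟩ := (isBigO_principal_iff fun x hx => by
      have := x.S.M_pos
      have := hx.1
      positivity).1 (isBigO_inc_two hα hα1 hsm hg)
    refine (isBigO_principal_iff fun x hx => ?_).2
      ⟨C * (1 / (2 - 2 * α) + 1 / (2 - α)) * kw Ψ 2, ?_, fun x hx => ?_⟩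
    · have := x.S.M_pos
      have := hx.1.1
      have := hx.2.1
      positivity
    · have h1 : 0 < 2 - 2 * α := by linarith
      have h2 : 0 < 2 - α := by linarith
      have := kw_nonneg Ψ 2
      positivity
    have hM := x.S.M_pos
    have hR := hx.1.1
    have hℓ := hx.2.1
    have a1 : 2 * α - 3 < -1 := by linarith
    have a2 : α - 3 < -1 := by linarith
    set A := x.S.M ^ 2 / x.R ^ j with hA
    have hA0 : 0 ≤ A := by positivity
    have i1 := integrableOn_Ioi_rpow_of_lt a1 hℓ
    have i2 := integrableOn_Ioi_rpow_of_lt a2 hℓ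
    have hw : IntegrableOn (fun s : ℝ => C * A * (s ^ (2 * α - 3) + x.R ^ α * s ^ (α - 3)))
        (Ioi x.ℓ) :=
      (i1.add (i2.const_mul _)).const_mul _
    have hm := abs_integral_scale_le
      (f := fun p => (p.1 ^ (2 + 1))⁻¹ * Ψ p.2 * g x.S x.q (p.1 • p.2))
      hw Ψ 2 fun s hs z => ?_
    · refine hm.trans ?_
      have hkw := kw_nonneg Ψ 2
      rw [integral_const_mul, integral_add i1 (i2.const_mul _), integral_const_mul,
        integral_Ioi_rpow_of_lt a1 hℓ, integral_Ioi_rpow_of_lt a2 hℓ]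
      have e1 : -x.ℓ ^ (2 * α - 3 + 1) / (2 * α - 3 + 1)
          ≤ 1 / (2 - 2 * α) * (x.R ^ α * x.ℓ ^ (α - 2)) := by
        have : x.ℓ ^ (2 * α - 3 + 1) = x.ℓ ^ α * x.ℓ ^ (α - 2) := by
          rw [← Real.rpow_add hℓ]; ring_nf
        have h1 : 0 < 2 - 2 * α := by linarith
        rw [show 2 * α - 3 + 1 = -(2 - 2 * α) by ring, neg_div_neg_eq] at *
        rw [this, div_eq_mul_inv, mul_comm, one_div]
        have h3 := Real.rpow_le_rpow hℓ.le hx.2.2 hα.le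
        gcongr
      have e2 : x.R ^ α * (-x.ℓ ^ (α - 3 + 1) / (α - 3 + 1))
          = 1 / (2 - α) * (x.R ^ α * x.ℓ ^ (α - 2)) := by
        rw [show α - 3 + 1 = -(2 - α) by ring, neg_div_neg_eq, show -(2 - α) = α - 2 by ring]
        ring
      rw [e2]
      calc _ ≤ C * A * (1 / (2 - 2 * α) * (x.R ^ α * x.ℓ ^ (α - 2))
          + 1 / (2 - α) * (x.R ^ α * x.ℓ ^ (α - 2))) * kw Ψ 2 := by gcongr
        _ = _ := by ring
    · have hs0 : 0 < s := hℓ.trans hs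
      have hz := norm_nonneg z
      have h1 := h {x with z := s • z} hx.1
      dsimp only at h1
      rw [norm_smul_rpow hs0] at h1
      have h2 : ‖z‖ ^ α ≤ 1 + ‖z‖ := rpow_le_one_add hz hα.le hα1.le
      have h3 : s ^ α * ‖z‖ ^ α * (s ^ α * ‖z‖ ^ α + x.R ^ α)
          ≤ s ^ α * (s ^ α + x.R ^ α) * (1 + ‖z‖) ^ 2 := by
        calc _ ≤ s ^ α * (1 + ‖z‖) * (s ^ α * (1 + ‖z‖) + x.R ^ α * (1 + ‖z‖)) := by
              gcongr
              nlinarith [Real.rpow_nonneg hR.le α]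
          _ = _ := by ring
      have h4 : (s ^ (2 + 1))⁻¹ * (s ^ α * (s ^ α + x.R ^ α))
          = s ^ (2 * α - 3) + x.R ^ α * s ^ (α - 3) := by
        rw [Real.rpow_sub hs0, Real.rpow_sub hs0, two_mul α, Real.rpow_add hs0]
        norm_num
        field_simp
      rw [abs_mul, abs_mul, abs_of_nonneg (by positivity : 0 ≤ (s ^ (2 + 1))⁻¹)]
      calc _ ≤ (s ^ (2 + 1))⁻¹ * |Ψ z|
            * (C * (A * (s ^ α * (s ^ α + x.R ^ α) * (1 + ‖z‖) ^ 2))) := by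
            gcongr
            exact h1.trans (by gcongr)
        _ = C * A * ((s ^ (2 + 1))⁻¹ * (s ^ α * (s ^ α + x.R ^ α))) * (|Ψ z| * (1 + ‖z‖) ^ 2) := by
            ring
        _ = _ := by rw [h4]

end Smoothing

section Smoothing

variable {d : ℕ} {α : ℝ}

lemma abs_moll_pd_le {T : ℝ} {a : Pt d → ℝ} (ha : IsField T a) {q : Pt d} (hq : q ∈ slab d T)
    (w : Fin d) {R C : ℝ} (hR : 0 < R) (n : ℕ)
    (h : ∀ z, |dl a q (R • z)| ≤ C * (1 + ‖z‖) ^ n) :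
    |moll (gauss d) R (pd w a) q| ≤ R⁻¹ * (C * kw (kd w (gauss d)) n) := by
  have hf : IsField T fun q' => a q' - a q := ha.sub (.const _)
  have h1 := moll_kd (gauss d) hf hq R w
  have h2 : pd w (fun q' => a q' - a q) = pd w a := by
    funext q'
    simp [pd, fderiv_sub_const]
  rw [h2] at h1
  have h3 : moll (gauss d) R (pd w a) q
      = -R⁻¹ * moll (kd w (gauss d)) R (fun q' => a q' - a q) q := by
    rw [h1]
    field_simp
  rw [h3, abs_mul, abs_neg, abs_of_pos (inv_pos.2 hR)]
  gcongr
  exact abs_moll_le _ n h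

lemma abs_le_of_smoothing {f f' : ℝ → ℝ} {ν R α t F₀ K : ℝ} (hα : 0 < α) (hν : 0 < ν) (hR : 0 < R)
    (hf : ContinuousOn f (Icc (t - R ^ 2 / ν) t))
    (hf' : ∀ s ∈ Ico (t - R ^ 2 / ν) t, HasDerivAt f (f' s) s)
    (h0 : |f (t - R ^ 2 / ν)| ≤ F₀)
    (hb : ∀ s ∈ Ico (t - R ^ 2 / ν) t, |f' s| ≤ K * √(ν * (t - s)) ^ (α - 2)) :
    |f t| ≤ F₀ + K * (2 / (α * ν)) * R ^ α := by
  have hc : t - R ^ 2 / ν ≤ t := by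
    have : 0 ≤ R ^ 2 / ν := by positivity
    linarith
  have hRα : (R ^ 2) ^ (α / 2) = R ^ α := by
    rw [← Real.rpow_natCast R 2, ← Real.rpow_mul hR.le]
    congr 1
    push_cast
    ring
  have h := image_norm_le_of_norm_deriv_right_le_deriv_boundary' (f := f) (f' := f')
    (B := fun s => F₀ + K * (2 / (α * ν)) * (R ^ α - (ν * (t - s)) ^ (α / 2)))
    (B' := fun s => K * √(ν * (t - s)) ^ (α - 2)) hf
    (fun s hs => (hf' s hs).hasDerivWithinAt) ?_ ?_ (fun s hs => ?_) hb ⟨hc, le_rfl⟩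
  · simpa [Real.zero_rpow (by positivity : α / 2 ≠ 0)] using h
  · have e : ν * (t - (t - R ^ 2 / ν)) = R ^ 2 := by field_simp; ring
    simp only [e, hRα, sub_self, mul_zero, add_zero]
    simpa using h0
  · refine ContinuousOn.add continuousOn_const (ContinuousOn.mul continuousOn_const
      (ContinuousOn.sub continuousOn_const (ContinuousOn.rpow_const (by fun_prop) fun s _ => ?_)))
    exact Or.inr (by positivity)
  · have hp : 0 < ν * (t - s) := mul_pos hν (by linarith [hs.2])
    have h1 : HasDerivAt (fun s => ν * (t - s)) (-ν) s := by
      simpa using ((hasDerivAt_id s).const_sub t).const_mul ν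
    have h2 := (((h1.rpow_const (p := α / 2) (Or.inl hp.ne')).const_sub (R ^ α)).const_mul
      (K * (2 / (α * ν)))).const_add F₀
    refine (h2.congr_deriv ?_).hasDerivWithinAt
    rw [Real.sqrt_eq_rpow, ← Real.rpow_mul hp.le, show 1 / 2 * (α - 2) = α / 2 - 1 by ring]
    field_simp

/-- The derivative in `hasDerivAt_smoothing`. -/
noncomputable def smoothingRate (S : Flow d α) (a N : Pt d → ℝ) (i w : Fin d) (V : List (Fin d))
    (ρ : ℝ) (q : Pt d) : ℝ :=
  -((ρ ^ 2)⁻¹ * ∑ l, ∫ z, kd l (kd w (gauss d)) z * (dl a q (ρ • z) * dl (uc l S) q (ρ • z)))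
    - moll (gauss d) ρ (pdl V (pdl [w, i] S.p)) q
    - ρ⁻¹ * moll (kd w (gauss d)) ρ N q

lemma abs_pd_le_of_smoothingRate (hα : 0 < α) {S : Flow d α} {a N : Pt d → ℝ} (ha : IsField S.T a)
    (hN : IsField S.T N) {i : Fin d} {V : List (Fin d)}
    (hmd : ∀ q ∈ slab d S.T, md S a q = S.ν * ∑ l, pd l (pd l a) q - pdl V (pd i S.p) q + N q)
    (w : Fin d) {q : Pt d} (hq : q ∈ slab d S.T) {R : ℝ} (hR : 0 < R) (hRq : R ^ 2 < S.ν * q.1)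
    {F₀ K : ℝ}
    (h0 : ∀ q' ∈ slab d S.T, q.1 - R ^ 2 / S.ν ≤ q'.1 → |moll (gauss d) R (pd w a) q'| ≤ F₀)
    (hb : ∀ q' ∈ slab d S.T, q.1 - R ^ 2 / S.ν ≤ q'.1 → ∀ ρ, 0 < ρ → ρ ≤ R →
      |smoothingRate S a N i w V ρ q'| ≤ K * ρ ^ (α - 2)) :
    |pd w a q| ≤ F₀ + K * (2 / (α * S.ν)) * R ^ α := by
  have hν := S.ν_pos
  have hqT := mem_slab.1 hq
  obtain ⟨c, hc⟩ : ∃ c, c = q.1 - R ^ 2 / S.ν := ⟨_, rfl⟩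
  have hc0 : 0 < c := by
    rw [hc, sub_pos, div_lt_iff₀ hν]
    linarith
  have hct : c < q.1 := by
    have : 0 < R ^ 2 / S.ν := by positivity
    linarith
  have hνc : S.ν * (q.1 - c) = R ^ 2 := by rw [hc]; field_simp; ring
  obtain ⟨γ, hγt, hγc, hγ⟩ := exists_trajectory S hq (c := c / 2) (by positivity) (by linarith)
  have hmem : ∀ s ∈ Icc c q.1, (s, γ s) ∈ slab d S.T := fun s hs =>
    mem_slab.2 ⟨hc0.trans_le hs.1, hs.2.trans_lt hqT.2⟩
  have hρ0 : ∀ s ∈ Ico c q.1, 0 < √(S.ν * (q.1 - s)) := fun s hs =>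
    Real.sqrt_pos.2 (mul_pos hν (by linarith [hs.2]))
  have hρR : ∀ s ∈ Icc c q.1, √(S.ν * (q.1 - s)) ≤ R := fun s hs => by
    refine Real.sqrt_le_iff.2 ⟨hR.le, ?_⟩
    rw [← hνc]
    have := hs.1
    gcongr
  have key := abs_le_of_smoothing
    (f := fun s => moll (gauss d) (√(S.ν * (q.1 - s))) (pd w a) (s, γ s))
    (f' := fun s => smoothingRate S a N i w V (√(S.ν * (q.1 - s))) (s, γ s))
    (F₀ := F₀) (K := K) hα hν hR (t := q.1) ?_ ?_ ?_ ?_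
  · simpa [moll_gauss_zero, hγt] using key
  · rw [← hc]
    intro s hs
    obtain ⟨L, hL, -⟩ := moll_hasFDerivAt (gauss d) (ha.pd w) (hmem s hs) (√(S.ν * (q.1 - s)))
    have h1 : ContinuousWithinAt (fun s => ((s, γ s), √(S.ν * (q.1 - s)))) (Icc c q.1) s := by
      refine (continuousWithinAt_id.prodMk ((hγc s ⟨by linarith [hs.1], hs.2⟩).mono
        (Icc_subset_Icc (by linarith) le_rfl))).prodMk ?_
      have : Continuous fun s : ℝ => √(S.ν * (q.1 - s)) := by fun_prop
      exact this.continuousWithinAt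
    exact hL.continuousAt.comp_continuousWithinAt (f := fun s => ((s, γ s), √(S.ν * (q.1 - s))))
      (g := fun r : Pt d × ℝ => moll (gauss d) r.2 (pd w a) r.1) h1
  · rw [← hc]
    intro s hs
    have hp : 0 < S.ν * (q.1 - s) := mul_pos hν (by linarith [hs.2])
    have h1 : HasDerivAt (fun s => S.ν * (q.1 - s)) (-S.ν) s := by
      simpa using ((hasDerivAt_id s).const_sub q.1).const_mul S.ν
    exact hasDerivAt_smoothing ha hN hmd w (r := fun s => √(S.ν * (q.1 - s)))
      (hmem s ⟨hs.1, hs.2.le⟩) (hρ0 s hs) (hγ s ⟨by linarith [hs.1], hs.2⟩) (h1.sqrt hp.ne')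
  · have hcc : c ∈ Icc c q.1 := ⟨le_rfl, hct.le⟩
    have := h0 _ (hmem c hcc) hc.ge
    rw [← hc, hνc, Real.sqrt_sq hR.le]
    exact this
  · rw [← hc]
    intro s hs
    have hs' : s ∈ Icc c q.1 := ⟨hs.1, hs.2.le⟩
    exact hb _ (hmem s hs') (hc ▸ hs.1) _ (hρ0 s hs) (hρR s hs')

lemma abs_smoothingRate_le (hα : 0 < α) (hα1 : α < 1) {S : Flow d α} {a N : Pt d → ℝ}
    {i w : Fin d} {V : List (Fin d)} {q : Pt d} (hq : q ∈ slab d S.T) {ρ R A B C₁ C₂ C₃ : ℝ}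
    (hρ : 0 < ρ) (hρR : ρ ≤ R) (hB : 0 ≤ B) (hC₁ : 0 ≤ C₁) (hC₃ : 0 ≤ C₃) (hA : A = S.M * B)
    (h1 : ∀ z, |dl a q (ρ • z)| ≤ C₃ * B * (1 + ‖z‖) ^ 1)
    (h2 : |moll (gauss d) ρ (pdl V (pdl [w, i] S.p)) q| ≤ C₂ * A * ρ ^ (α - 2))
    (h3 : ∀ z, |N (q + (0, ρ • z))| ≤ C₁ * A * (R ^ α / R)) :
    |smoothingRate S a N i w V ρ q| ≤ (C₃ * ∑ l, kw (kd l (kd w (gauss d))) 2 + C₂ +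
      C₁ * kw (kd w (gauss d)) 0) * A * ρ ^ (α - 2) := by
  have hM := S.M_pos
  have hR := hρ.trans_le hρR
  have hρα : 0 < ρ ^ α := Real.rpow_pos_of_pos hρ α
  have hRα : 0 < R ^ α := Real.rpow_pos_of_pos hR α
  have hρ2 : ρ ^ (α - 2) = ρ ^ α / ρ ^ 2 := by
    rw [Real.rpow_sub hρ]; norm_num
  have hA0 : 0 ≤ A := by rw [hA]; positivity
  have hk0 := kw_nonneg (kd w (gauss d)) 0
  have t1 : |(ρ ^ 2)⁻¹ * ∑ l, ∫ z, kd l (kd w (gauss d)) z *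
      (dl a q (ρ • z) * dl (uc l S) q (ρ • z))|
      ≤ C₃ * (∑ l, kw (kd l (kd w (gauss d))) 2) * A * ρ ^ (α - 2) := by
    rw [abs_mul, abs_of_pos (by positivity : 0 < (ρ ^ 2)⁻¹)]
    have hl : ∀ l, |∫ z, kd l (kd w (gauss d)) z *
        (dl a q (ρ • z) * dl (uc l S) q (ρ • z))|
        ≤ C₃ * B * (S.M * ρ ^ α) * kw (kd l (kd w (gauss d))) 2 :=
      fun l => by
        refine abs_moll_le _ 2 fun z => ?_
        have h2 : |dl (uc l S) q (ρ • z)| ≤ S.M * (ρ ^ α * (1 + ‖z‖)) := by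
          refine (PiLp.norm_apply_le (S.u (q + (0, ρ • z)) - S.u q) l).trans
            ((S.holder _ hq _).trans ?_)
          rw [norm_smul_rpow hρ]
          gcongr
          exact rpow_le_one_add (norm_nonneg z) hα.le hα1.le
        rw [abs_mul]
        calc _ ≤ C₃ * B * (1 + ‖z‖) ^ 1 * (S.M * (ρ ^ α * (1 + ‖z‖))) := by
              gcongr
              exact h1 z
          _ = _ := by ring
    calc _ ≤ (ρ ^ 2)⁻¹ * ∑ l, C₃ * B * (S.M * ρ ^ α) * kw (kd l (kd w (gauss d))) 2 := by
          gcongr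
          exact (Finset.abs_sum_le_sum_abs _ _).trans (Finset.sum_le_sum fun l _ => hl l)
      _ = _ := by
          rw [← Finset.mul_sum, hρ2, hA]
          ring
  have t3 : |ρ⁻¹ * moll (kd w (gauss d)) ρ N q|
      ≤ C₁ * kw (kd w (gauss d)) 0 * A * ρ ^ (α - 2) := by
    rw [abs_mul, abs_of_pos (inv_pos.2 hρ)]
    have h1 : |moll (kd w (gauss d)) ρ N q| ≤ C₁ * A * (R ^ α / R) * kw (kd w (gauss d)) 0 :=
      abs_moll_le _ 0 fun z => by simpa using h3 z
    have h2 := rpow_mul_le_rpow_mul hρ.le hρR hα1.le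
    calc _ ≤ ρ⁻¹ * (C₁ * A * (R ^ α / R) * kw (kd w (gauss d)) 0) := by gcongr
      _ = C₁ * kw (kd w (gauss d)) 0 * A * ((R ^ α * ρ) / (R * ρ ^ 2)) := by field_simp
      _ ≤ C₁ * kw (kd w (gauss d)) 0 * A * ((ρ ^ α * R) / (R * ρ ^ 2)) := by gcongr
      _ = _ := by rw [hρ2]; field_simp
  rw [smoothingRate]
  refine (abs_sub _ _).trans ((add_le_add_left (abs_sub _ _) _).trans ?_)
  rw [abs_neg]
  refine (add_le_add (add_le_add t1 h2) t3).trans (le_of_eq ?_)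
  ring

lemma Smooth.succ (hα : 0 < α) (hα1 : α < 1) {j : ℕ} (hsm : ∀ i, 1 ≤ i → i ≤ j → Smooth d α i) :
    Smooth d α (j + 1) := by
  intro F hF
  cases hF with
  | @pd _ _ a w ha =>
  obtain ⟨i, V, N, hV, hN, hmd⟩ := ha.md_eq
  obtain ⟨P, hP, hPp⟩ := exists_sing_pdl_pressure (α := α) 1 [w, i] rfl V
  rw [hV] at hP
  obtain ⟨C₁, hC₁, b1⟩ := (isBigO_principal_iff fun x hx => by
    have := x.S.M_pos; have := hx.1; positivity).1 (hN.isBigO_heat hsm)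
  obtain ⟨C₂, hC₂, b2⟩ := (isBigO_principal_iff fun x hx => by
    have := x.S.M_pos; have := hx.1.1; have := hx.2.1; positivity).1 (hP.isBigO_heat hα hα1 hsm)
  obtain ⟨C₃, hC₃, b3⟩ := (isBigO_principal_iff fun x hx => by
    have := x.S.M_pos; have := hx.1; positivity).1
    (isBigO_dl_weak le_rfl (fun h => hsm j h le_rfl) ha)
  obtain ⟨k₀, hk₀, e₀⟩ : ∃ k, 0 ≤ k ∧ kw (kd w (gauss d)) 0 = k := ⟨_, kw_nonneg _ _, rfl⟩
  obtain ⟨k₁, hk₁, e₁⟩ : ∃ k, 0 ≤ k ∧ kw (kd w (gauss d)) 1 = k := ⟨_, kw_nonneg _ _, rfl⟩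
  obtain ⟨k₂, hk₂, e₂⟩ : ∃ k, 0 ≤ k ∧ ∑ l, kw (kd l (kd w (gauss d))) 2 = k :=
    ⟨_, Finset.sum_nonneg fun l _ => kw_nonneg _ _, rfl⟩
  refine (isBigO_principal_iff fun x hx => by
    have := x.S.M_pos; have := hx.1; positivity).2
    ⟨2 * C₃ * k₁ + (2 * C₃ * k₂ + C₂ +
      C₁ * k₀) * (2 / α), by positivity, ?_⟩
  rintro ⟨S, R, κ, ℓ₀, q, z₀, y₀⟩ ⟨hR, hMR, hq, ht⟩
  dsimp only at hR hMR hq ht ⊢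
  have hM := S.M_pos
  have hν := S.ν_pos
  have hRα : 0 < R ^ α := Real.rpow_pos_of_pos hR α
  have hheat : ∀ q' ∈ slab d S.T, q.1 - R ^ 2 / S.ν ≤ q'.1 → ∀ ℓ z,
      (⟨S, R, κ, ℓ, q', z, y₀⟩ : Cfg d α) ∈ Heat d α j := fun q' hq' hqq ℓ z => by
    refine ⟨hR, hMR, hq', ?_⟩
    have := mul_le_mul_of_nonneg_left hqq hν.le
    rw [mul_sub, mul_div_cancel₀ _ hν.ne'] at this
    push_cast at ht
    dsimp only
    linarith
  have hdl : ∀ q' ∈ slab d S.T, q.1 - R ^ 2 / S.ν ≤ q'.1 → ∀ ρ, 0 < ρ → ρ ≤ R → ∀ z,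
      |dl (a S) q' (ρ • z)| ≤ 2 * C₃ * (S.M * (R ^ α / R ^ j)) * (1 + ‖z‖) ^ 1 :=
    fun q' hq' hqq ρ hρ hρR z => by
      refine (b3 _ (hheat q' hq' hqq 0 (ρ • z))).trans ?_
      dsimp only
      have h1 := Real.rpow_le_rpow hρ.le hρR hα.le
      have h2 := rpow_le_one_add (norm_nonneg z) hα.le hα1.le
      have h3 := norm_nonneg z
      rw [norm_smul_rpow hρ]
      calc C₃ * (S.M * ((ρ ^ α * ‖z‖ ^ α + R ^ α) / R ^ j))
          ≤ C₃ * (S.M * ((R ^ α * (1 + ‖z‖) + R ^ α * (1 + ‖z‖)) / R ^ j)) := by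
            gcongr
            nlinarith
        _ = _ := by ring
  have key := abs_pd_le_of_smoothingRate hα (ha.isField S) (hN.isField S) (hmd S) w hq hR
    (by push_cast at ht; nlinarith [pow_pos hR 2, (Nat.cast_nonneg j : (0 : ℝ) ≤ j)])
    (F₀ := R⁻¹ * (2 * C₃ * (S.M * (R ^ α / R ^ j)) * k₁))
    (K := (2 * C₃ * k₂ + C₂ +
      C₁ * k₀) * (S.M ^ 2 / R ^ j * R ^ α))
    (fun q' hq' hqq => e₁ ▸ abs_moll_pd_le (ha.isField S) hq' w hR 1 (hdl q' hq' hqq R hR le_rfl))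
    (fun q' hq' hqq ρ hρ hρR => ?_)
  · refine key.trans ?_
    have hMR' : S.M * (R * R ^ α) ≤ S.ν := by
      rwa [Real.rpow_add hR, Real.rpow_one] at hMR
    have h5 : S.M ^ 2 / R ^ j * R ^ α * (2 / (α * S.ν)) * R ^ α
        ≤ 2 / α * (S.M * (R ^ α / R ^ (j + 1))) := by
      calc _ = 2 / α * (S.M * (R ^ α / R ^ (j + 1))) * (S.M * (R * R ^ α) / S.ν) := by
            rw [pow_succ R j]; field_simp
        _ ≤ 2 / α * (S.M * (R ^ α / R ^ (j + 1))) * 1 := by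
            gcongr
            exact (div_le_one hν).2 hMR'
        _ = _ := mul_one _
    calc _ = 2 * C₃ * k₁ * (S.M * (R ^ α / R ^ (j + 1))) +
          (2 * C₃ * k₂ + C₂ + C₁ * k₀) *
          (S.M ^ 2 / R ^ j * R ^ α * (2 / (α * S.ν)) * R ^ α) := by
          rw [pow_succ R j]; field_simp
      _ ≤ 2 * C₃ * k₁ * (S.M * (R ^ α / R ^ (j + 1))) +
          (2 * C₃ * k₂ + C₂ + C₁ * k₀) *
          (2 / α * (S.M * (R ^ α / R ^ (j + 1)))) := by gcongr
      _ = _ := by ring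
  · rw [← e₀, ← e₂]
    refine abs_smoothingRate_le hα hα1 hq' hρ hρR (by positivity) hC₁ (by positivity)
      (B := S.M * (R ^ α / R ^ j)) (by ring) (hdl q' hq' hqq ρ hρ hρR) ?_ fun z => ?_
    · rw [hPp S ρ hρ.le (Or.inl hρ) _ hq']
      refine (b2 ⟨S, R, κ, ρ, q', 0, y₀⟩ ⟨hheat q' hq' hqq ρ 0, hρ, hρR⟩).trans ?_
      exact le_of_eq (by dsimp only; ring)
    · refine (b1 _ (Heat.translate _ (hheat q' hq' hqq ρ 0) (ρ • z))).trans (le_of_eq ?_)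
      dsimp only
      rw [pow_succ R j]
      field_simp

lemma smooth (hα : 0 < α) (hα1 : α < 1) (j : ℕ) (hj : 1 ≤ j) : Smooth d α j := by
  induction j using Nat.strong_induction_on with
  | _ j ih =>
    obtain ⟨j, rfl⟩ := Nat.exists_eq_add_of_le' hj
    exact Smooth.succ hα hα1 fun i h1 h2 => ih i (by omega) h1

end Smoothing

section Estimates

variable {d : ℕ} {α : ℝ}

/-- The Hölder exponent of the `k`-th material derivative of the velocity. -/
noncomputable def hexp (α : ℝ) (k : ℕ) : ℝ := α - k * (1 - α)

lemma hexp_zero : hexp α 0 = α := by simp [hexp]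

lemma hexp_anti (hα1 : α < 1) : Antitone (hexp α) := fun k k' h => by
  have : (k : ℝ) ≤ k' := by exact_mod_cast h
  unfold hexp
  nlinarith

lemma hexp_le_one (hα1 : α < 1) (k : ℕ) : hexp α k ≤ 1 :=
  (hexp_anti hα1 (Nat.zero_le k)).trans (hexp_zero.trans_le hα1.le)

/-- Admissible parameters: `R` is a length scale at which the solution is smooth and `κ` a rate. -/
def Adm (d : ℕ) (α : ℝ) : Set (Cfg d α) :=
  {x | 0 < x.R ∧ x.S.M ≤ x.κ ∧ x.S.ν ≤ x.κ * x.R ^ (1 + α) ∧ x.S.M * x.R ^ (1 + α) ≤ x.S.ν ∧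
    x.q ∈ slab d x.S.T ∧ x.R ^ 2 ≤ x.S.ν * x.q.1}

lemma Adm.translate : ∀ x ∈ Adm d α, ∀ z : Sp d, {x with q := x.q + (0, z)} ∈ Adm d α :=
  fun _ hx z => ⟨hx.1, hx.2.1, hx.2.2.1, hx.2.2.2.1, add_mem_slab hx.2.2.2.2.1 z,
    by simpa using hx.2.2.2.2.2⟩

lemma Adm.slab : ∀ x ∈ Adm d α, x.q ∈ slab d x.S.T := fun _ hx => hx.2.2.2.2.1

lemma Adm.κ_pos {x : Cfg d α} (hx : x ∈ Adm d α) : 0 < x.κ := x.S.M_pos.trans_le hx.2.1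

/-- The amplitude of `n`-linear expressions with `k` material and `j` spatial derivatives. -/
noncomputable def amp (n k j : ℕ) (x : Cfg d α) : ℝ := x.S.M ^ n * x.κ ^ k / x.R ^ j

lemma amp_pos {n k j : ℕ} {x : Cfg d α} (hx : x ∈ Adm d α) : 0 < amp n k j x := by
  have := x.S.M_pos
  have := hx.1
  have := Adm.κ_pos hx
  unfold amp
  positivity

lemma amp_mul {n k j n' k' j' : ℕ} (x : Cfg d α) :
    amp n k j x * amp n' k' j' x = amp (n + n') (k + k') (j + j') x := by
  simp only [amp, pow_add]
  rw [div_mul_div_comm]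
  ring

lemma amp_le {n k K j : ℕ} (h : k + n = K + 1) (hn : 1 ≤ n) {x : Cfg d α} (hx : x ∈ Adm d α) :
    amp n k j x ≤ amp 1 K j x := by
  have hM := x.S.M_pos
  have hR := hx.1
  have hκ := Adm.κ_pos hx
  obtain ⟨n, rfl⟩ := Nat.exists_eq_add_of_le' hn
  obtain rfl : K = n + k := by omega
  unfold amp
  rw [pow_succ', pow_one, pow_add x.κ, ← mul_assoc]
  gcongr
  exact hx.2.1

/-- The estimates for words with `k` material derivatives. -/
def Est (d : ℕ) (α : ℝ) (k : ℕ) : Prop :=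
  ∀ j F, Word (d := d) (α := α) k j F →
    ((fun x : Cfg d α => dl (F x.S) x.q x.z) =O[𝓟 (Adm d α)]
      fun x => amp 1 k j x * ‖x.z‖ ^ hexp α k) ∧
    (1 ≤ j → (fun x : Cfg d α => F x.S x.q) =O[𝓟 (Adm d α)]
      fun x => amp 1 k j x * x.R ^ hexp α k)

lemma isBigO_dl_of_sup {F : Flow d α → Pt d → ℝ} (hF : ∀ S, IsField S.T (F S)) {k j : ℕ} {b : ℝ}
    (hb0 : 0 ≤ b) (hb : b ≤ 1)
    (h0 : (fun x : Cfg d α => F x.S x.q) =O[𝓟 (Adm d α)] fun x => amp 1 k j x * x.R ^ b)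
    (h1 : ∀ l, (fun x : Cfg d α => pd l (F x.S) x.q) =O[𝓟 (Adm d α)]
      fun x => amp 1 k (j + 1) x * x.R ^ b) :
    (fun x : Cfg d α => dl (F x.S) x.q x.z) =O[𝓟 (Adm d α)] fun x => amp 1 k j x * ‖x.z‖ ^ b := by
  have hw : ∀ j, ∀ x ∈ Adm d α, 0 ≤ amp 1 k j x * x.R ^ b := fun j x hx =>
    mul_nonneg (amp_pos hx).le (Real.rpow_nonneg hx.1.le _)
  have h2 := isBigO_dl_of_pd hF (hw _) Adm.slab Adm.translate (fun _ _ => rfl) h1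
  have h3 := isBigO_dl_of_isBigO (hw _) Adm.translate (fun _ _ => rfl) h0
  obtain ⟨C₁, hC₁, h2⟩ := (isBigO_principal_iff fun x hx =>
    mul_nonneg (hw _ x hx) (norm_nonneg _)).1 h2
  obtain ⟨C₂, hC₂, h3⟩ := (isBigO_principal_iff (hw _)).1 h3
  refine (isBigO_principal_iff fun x hx => mul_nonneg (amp_pos hx).le (by positivity)).2
    ⟨C₁ + C₂, by positivity, fun x hx => ?_⟩
  have hR := hx.1
  have hA := amp_pos (n := 1) (k := k) (j := j) hx
  have hz := norm_nonneg x.z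
  rw [add_mul]
  rcases le_total ‖x.z‖ x.R with h | h
  · refine (h2 x hx).trans (le_trans ?_ (le_add_of_nonneg_right (by positivity)))
    have h4 := rpow_mul_le_rpow_mul hz h hb
    have h5 : amp 1 k (j + 1) x = amp 1 k j x / x.R := by
      simp only [amp, pow_succ x.R, div_div]
    rw [h5]
    refine mul_le_mul_of_nonneg_left ?_ hC₁
    calc amp 1 k j x / x.R * x.R ^ b * ‖x.z‖ = amp 1 k j x / x.R * (x.R ^ b * ‖x.z‖) := by ring
      _ ≤ amp 1 k j x / x.R * (‖x.z‖ ^ b * x.R) := by gcongr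
      _ = _ := by field_simp
  · refine (h3 x hx).trans (le_trans ?_ (le_add_of_nonneg_left (by positivity)))
    gcongr

lemma est_zero (hα : 0 < α) (hα1 : α < 1) : Est d α 0 := by
  have sup : ∀ j F, Word (d := d) (α := α) 0 j F → 1 ≤ j →
      (fun x : Cfg d α => F x.S x.q) =O[𝓟 (Adm d α)] fun x => amp 1 0 j x * x.R ^ α := by
    intro j F hF hj
    obtain ⟨C, hC, h⟩ := (isBigO_principal_iff fun x hx => by
      have := x.S.M_pos; have := hx.1; positivity).1 (smooth hα hα1 j hj F hF)
    have hj1 : (0 : ℝ) < j + 1 := by positivity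
    refine (isBigO_principal_iff fun x hx => mul_nonneg (amp_pos hx).le
      (Real.rpow_nonneg hx.1.le _)).2 ⟨C * (j + 1) ^ j, by positivity, fun x hx => ?_⟩
    have hM := x.S.M_pos
    have hR := hx.1
    have hRR : x.R / (j + 1) ≤ x.R :=
      div_le_self hR.le (by linarith [(Nat.cast_nonneg j : (0 : ℝ) ≤ j)])
    have h1 := h {x with R := x.R / (j + 1)} ⟨by dsimp only; positivity, ?_, hx.2.2.2.2.1, ?_⟩
    · refine h1.trans ?_
      dsimp only
      have h2 := Real.rpow_le_rpow (by positivity) hRR hα.le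
      calc C * (x.S.M * ((x.R / (j + 1)) ^ α / (x.R / (j + 1)) ^ j))
          ≤ C * (x.S.M * (x.R ^ α / (x.R / (j + 1)) ^ j)) := by gcongr
        _ = _ := by
          rw [amp, div_pow]
          field_simp
    · refine le_trans ?_ hx.2.2.2.1
      dsimp only
      gcongr
    · refine le_trans ?_ hx.2.2.2.2.2
      dsimp only
      calc ((j : ℝ) + 1) * (x.R / (j + 1)) ^ 2 = x.R * (x.R / (j + 1)) := by field_simp
        _ ≤ x.R * x.R := by gcongr
        _ = _ := by ring
  intro j F hF
  rw [hexp_zero]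
  refine ⟨?_, sup j F hF⟩
  rcases Nat.eq_zero_or_pos j with rfl | hj
  · obtain ⟨l, rfl⟩ := hF.eq_uc
    simpa [amp] using isBigO_dl_uc l Adm.slab
  · exact isBigO_dl_of_sup hF.isField hα.le hα1.le (sup j F hF hj)
      fun l => sup _ _ (hF.pd l) (by omega)

/-- Nonlinear terms and viscous terms are bounded at all orders. -/
lemma NP.isBigO_sup {K j : ℕ} (hest : ∀ k ≤ K, Est d α k)
    {N : Flow d α → Pt d → ℝ} (hN : NP True K j N) :
    (fun x : Cfg d α => N x.S x.q) =O[𝓟 (Adm d α)]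
      fun x => amp 1 (K + 1) j x * x.R ^ hexp α (K + 1) := by
  have hw : ∀ K j, ∀ x ∈ Adm d α, 0 ≤ amp 1 (K + 1) j x * x.R ^ hexp α (K + 1) := fun K j x hx =>
    mul_nonneg (amp_pos hx).le (Real.rpow_nonneg hx.1.le _)
  induction hN with
  | zero => exact isBigO_zero _ _
  | add _ _ ih ih' => exact (ih hest).add (ih' hest)
  | neg _ ih => exact (ih hest).neg_left
  | @visc k j F _ hF =>
    obtain ⟨C, hC, h⟩ := (isBigO_principal_iff fun x hx => mul_nonneg (amp_pos hx).le
      (Real.rpow_nonneg hx.1.le _)).1 ((hest k le_rfl _ F hF).2 (by omega))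
    refine (isBigO_principal_iff (hw k j)).2 ⟨C, hC, fun x hx => ?_⟩
    have hR := hx.1
    have hν := x.S.ν_pos
    have hκ := Adm.κ_pos hx
    have hA := amp_pos (n := 1) (k := k) (j := j + 2) hx
    rw [abs_mul, abs_of_pos hν]
    calc x.S.ν * |F x.S x.q| ≤ (x.κ * x.R ^ (1 + α)) * (C * (amp 1 k (j + 2) x * x.R ^ hexp α k)) :=
          mul_le_mul hx.2.2.1 (h x hx) (abs_nonneg _) (by positivity)
      _ = C * (x.κ * amp 1 k (j + 2) x * (x.R ^ (1 + α) * x.R ^ hexp α k)) := by ring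
      _ = C * (x.κ * amp 1 k (j + 2) x * (x.R ^ 2 * x.R ^ hexp α (k + 1))) := by
          rw [← Real.rpow_add hR, ← Real.rpow_natCast x.R 2, ← Real.rpow_add hR]
          simp only [hexp]
          push_cast
          ring_nf
      _ = _ := by
          simp only [amp, pow_add]
          field_simp
  | @prod k k' K j j' J F G hF hG hj hj' hK hJ =>
    have h := ((hest k (by omega) j F hF).2 hj).mul ((hest k' (by omega) j' G hG).2 hj')
    refine h.trans ((isBigO_principal_iff (hw K J)).2 ⟨1, zero_le_one, fun x hx => ?_⟩)
    have hR := hx.1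
    have hRp := Real.rpow_pos_of_pos hR (hexp α (K + 1))
    have e1 : amp 1 k j x * x.R ^ hexp α k * (amp 1 k' j' x * x.R ^ hexp α k')
        = amp 2 K J x * x.R ^ hexp α (K + 1) := by
      have : x.R ^ hexp α k * x.R ^ hexp α k' = x.R * x.R ^ hexp α (K + 1) := by
        nth_rw 3 [← Real.rpow_one x.R]
        rw [← Real.rpow_add hR, ← Real.rpow_add hR, ← hK]
        congr 1
        simp only [hexp]
        push_cast
        ring
      rw [mul_mul_mul_comm, amp_mul, this, hK, hJ]
      simp only [amp, pow_succ x.R J]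
      field_simp
      ring
    have hA := amp_pos (n := 2) (k := K) (j := J) hx
    rw [e1, abs_of_nonneg (by positivity), one_mul]
    gcongr
    exact amp_le (by omega) (by omega) hx

end Estimates

section Gains

variable {d : ℕ} {α : ℝ}

/-- The homogeneity of products of `n` increments with `k` material derivatives. -/
noncomputable def homog (α : ℝ) (n k : ℕ) : ℝ := n * α - k * (1 - α)

lemma homog_one (k : ℕ) : homog α 1 k = hexp α k := by simp [homog, hexp]

lemma homog_add (n k n' k' : ℕ) : homog α (n + n') (k + k') = homog α n k + homog α n' k' := by
  simp only [homog]
  push_cast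
  ring

lemma hexp_le_homog (hα : 0 < α) (hα1 : α < 1) {n k K : ℕ} (hn : 1 ≤ n) (hk : k ≤ K) :
    hexp α K ≤ homog α n k := by
  refine (hexp_anti hα1 hk).trans ?_
  have : (1 : ℝ) ≤ n := by exact_mod_cast hn
  unfold hexp homog
  nlinarith

/-- The bound of `n`-linear kernels with `b` of their homogeneity saturating at distance `θ`. -/
noncomputable def gain (n k j : ℕ) (b : ℝ) (θ : Cfg d α → ℝ) (x : Cfg d α) : ℝ :=
  amp n k j x * (‖x.z‖ ^ (homog α n k - b) * min ‖x.z‖ (θ x) ^ b)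

lemma isBigO_gain {f θ : Cfg d α → ℝ} {k j : ℕ} {b : ℝ} (hb0 : 0 ≤ b) (hb : b ≤ hexp α k)
    (hθ : ∀ x ∈ Adm d α, 0 ≤ θ x)
    (h1 : f =O[𝓟 (Adm d α)] fun x => amp 1 k j x * ‖x.z‖ ^ hexp α k)
    (h2 : f =O[𝓟 (Adm d α)] fun x => amp 1 k j x * θ x ^ hexp α k) :
    f =O[𝓟 (Adm d α)] gain 1 k j b θ := by
  obtain ⟨C₁, hC₁, h1⟩ := (isBigO_principal_iff fun x hx =>
    mul_nonneg (amp_pos hx).le (Real.rpow_nonneg (norm_nonneg _) _)).1 h1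
  obtain ⟨C₂, hC₂, h2⟩ := (isBigO_principal_iff fun x hx =>
    mul_nonneg (amp_pos hx).le (Real.rpow_nonneg (hθ x hx) _)).1 h2
  have hmin : ∀ x ∈ Adm d α, 0 ≤ min ‖x.z‖ (θ x) := fun x hx => le_min (norm_nonneg _) (hθ x hx)
  refine (isBigO_principal_iff fun x hx => mul_nonneg (amp_pos hx).le
    (mul_nonneg (Real.rpow_nonneg (norm_nonneg _) _) (Real.rpow_nonneg (hmin x hx) _))).2
    ⟨C₁ + C₂, by positivity, fun x hx => ?_⟩
  have hA := amp_pos (n := 1) (k := k) (j := j) hx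
  have h3 : |f x| ≤ (C₁ + C₂) * (amp 1 k j x * min ‖x.z‖ (θ x) ^ hexp α k) := by
    have h0 := mul_nonneg hA.le (Real.rpow_nonneg (hmin x hx) (hexp α k))
    rw [add_mul]
    rcases le_total ‖x.z‖ (θ x) with h | h
    · rw [min_eq_left h] at h0 ⊢
      exact (h1 x hx).trans (le_add_of_nonneg_right (by positivity))
    · rw [min_eq_right h] at h0 ⊢
      exact (h2 x hx).trans (le_add_of_nonneg_left (by positivity))
  refine h3.trans ?_
  have h4 : min ‖x.z‖ (θ x) ^ hexp α k
      = min ‖x.z‖ (θ x) ^ (hexp α k - b) * min ‖x.z‖ (θ x) ^ b := by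
    rw [← Real.rpow_add_of_nonneg (hmin x hx) (by linarith) hb0]
    ring_nf
  rw [h4]
  rw [homog_one]
  have h5 := Real.rpow_le_rpow (hmin x hx) (min_le_left ‖x.z‖ (θ x)) (sub_nonneg.2 hb)
  have h6 := Real.rpow_nonneg (hmin x hx) b
  gcongr

lemma isBigO_gain_mul {f f' θ : Cfg d α → ℝ} {n k j n' k' j' : ℕ} {b : ℝ}
    (hb : b ≤ homog α n k) (h0 : 0 ≤ homog α n' k')
    (h : f =O[𝓟 (Adm d α)] gain n k j b θ)
    (h' : f' =O[𝓟 (Adm d α)] fun x => amp n' k' j' x * ‖x.z‖ ^ homog α n' k') :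
    (fun x => f x * f' x) =O[𝓟 (Adm d α)] gain (n + n') (k + k') (j + j') b θ := by
  refine (h.mul h').congr_right fun x => ?_
  rw [gain, gain, ← amp_mul, homog_add, show homog α n k + homog α n' k' - b
    = (homog α n k - b) + homog α n' k' by ring,
    Real.rpow_add_of_nonneg (norm_nonneg _) (by linarith) h0]
  ring

lemma gain_comm (n k j n' k' j' : ℕ) (b : ℝ) (θ : Cfg d α → ℝ) :
    gain (n + n') (k + k') (j + j') b θ = gain (n' + n) (k' + k) (j' + j) b θ := by
  rw [add_comm n, add_comm k, add_comm j]

variable {n k j K : ℕ} {g : Flow d α → Pt d → Sp d → ℝ}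

lemma Inc.isBigO (hα : 0 < α) (hα1 : α < 1) (hest : ∀ k ≤ K, Est d α k) (h0 : 0 ≤ hexp α K)
    (hg : Inc n k j g) (hk : k ≤ K) :
    (fun x : Cfg d α => g x.S x.q x.z) =O[𝓟 (Adm d α)]
      fun x => amp n k j x * ‖x.z‖ ^ homog α n k := by
  induction hg with
  | one hF => simpa only [homog_one] using (hest _ hk _ _ hF).1
  | add _ _ ih ih' => exact (ih hk).add (ih' hk)
  | @mul n k j n' k' j' g g' hg hg' ih ih' =>
    refine ((ih (by omega)).mul (ih' (by omega))).congr_right fun x => ?_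
    rw [← amp_mul, homog_add, Real.rpow_add_of_nonneg (norm_nonneg _)
      (h0.trans (hexp_le_homog hα hα1 hg.pos (by omega)))
      (h0.trans (hexp_le_homog hα hα1 hg'.pos (by omega)))]
    ring

lemma Inc.isBigO_scale (hα : 0 < α) (hα1 : α < 1) (hest : ∀ k ≤ K, Est d α k)
    (h0 : 0 ≤ hexp α K) (hg : Inc n k j g) (hk : k ≤ K) (hj : 1 ≤ j) :
    (fun x : Cfg d α => g x.S x.q x.z) =O[𝓟 (Adm d α)] gain n k j (hexp α K) fun x => x.R := by
  induction hg with
  | one hF =>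
    obtain ⟨h1, h2⟩ := hest _ hk _ _ hF
    exact isBigO_gain h0 (hexp_anti hα1 hk) (fun x hx => hx.1.le) h1
      (isBigO_dl_of_isBigO (fun x hx => mul_nonneg (amp_pos hx).le (Real.rpow_nonneg hx.1.le _))
        Adm.translate (fun _ _ => rfl) (h2 hj))
  | add _ _ ih ih' => exact (ih hk hj).add (ih' hk hj)
  | @mul n k j n' k' j' g g' hg hg' ih ih' =>
    have e := hexp_le_homog hα hα1 (k := k) (K := K) hg.pos (by omega)
    have e' := hexp_le_homog hα hα1 (k := k') (K := K) hg'.pos (by omega)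
    rcases Nat.eq_zero_or_pos j with rfl | hj
    · rw [gain_comm]
      simp_rw [mul_comm (g _ _ _)]
      exact isBigO_gain_mul e' (h0.trans e) (ih' (by omega) (by omega))
        (hg.isBigO hα hα1 hest h0 (by omega))
    · exact isBigO_gain_mul e (h0.trans e') (ih (by omega) hj)
        (hg'.isBigO hα hα1 hest h0 (by omega))

lemma Inc.isBigO_periodic (hα : 0 < α) (hα1 : α < 1) (hest : ∀ k ≤ K, Est d α k)
    (h0 : 0 ≤ hexp α K) (hg : Inc n k j g) (hk : k ≤ K) :
    (fun x : Cfg d α => g x.S x.q x.z) =O[𝓟 (Adm d α)] gain n k j (hexp α K) fun _ => 1 := by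
  induction hg with
  | @one k j F hF =>
    obtain ⟨h1, -⟩ := hest _ hk _ _ hF
    refine isBigO_gain h0 (hexp_anti hα1 hk) (fun x hx => zero_le_one) h1 ?_
    obtain ⟨C, hC, h1⟩ := (isBigO_principal_iff fun x hx =>
      mul_nonneg (amp_pos hx).le (Real.rpow_nonneg (norm_nonneg _) _)).1 h1
    refine (isBigO_principal_iff fun x hx =>
      mul_nonneg (amp_pos hx).le (Real.rpow_nonneg zero_le_one _)).2
      ⟨C * (d : ℝ) ^ hexp α k, by positivity, fun x hx => ?_⟩
    obtain ⟨l, hl⟩ := exists_lat x.z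
    have h2 := h1 {x with z := x.z + lat l} hx
    have h3 : dl (F x.S) x.q (x.z + lat l) = dl (F x.S) x.q x.z := by
      have : x.q + ((0 : ℝ), x.z + lat l) = (x.q + (0, x.z)) + (0, lat l) := by
        rw [add_assoc]
        simp
      rw [dl, dl, this, (hF.isField x.S).periodic]
    have hA := amp_pos (n := 1) (k := k) (j := j) hx
    have h4 := Real.rpow_le_rpow (norm_nonneg _) hl (h0.trans (hexp_anti hα1 hk))
    dsimp only at h2
    rw [h3] at h2
    refine h2.trans ?_
    rw [Real.one_rpow, mul_one]
    calc C * (amp 1 k j x * ‖x.z + lat l‖ ^ hexp α k) ≤ C * (amp 1 k j x * d ^ hexp α k) := by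
          gcongr
      _ = _ := by ring
  | add _ _ ih ih' => exact (ih hk).add (ih' hk)
  | @mul n k j n' k' j' g g' hg hg' ih ih' =>
    exact isBigO_gain_mul (hexp_le_homog hα hα1 hg.pos (by omega))
      (h0.trans (hexp_le_homog hα hα1 hg'.pos (by omega))) (ih (by omega))
      (hg'.isBigO hα hα1 hest h0 (by omega))

lemma Inc.isBigO_sub (hα : 0 < α) (hα1 : α < 1) (hest : ∀ k ≤ K, Est d α k)
    (h0 : 0 ≤ hexp α K) (hg : Inc n k j g) (hk : k ≤ K) :
    (fun x : Cfg d α => g x.S (x.q + (0, x.y)) x.z - g x.S x.q x.z) =O[𝓟 (Adm d α)]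
      gain n k j (hexp α K) fun x => ‖x.y‖ := by
  have ht : Tendsto (fun x : Cfg d α => {x with q := x.q + (0, x.y)}) (𝓟 (Adm d α))
      (𝓟 (Adm d α)) := tendsto_principal_principal.2 fun x hx => Adm.translate x hx x.y
  induction hg with
  | @one k j F hF =>
    obtain ⟨h1, -⟩ := hest _ hk _ _ hF
    refine isBigO_gain h0 (hexp_anti hα1 hk) (fun x hx => norm_nonneg _)
      (IsBigO.sub (h1.comp_tendsto ht) h1) ?_
    have hz : Tendsto (fun x : Cfg d α => {x with q := x.q + (0, x.z), z := x.y}) (𝓟 (Adm d α))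
        (𝓟 (Adm d α)) := tendsto_principal_principal.2 fun x hx => Adm.translate x hx x.z
    have hy : Tendsto (fun x : Cfg d α => {x with z := x.y}) (𝓟 (Adm d α))
        (𝓟 (Adm d α)) := tendsto_principal_principal.2 fun x hx => hx
    have h2 : (fun x : Cfg d α => dl (F x.S) (x.q + (0, x.z)) x.y) =O[𝓟 (Adm d α)]
        fun x => amp 1 k j x * ‖x.y‖ ^ hexp α k := h1.comp_tendsto hz
    have h3 : (fun x : Cfg d α => dl (F x.S) x.q x.y) =O[𝓟 (Adm d α)]
        fun x => amp 1 k j x * ‖x.y‖ ^ hexp α k := h1.comp_tendsto hy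
    refine (h2.sub h3).congr_left fun x => ?_
    simp only [dl, add_right_comm x.q (0, x.z) (0, x.y)]
    ring
  | add _ _ ih ih' =>
    refine ((ih hk).add (ih' hk)).congr_left fun x => ?_
    ring
  | @mul n k j n' k' j' g g' hg hg' ih ih' =>
    have e := hexp_le_homog hα hα1 (k := k) (K := K) hg.pos (by omega)
    have e' := hexp_le_homog hα hα1 (k := k') (K := K) hg'.pos (by omega)
    have h3 : (fun x : Cfg d α => g x.S (x.q + (0, x.y)) x.z) =O[𝓟 (Adm d α)]
        fun x => amp n k j x * ‖x.z‖ ^ homog α n k :=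
      (hg.isBigO hα hα1 hest h0 (by omega)).comp_tendsto ht
    have h1 := isBigO_gain_mul e' (h0.trans e) (ih' (by omega)) h3
    have h2 := isBigO_gain_mul e (h0.trans e') (ih (by omega))
      (hg'.isBigO hα hα1 hest h0 (by omega))
    rw [gain_comm] at h1
    refine (h1.add h2).congr_left fun x => ?_
    simp only
    ring

end Gains

section Scales

lemma integrableOn_Ioc_rpow {r θ : ℝ} (hθ : 0 ≤ θ) (hr : -1 < r) :
    IntegrableOn (fun s : ℝ => s ^ r) (Ioc 0 θ) ∧
      ∫ s in Ioc 0 θ, s ^ r = θ ^ (r + 1) / (r + 1) := by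
  constructor
  · exact (intervalIntegrable_iff_integrableOn_Ioc_of_le hθ).1
      (intervalIntegral.intervalIntegrable_rpow' hr)
  · rw [← intervalIntegral.integral_of_le hθ, integral_rpow (Or.inl hr),
      Real.zero_rpow (by linarith), sub_zero]

lemma integral_Ioi_rpow_mul_min {r b θ : ℝ} (hθ : 0 < θ) (h1 : -1 < r + b) (h2 : r < -1) :
    IntegrableOn (fun s : ℝ => s ^ r * min s θ ^ b) (Ioi 0) ∧
      ∫ s in Ioi 0, s ^ r * min s θ ^ b = θ ^ (r + b + 1) * (1 / (r + b + 1) - 1 / (r + 1)) := by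
  obtain ⟨i1, e1⟩ := integrableOn_Ioc_rpow hθ.le h1
  have c1 : EqOn (fun s : ℝ => s ^ (r + b)) (fun s => s ^ r * min s θ ^ b) (Ioc 0 θ) :=
    fun s hs => by simp only [min_eq_left hs.2, Real.rpow_add hs.1]
  have i2 := (integrableOn_Ioi_rpow_of_lt h2 hθ).mul_const (θ ^ b)
  have c2 : EqOn (fun s : ℝ => s ^ r * θ ^ b) (fun s => s ^ r * min s θ ^ b) (Ioi θ) :=
    fun s hs => by simp only [min_eq_right (le_of_lt (show θ < s from hs))]
  have i1' := i1.congr_fun c1 measurableSet_Ioc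
  have i2' := IntegrableOn.congr_fun i2 c2 measurableSet_Ioi
  rw [← Ioc_union_Ioi_eq_Ioi hθ.le]
  refine ⟨i1'.union i2', ?_⟩
  rw [setIntegral_union (Ioc_disjoint_Ioi le_rfl) measurableSet_Ioi i1' i2',
    ← setIntegral_congr_fun measurableSet_Ioc c1, ← setIntegral_congr_fun measurableSet_Ioi c2, e1,
    integral_mul_const, integral_Ioi_rpow_of_lt h2 hθ, show r + b + 1 = (r + 1) + b by ring,
    Real.rpow_add hθ]
  ring

lemma integral_Ioi_rpow_mul_min_one {r b ℓ : ℝ} (hℓ : 0 < ℓ) (hℓ1 : ℓ ≤ 1) (h1 : r + b = -1)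
    (h2 : r < -1) :
    IntegrableOn (fun s : ℝ => s ^ r * min s 1 ^ b) (Ioi ℓ) ∧
      ∫ s in Ioi ℓ, s ^ r * min s 1 ^ b = Real.log (1 / ℓ) - 1 / (r + 1) := by
  have i1 : IntegrableOn (fun s : ℝ => 1 / s) (Ioc ℓ 1) :=
    (intervalIntegrable_iff_integrableOn_Ioc_of_le hℓ1).1
      (intervalIntegral.intervalIntegrable_one_div (fun s hs => by
        rw [uIcc_of_le hℓ1] at hs
        exact (hℓ.trans_le hs.1).ne') continuousOn_id)
  have c1 : EqOn (fun s : ℝ => 1 / s) (fun s => s ^ r * min s 1 ^ b) (Ioc ℓ 1) := fun s hs => by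
    simp only [min_eq_left hs.2, ← Real.rpow_add (hℓ.trans hs.1), h1, Real.rpow_neg_one, one_div]
  have i2 := integrableOn_Ioi_rpow_of_lt h2 zero_lt_one
  have c2 : EqOn (fun s : ℝ => s ^ r) (fun s => s ^ r * min s 1 ^ b) (Ioi 1) :=
    fun s hs => by simp only [min_eq_right (le_of_lt (show 1 < s from hs)), Real.one_rpow, mul_one]
  have i1' := i1.congr_fun c1 measurableSet_Ioc
  have i2' := i2.congr_fun c2 measurableSet_Ioi
  rw [← Ioc_union_Ioi_eq_Ioi hℓ1]
  refine ⟨i1'.union i2', ?_⟩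
  rw [setIntegral_union (Ioc_disjoint_Ioi le_rfl) measurableSet_Ioi i1' i2',
    ← setIntegral_congr_fun measurableSet_Ioc c1, ← setIntegral_congr_fun measurableSet_Ioi c2,
    integral_Ioi_rpow_of_lt h2 zero_lt_one, ← intervalIntegral.integral_of_le hℓ1,
    integral_one_div_of_pos hℓ zero_lt_one, Real.one_rpow]
  ring

variable {d : ℕ}

lemma abs_kernel_le_rpow {n : ℕ} (Ψ : 𝓢(Sp d, ℝ)) {s θ B b c x : ℝ} {z : Sp d} (hs : 0 < s)
    (hθ : 0 ≤ θ) (hB : 0 ≤ B) (hc : 0 ≤ c) (hb : 0 ≤ b) (hcb : c + b ≤ n)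
    (hx : |x| ≤ B * (‖s • z‖ ^ c * min ‖s • z‖ θ ^ b)) :
    |(s ^ n)⁻¹ * Ψ z * x| ≤ B * (s ^ (c - n) * min s θ ^ b) * (|Ψ z| * (1 + ‖z‖) ^ n) := by
  have hz := norm_nonneg z
  rw [norm_smul, Real.norm_of_nonneg hs.le] at hx
  have h1 : (s * ‖z‖) ^ c ≤ s ^ c * (1 + ‖z‖) ^ c := by
    rw [← Real.mul_rpow hs.le (by positivity)]
    exact Real.rpow_le_rpow (by positivity) (by nlinarith) hc
  have h2 : min (s * ‖z‖) θ ^ b ≤ min s θ ^ b * (1 + ‖z‖) ^ b := by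
    rw [← Real.mul_rpow (le_min hs.le hθ) (by positivity)]
    refine Real.rpow_le_rpow (le_min (by positivity) hθ) ?_ hb
    rw [min_mul_of_nonneg _ _ (by positivity)]
    exact min_le_min (by nlinarith) (by nlinarith)
  have h3 : (1 + ‖z‖) ^ c * (1 + ‖z‖) ^ b ≤ (1 + ‖z‖) ^ n := by
    rw [← Real.rpow_add (by positivity), ← Real.rpow_natCast]
    exact Real.rpow_le_rpow_of_exponent_le (by linarith) hcb
  have hmin : 0 ≤ min s θ ^ b := Real.rpow_nonneg (le_min hs.le hθ) _
  have hmin' : 0 ≤ min (s * ‖z‖) θ ^ b := Real.rpow_nonneg (le_min (by positivity) hθ) _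
  rw [abs_mul, abs_mul, abs_of_nonneg (by positivity : 0 ≤ (s ^ n)⁻¹), Real.rpow_sub hs,
    Real.rpow_natCast]
  calc (s ^ n)⁻¹ * |Ψ z| * |x|
      ≤ (s ^ n)⁻¹ * |Ψ z| * (B * ((s ^ c * (1 + ‖z‖) ^ c) * (min s θ ^ b * (1 + ‖z‖) ^ b))) := by
        gcongr
        exact hx.trans (by gcongr)
    _ = (s ^ n)⁻¹ * |Ψ z| * (B * (s ^ c * min s θ ^ b * ((1 + ‖z‖) ^ c * (1 + ‖z‖) ^ b))) := by ring
    _ ≤ (s ^ n)⁻¹ * |Ψ z| * (B * (s ^ c * min s θ ^ b * (1 + ‖z‖) ^ n)) := by gcongr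
    _ = _ := by ring

variable {n : ℕ} {h : Sp d → ℝ} {B b c : ℝ}

lemma abs_integral_kernel_le (Ψ : 𝓢(Sp d, ℝ)) {θ : ℝ} (hθ : 0 < θ) (hB : 0 ≤ B) (hc : 0 ≤ c)
    (hb : 0 ≤ b) (hcb : c + b ≤ n) (h1 : -1 < c - n + b) (h2 : c - n < -1)
    (hh : ∀ z, |h z| ≤ B * (‖z‖ ^ c * min ‖z‖ θ ^ b)) :
    |∫ p, (p.1 ^ n)⁻¹ * Ψ p.2 * h (p.1 • p.2) ∂scale d 0| ≤
      B * (θ ^ (c - n + b + 1) * (1 / (c - n + b + 1) - 1 / (c - n + 1))) * kw Ψ n := by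
  obtain ⟨i, e⟩ := integral_Ioi_rpow_mul_min hθ h1 h2
  rw [← e, ← integral_const_mul]
  exact abs_integral_scale_le (f := fun p => (p.1 ^ n)⁻¹ * Ψ p.2 * h (p.1 • p.2))
    (i.const_mul B) Ψ n fun s hs z => abs_kernel_le_rpow Ψ hs hθ.le hB hc hb hcb (hh _)

lemma abs_integral_kernel_le_log (Ψ : 𝓢(Sp d, ℝ)) {ℓ : ℝ} (hℓ : 0 < ℓ) (hℓ1 : ℓ ≤ 1) (hB : 0 ≤ B)
    (hc : 0 ≤ c) (hb : 0 ≤ b) (hcb : c + b ≤ n) (h1 : c - n + b = -1) (h2 : c - n < -1)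
    (hh : ∀ z, |h z| ≤ B * (‖z‖ ^ c * min ‖z‖ 1 ^ b)) :
    |∫ p, (p.1 ^ n)⁻¹ * Ψ p.2 * h (p.1 • p.2) ∂scale d ℓ| ≤
      B * (Real.log (1 / ℓ) - 1 / (c - n + 1)) * kw Ψ n := by
  obtain ⟨i, e⟩ := integral_Ioi_rpow_mul_min_one hℓ hℓ1 h1 h2
  rw [← e, ← integral_const_mul]
  exact abs_integral_scale_le (f := fun p => (p.1 ^ n)⁻¹ * Ψ p.2 * h (p.1 • p.2))
    (i.const_mul B) Ψ n fun s hs z =>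
      abs_kernel_le_rpow Ψ (hℓ.trans hs) zero_le_one hB hc hb hcb (hh _)

lemma abs_integral_kernel_sub_le (Ψ : 𝓢(Sp d, ℝ)) {ℓ : ℝ} (hℓ : 0 ≤ ℓ) (hB : 0 ≤ B)
    (hc : 0 ≤ c) (hcn : c ≤ n) (h1 : -1 < c - n) (hh : ∀ z, |h z| ≤ B * ‖z‖ ^ c)
    (h_int : Integrable (fun p => (p.1 ^ n)⁻¹ * Ψ p.2 * h (p.1 • p.2)) (scale d 0)) :
    |∫ p, (p.1 ^ n)⁻¹ * Ψ p.2 * h (p.1 • p.2) ∂scale d 0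
        - ∫ p, (p.1 ^ n)⁻¹ * Ψ p.2 * h (p.1 • p.2) ∂scale d ℓ| ≤
      B * (ℓ ^ (c - n + 1) / (c - n + 1)) * kw Ψ n := by
  have hm : MeasurableSet (Ioi ℓ ×ˢ univ : Set (ℝ × Sp d)) := measurableSet_Ioi.prod .univ
  have hs : scale d ℓ = (scale d 0).restrict (Ioi ℓ ×ˢ univ) := by
    rw [scale_eq, scale_eq, Measure.restrict_restrict hm, inter_eq_left.2]
    exact prod_mono (Ioi_subset_Ioi hℓ) subset_rfl
  obtain ⟨i, e⟩ := integrableOn_Ioc_rpow hℓ h1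
  have e' : ∫ s in Ioi 0, (Ioc 0 ℓ).indicator (fun s : ℝ => B * s ^ (c - n)) s
      = B * (ℓ ^ (c - n + 1) / (c - n + 1)) := by
    rw [setIntegral_indicator measurableSet_Ioc, inter_eq_right.2 Ioc_subset_Ioi_self,
      integral_const_mul, e]
  rw [hs, ← integral_indicator hm, ← integral_sub h_int (h_int.indicator hm), ← e']
  refine abs_integral_scale_le (w := (Ioc 0 ℓ).indicator fun s : ℝ => B * s ^ (c - n))
    (f := fun p => (p.1 ^ n)⁻¹ * Ψ p.2 * h (p.1 • p.2) - (Ioi ℓ ×ˢ univ).indicator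
      (fun p => (p.1 ^ n)⁻¹ * Ψ p.2 * h (p.1 • p.2)) p)
    ((integrable_indicator_iff measurableSet_Ioc).2 (IntegrableOn.restrict
      (Integrable.const_mul i B))) Ψ n fun s hs z => ?_
  rcases lt_or_ge ℓ s with h | h
  · rw [indicator_of_mem (show (s, z) ∈ Ioi ℓ ×ˢ univ from ⟨h, mem_univ _⟩),
      indicator_of_notMem fun h' => h.not_ge h'.2]
    simp
  · rw [indicator_of_notMem fun h' => h.not_gt h'.1,
      indicator_of_mem (show s ∈ Ioc 0 ℓ from ⟨hs, h⟩), sub_zero]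
    simpa using abs_kernel_le_rpow (b := 0) (θ := 0) Ψ hs le_rfl hB hc le_rfl (by simpa)
      (by simpa using hh (s • z))

end Scales

section SingularBounds

variable {d : ℕ} {α : ℝ}

lemma hexp_succ (k : ℕ) : hexp α (k + 1) = hexp α k - (1 - α) := by
  simp only [hexp]
  push_cast
  ring

lemma homog_eq {n k K : ℕ} (h : k + n = K + 2) : homog α n k = n + hexp α (K + 1) - 1 := by
  have h' : (k : ℝ) = K + 2 - n := by
    rw [eq_sub_iff_add_eq]
    exact_mod_cast h
  simp only [homog, hexp, h']
  push_cast
  ring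

lemma isBigO_integral_kernel (hα : 0 < α) (hα1 : α < 1) {f θ : Cfg d α → ℝ} {n k j K : ℕ}
    (Ψ : 𝓢(Sp d, ℝ)) (hn : 2 ≤ n) (hk : k + n = K + 2) (hK : 0 < hexp α (K + 1))
    (hθ : ∀ x ∈ Adm d α, 0 ≤ θ x) (hz : ∀ x z, θ {x with z := z} = θ x)
    (hf : f =O[𝓟 (Adm d α)] gain n k j (hexp α K) θ) :
    (fun x : Cfg d α => ∫ p, (p.1 ^ n)⁻¹ * Ψ p.2 * f {x with z := p.1 • p.2} ∂scale d 0)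
      =O[𝓟 (Adm d α)] fun x => amp 1 (K + 1) j x * θ x ^ hexp α (K + 1) := by
  obtain ⟨C, hC, h⟩ := (isBigO_principal_iff fun x hx => mul_nonneg (amp_pos hx).le
    (mul_nonneg (Real.rpow_nonneg (norm_nonneg _) _)
      (Real.rpow_nonneg (le_min (norm_nonneg _) (hθ x hx)) _))).1 hf
  have hs := hexp_succ (α := α) K
  have e := homog_eq (α := α) hk
  have hc : hexp α K ≤ homog α n k := hexp_le_homog hα hα1 (by omega) (by omega)
  have hb : 0 < hexp α K := by linarith
  have hb1 := hexp_le_one hα1 K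
  have hkw := kw_nonneg Ψ n
  have h1 : 0 < 1 / hexp α (K + 1) + 1 / (1 - α) := by
    have : 0 < 1 - α := by linarith
    positivity
  refine (isBigO_principal_iff fun x hx => mul_nonneg (amp_pos hx).le
    (Real.rpow_nonneg (hθ x hx) _)).2
    ⟨C * (1 / hexp α (K + 1) + 1 / (1 - α)) * kw Ψ n, by positivity, fun x hx => ?_⟩
  have hA := amp_pos (n := n) (k := k) (j := j) hx
  have hB : ∀ z, |f {x with z := z}| ≤ C * amp n k j x *
      (‖z‖ ^ (homog α n k - hexp α K) * min ‖z‖ (θ x) ^ hexp α K) := fun z => by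
    refine (h {x with z := z} hx).trans_eq ?_
    simp only [hz, mul_assoc]
    rfl
  rcases (hθ x hx).eq_or_lt with h0 | h0
  · have hzero : ∀ z, f {x with z := z} = 0 := fun z => by
      have := hB z
      rwa [← h0, min_eq_right (norm_nonneg _), Real.zero_rpow hb.ne', mul_zero, mul_zero,
        abs_nonpos_iff] at this
    simp only [hzero, mul_zero, integral_zero, abs_zero]
    have := amp_pos (n := 1) (k := K + 1) (j := j) hx
    have := Real.rpow_nonneg (hθ x hx) (hexp α (K + 1))
    positivity
  · refine (abs_integral_kernel_le Ψ h0 (by positivity) (sub_nonneg.2 hc) hb.le (by linarith)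
      (by linarith) (by linarith) hB).trans ?_
    rw [show homog α n k - hexp α K - n + hexp α K + 1 = hexp α (K + 1) by linarith,
      show homog α n k - hexp α K - n + 1 = -(1 - α) by linarith, one_div_neg_eq_neg_one_div,
      sub_neg_eq_add]
    have hA' := amp_le (j := j) (show k + n = (K + 1) + 1 by omega) (by omega : 1 ≤ n) hx
    calc _ ≤ C * amp 1 (K + 1) j x * (θ x ^ hexp α (K + 1) *
          (1 / hexp α (K + 1) + 1 / (1 - α))) * kw Ψ n := by
          refine mul_le_mul_of_nonneg_right (mul_le_mul_of_nonneg_right ?_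
            (mul_nonneg (Real.rpow_nonneg h0.le _) h1.le)) hkw
          exact mul_le_mul_of_nonneg_left hA' hC
      _ = _ := by ring

variable {K j : ℕ} {P : Flow d α → ℝ → Pt d → ℝ}

lemma Sing.isBigO_scale (hα : 0 < α) (hα1 : α < 1) (hest : ∀ k ≤ K, Est d α k)
    (hK : 0 < hexp α (K + 1)) (hP : Sing 0 K j P) (hj : 1 ≤ j) :
    (fun x : Cfg d α => P x.S 0 x.q) =O[𝓟 (Adm d α)]
      fun x => amp 1 (K + 1) j x * x.R ^ hexp α (K + 1) := by
  induction hP with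
  | zero => exact isBigO_zero _ _
  | add _ _ ih ih' => exact (ih hest hK hj).add (ih' hest hK hj)
  | @base n k K j g Ψ hg hn hk =>
    have hK' : 0 ≤ hexp α K := hK.le.trans (hexp_anti hα1 K.le_succ)
    exact isBigO_integral_kernel hα hα1 Ψ hn hk hK (fun x hx => hx.1.le) (fun _ _ => rfl)
      (hg.isBigO_scale hα hα1 hest hK' (by omega) hj)

lemma Sing.isBigO_sub (hα : 0 < α) (hα1 : α < 1) (hest : ∀ k ≤ K, Est d α k)
    (hK : 0 < hexp α (K + 1)) (hP : Sing 0 K j P) :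
    (fun x : Cfg d α => dl (P x.S 0) x.q x.y) =O[𝓟 (Adm d α)]
      fun x => amp 1 (K + 1) j x * ‖x.y‖ ^ hexp α (K + 1) := by
  induction hP with
  | zero => simpa only [dl, sub_self] using isBigO_zero _ _
  | add _ _ ih ih' =>
    refine ((ih hest hK).add (ih' hest hK)).congr_left fun x => ?_
    simp only [dl]
    ring
  | @base n k K j g Ψ hg hn hk =>
    have hK' : 0 ≤ hexp α K := hK.le.trans (hexp_anti hα1 K.le_succ)
    refine (isBigO_integral_kernel hα hα1 Ψ hn hk hK (fun x hx => norm_nonneg x.y) (fun _ _ => rfl)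
      (hg.isBigO_sub hα hα1 hest hK' (by omega))).congr' ?_ EventuallyEq.rfl
    filter_upwards [mem_principal_self _] with x hx
    have hc := Sing.conv (e := 0) hn le_rfl (Or.inr rfl)
    rw [dl, scaleInt, scaleInt, ← integral_sub ((hg.reg x.S).integrable Ψ hc
      (add_mem_slab (Adm.slab x hx) _)) ((hg.reg x.S).integrable Ψ hc (Adm.slab x hx))]
    simp only [add_zero, mul_sub]

/-- Truncating the singular integrals at scale `ℓ`. -/
lemma Sing.isBigO_truncation (hα : 0 < α) (hα1 : α < 1) (hest : ∀ k ≤ K, Est d α k)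
    (hK : 0 < hexp α (K + 1)) (hP : Sing 0 K j P) :
    (fun x : Cfg d α => P x.S 0 x.q - P x.S x.ℓ x.q) =O[𝓟 (Adm d α ∩ {x | 0 < x.ℓ})]
      fun x => amp 1 (K + 1) j x * x.ℓ ^ hexp α (K + 1) := by
  induction hP with
  | zero => simpa only [sub_self] using isBigO_zero _ _
  | add _ _ ih ih' =>
    refine ((ih hest hK).add (ih' hest hK)).congr_left fun x => ?_
    ring
  | @base n k K j g Ψ hg hn hk =>
    have hs := hexp_succ (α := α) K
    have e := homog_eq (α := α) hk
    have hK' : 0 ≤ hexp α K := hK.le.trans (hexp_anti hα1 K.le_succ)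
    have hc : hexp α K ≤ homog α n k := hexp_le_homog hα hα1 (by omega) (by omega)
    have hb1 := hexp_le_one hα1 (K + 1)
    have hkw := kw_nonneg Ψ n
    obtain ⟨C, hC, h⟩ := (isBigO_principal_iff fun x hx => mul_nonneg (amp_pos hx).le
      (Real.rpow_nonneg (norm_nonneg _) _)).1 (hg.isBigO hα hα1 hest hK' (by omega))
    refine (isBigO_principal_iff fun x hx => mul_nonneg (amp_pos hx.1).le
      (Real.rpow_nonneg (le_of_lt hx.2) _)).2
      ⟨C * (1 / hexp α (K + 1)) * kw Ψ n, by positivity, fun x hx => ?_⟩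
    have hA := amp_pos (n := n) (k := k) (j := j) hx.1
    have hA' := amp_le (j := j) (show k + n = (K + 1) + 1 by omega) (by omega : 1 ≤ n) hx.1
    have hc0 := Sing.conv (e := 0) hn le_rfl (Or.inr rfl)
    refine (abs_integral_kernel_sub_le (n := n) (h := g x.S x.q) Ψ (le_of_lt hx.2)
      (mul_nonneg hC hA.le) (hK'.trans hc) (by linarith) (by linarith)
      (fun z => (h {x with z := z} hx.1).trans_eq (mul_assoc _ _ _).symm)
      ((hg.reg x.S).integrable Ψ hc0 (Adm.slab x hx.1))).trans ?_
    rw [show homog α n k - n + 1 = hexp α (K + 1) by linarith]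
    have h0 := Real.rpow_nonneg (le_of_lt hx.2) (hexp α (K + 1))
    calc _ ≤ C * amp 1 (K + 1) j x * (x.ℓ ^ hexp α (K + 1) / hexp α (K + 1)) * kw Ψ n := by
          refine mul_le_mul_of_nonneg_right (mul_le_mul_of_nonneg_right ?_
            (div_nonneg h0 hK.le)) hkw
          exact mul_le_mul_of_nonneg_left hA' hC
      _ = _ := by ring

/-- The truncated singular integrals diverge logarithmically at the critical order. -/
lemma Sing.isBigO_log (hα : 0 < α) (hα1 : α < 1) (hest : ∀ k ≤ K, Est d α k)
    (hK : hexp α (K + 1) = 0) (hP : Sing 0 K j P) :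
    (fun x : Cfg d α => P x.S x.ℓ x.q) =O[𝓟 (Adm d α ∩ {x | 0 < x.ℓ ∧ x.ℓ ≤ 1})]
      fun x => amp 1 (K + 1) j x * (1 + Real.log (1 / x.ℓ)) := by
  have hlog : ∀ ℓ : ℝ, 0 < ℓ → ℓ ≤ 1 → 0 ≤ Real.log (1 / ℓ) := fun ℓ h h' =>
    Real.log_nonneg (by rw [le_div_iff₀ h]; linarith)
  induction hP with
  | zero => exact isBigO_zero _ _
  | add _ _ ih ih' => exact (ih hest hK).add (ih' hest hK)
  | @base n k K j g Ψ hg hn hk =>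
    have hs := hexp_succ (α := α) K
    have e := homog_eq (α := α) hk
    have hb : 0 < hexp α K := by linarith
    have hc : hexp α K ≤ homog α n k := hexp_le_homog hα hα1 (by omega) (by omega)
    have hkw := kw_nonneg Ψ n
    have hα2 : 0 < 1 - α := by linarith
    obtain ⟨C, hC, h⟩ := (isBigO_principal_iff fun x hx => mul_nonneg (amp_pos hx).le
      (mul_nonneg (Real.rpow_nonneg (norm_nonneg _) _)
        (Real.rpow_nonneg (le_min (norm_nonneg _) zero_le_one) _))).1
      (hg.isBigO_periodic hα hα1 hest hb.le (by omega))
    refine (isBigO_principal_iff fun x hx => mul_nonneg (amp_pos hx.1).le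
      (add_nonneg zero_le_one (hlog _ hx.2.1 hx.2.2))).2
      ⟨C * (1 + 1 / (1 - α)) * kw Ψ n, by positivity, fun x hx => ?_⟩
    have hA := amp_pos (n := n) (k := k) (j := j) hx.1
    have hA' := amp_le (j := j) (show k + n = (K + 1) + 1 by omega) (by omega : 1 ≤ n) hx.1
    have hL := hlog _ hx.2.1 hx.2.2
    refine (abs_integral_kernel_le_log (n := n) (h := g x.S x.q) Ψ hx.2.1 hx.2.2
      (mul_nonneg hC hA.le) (sub_nonneg.2 hc) hb.le (by linarith) (by linarith) (by linarith)
      (fun z => (h {x with z := z} hx.1).trans_eq (mul_assoc _ _ _).symm)).trans ?_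
    rw [show homog α n k - hexp α K - n + 1 = -(1 - α) by linarith, one_div_neg_eq_neg_one_div,
      sub_neg_eq_add]
    have h2 : 0 < 1 / (1 - α) := by positivity
    calc _ ≤ C * amp 1 (K + 1) j x * ((1 + 1 / (1 - α)) * (1 + Real.log (1 / x.ℓ))) * kw Ψ n := by
          refine mul_le_mul_of_nonneg_right (mul_le_mul (mul_le_mul_of_nonneg_left hA' hC) ?_
            (by positivity) (mul_nonneg hC (amp_pos hx.1).le)) hkw
          nlinarith
      _ = _ := by ring

lemma est_succ (hα : 0 < α) (hα1 : α < 1) (hest : ∀ k ≤ K, Est d α k)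
    (hK : 0 < hexp α (K + 1)) : Est d α (K + 1) := by
  intro j F hF
  obtain ⟨P, N, hP, hN, h⟩ := hF.exists_eq
  have hN' := fun j N (hN : NP (d := d) (α := α) True K j N) => hN.isBigO_sup hest
  constructor
  · have hz : Tendsto (fun x : Cfg d α => {x with y := x.z}) (𝓟 (Adm d α)) (𝓟 (Adm d α)) :=
      tendsto_principal_principal.2 fun x hx => hx
    have h1 : (fun x : Cfg d α => dl (P x.S 0) x.q x.z) =O[𝓟 (Adm d α)]
      fun x => amp 1 (K + 1) j x * ‖x.z‖ ^ hexp α (K + 1) :=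
      (hP.isBigO_sub hα hα1 hest hK).comp_tendsto hz
    have h2 := isBigO_dl_of_sup hN.isField hK.le (hexp_le_one hα1 _) (hN' _ _ hN) fun l => by
      obtain ⟨N', hN1, e⟩ := hN.pd l
      refine (hN' _ _ hN1).congr' ?_ EventuallyEq.rfl
      filter_upwards [mem_principal_self _] with x hx
      exact (e x.S x.q (Adm.slab x hx)).symm
    refine (h1.add h2).congr' ?_ EventuallyEq.rfl
    filter_upwards [mem_principal_self _] with x hx
    have := Adm.slab x hx
    simp only [dl]
    rw [h x.S _ this, h x.S _ (add_mem_slab this _)]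
    ring
  · intro hj
    refine ((hP.isBigO_scale hα hα1 hest hK hj).add (hN' _ _ hN)).congr' ?_ EventuallyEq.rfl
    filter_upwards [mem_principal_self _] with x hx
    exact (h x.S x.q (Adm.slab x hx)).symm

lemma est (hα : 0 < α) (hα1 : α < 1) (k : ℕ) (hk : 0 < hexp α k) : Est d α k := by
  induction k using Nat.strong_induction_on with
  | _ k ih =>
    cases k with
    | zero => exact est_zero hα hα1
    | succ k =>
      exact est_succ hα hα1 (fun i hi => ih i (by omega)
        (hk.trans_le (hexp_anti hα1 (by omega)))) hk

end SingularBounds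

section Approximation

variable {d : ℕ} {α : ℝ}

/-- Differentiable approximations at scale `ℓ`, with derivative `G'` along the flow. -/
structure Approx (K : ℕ) (F : Flow d α → Pt d → ℝ) (G G' : Flow d α → ℝ → Pt d → ℝ) : Prop where
  differentiable : ∀ S ℓ, 0 < ℓ → ∀ q ∈ slab d S.T, DifferentiableAt ℝ (G S ℓ) q
  fderiv_eq : ∀ S ℓ, 0 < ℓ → ∀ q ∈ slab d S.T, fderiv ℝ (G S ℓ) q (1, S.u q) = G' S ℓ q
  error : (fun x : Cfg d α => F x.S x.q - G x.S x.ℓ x.q)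
    =O[𝓟 (Adm d α ∩ {x | 0 < x.ℓ ∧ x.ℓ ≤ 1})] fun x => amp 1 K 0 x * x.ℓ ^ (1 - α)
  growth : (fun x : Cfg d α => G' x.S x.ℓ x.q)
    =O[𝓟 (Adm d α ∩ {x | 0 < x.ℓ ∧ x.ℓ ≤ 1})]
      fun x => amp 1 (K + 1) 0 x * (1 + Real.log (1 / x.ℓ))

lemma Adm.log_nonneg : ∀ x ∈ Adm d α ∩ {x | 0 < x.ℓ ∧ x.ℓ ≤ 1}, 0 ≤ Real.log (1 / x.ℓ) :=
  fun x hx => Real.log_nonneg (by rw [le_div_iff₀ hx.2.1]; linarith [hx.2.2])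

lemma isBigO_one_add_log (K : ℕ) : (amp 1 K 0 : Cfg d α → ℝ)
    =O[𝓟 (Adm d α ∩ {x | 0 < x.ℓ ∧ x.ℓ ≤ 1})] fun x => amp 1 K 0 x * (1 + Real.log (1 / x.ℓ)) := by
  refine (isBigO_principal_iff fun x hx => mul_nonneg (amp_pos hx.1).le
    (add_nonneg zero_le_one (Adm.log_nonneg x hx))).2 ⟨1, zero_le_one, fun x hx => ?_⟩
  have h1 := amp_pos (n := 1) (k := K) (j := 0) hx.1
  have h2 := Adm.log_nonneg x hx
  rw [abs_of_pos h1, one_mul]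
  nlinarith

lemma exists_approx_succ (hα : 0 < α) (hα1 : α < 1) {K : ℕ} (hK : hexp α (K + 1 + 1) = 0)
    {F : Flow d α → Pt d → ℝ} (hF : Word (K + 1) 0 F) : ∃ G G', Approx (K + 1) F G G' := by
  have hK1 : hexp α (K + 1) = 1 - α := by linarith [hexp_succ (α := α) (K + 1)]
  have hpos : 0 < hexp α (K + 1) := by linarith
  have hest : ∀ k ≤ K + 1, Est d α k := fun k hk =>
    est hα hα1 k (hpos.trans_le (hexp_anti hα1 hk))
  obtain ⟨P, N, hP, hN, h⟩ := hF.exists_eq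
  obtain ⟨P', hP', hPd⟩ := hP.md
  obtain ⟨N', hN', hNd⟩ := hN.md
  have hdiff : ∀ S ℓ, 0 < ℓ → ∀ q ∈ slab d S.T,
      HasFDerivAt (fun q => P S ℓ q + N S q) (fderiv ℝ (P S ℓ) q + fderiv ℝ (N S) q) q :=
    fun S ℓ hℓ q hq => ((hPd S ℓ hℓ.le (Or.inl hℓ) q hq).1.hasFDerivAt).add
      (((hN.isField S).differentiableAt hq).hasFDerivAt)
  refine ⟨fun S ℓ q => P S ℓ q + N S q, fun S ℓ q => P' S ℓ q + N' S q, ⟨fun S ℓ hℓ q hq =>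
    (hdiff S ℓ hℓ q hq).differentiableAt, fun S ℓ hℓ q hq => ?_, ?_, ?_⟩⟩
  · rw [(hdiff S ℓ hℓ q hq).fderiv, add_apply, (hPd S ℓ hℓ.le (Or.inl hℓ) q hq).2,
      ← hNd S q hq]
    rfl
  · have h1 := (hP.isBigO_truncation hα hα1 (fun k hk => hest k (by omega)) hpos).mono
      (principal_mono.2 fun x (hx : x ∈ Adm d α ∩ {x | 0 < x.ℓ ∧ x.ℓ ≤ 1}) => ⟨hx.1, hx.2.1⟩)
    rw [hK1] at h1
    refine h1.congr' ?_ EventuallyEq.rfl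
    filter_upwards [mem_principal_self _] with x hx
    rw [h x.S x.q (Adm.slab x hx.1)]
    ring
  · refine (hP'.isBigO_log hα hα1 hest hK).add (IsBigO.trans ?_ (isBigO_one_add_log _))
    have h2 := hN'.isBigO_sup hest
    simp only [hK, Real.rpow_zero, mul_one] at h2
    exact h2.mono (principal_mono.2 inter_subset_left)

lemma integrable_gauss_mul_const (c : ℝ) : Integrable fun z => gauss d z * c :=
  (gauss d).integrable.mul_const c

lemma isBigO_sub_moll (hα : 0 < α) (hα1 : α < 1) (i : Fin d) :
    (fun x : Cfg d α => uc i x.S x.q - moll (gauss d) x.ℓ (uc i x.S) x.q)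
      =O[𝓟 (Adm d α ∩ {x | 0 < x.ℓ ∧ x.ℓ ≤ 1})] fun x => x.S.M * x.ℓ ^ α := by
  obtain ⟨C, hC, h⟩ := (isBigO_principal_iff fun x _ => mul_nonneg x.S.M_pos.le
    (Real.rpow_nonneg (norm_nonneg _) _)).1 (isBigO_dl_uc i (Adm.slab (d := d) (α := α)))
  refine (isBigO_principal_iff fun x hx => mul_nonneg x.S.M_pos.le
    (Real.rpow_nonneg hx.2.1.le _)).2 ⟨C * kw (gauss d) 1, mul_nonneg hC (kw_nonneg _ _),
    fun x hx => ?_⟩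
  have hM := x.S.M_pos
  have hℓ := hx.2.1
  have e : moll (gauss d) x.ℓ (uc i x.S) x.q - uc i x.S x.q
      = ∫ z, gauss d z * dl (uc i x.S) x.q (x.ℓ • z) := by
    have h1 : uc i x.S x.q = ∫ z, gauss d z * uc i x.S x.q := by
      rw [integral_mul_const, integral_gauss, one_mul]
    rw [h1, moll, ← integral_sub (integrable_moll _ (field_uc x.S i) (Adm.slab x hx.1) _)
      (integrable_gauss_mul_const _)]
    simp only [dl, mul_sub]
  rw [abs_sub_comm, e]
  refine (abs_moll_le (c := C * (x.S.M * x.ℓ ^ α)) _ 1 fun z => ?_).trans_eq (by ring)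
  refine (h {x with z := x.ℓ • z} hx.1).trans ?_
  simp only [norm_smul_rpow hℓ, pow_one]
  calc C * (x.S.M * (x.ℓ ^ α * ‖z‖ ^ α)) = C * (x.S.M * x.ℓ ^ α) * ‖z‖ ^ α := by ring
    _ ≤ _ := by
      gcongr
      exact rpow_le_one_add (norm_nonneg _) hα.le hα1.le

lemma isBigO_moll_quadratic (hα : 0 < α) (hα1 : α < 1) (i l : Fin d) :
    (fun x : Cfg d α => ∫ z, kd l (gauss d) z
        * (dl (uc i x.S) x.q (x.ℓ • z) * dl (uc l x.S) x.q (x.ℓ • z)))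
      =O[𝓟 (Adm d α ∩ {x | 0 < x.ℓ ∧ x.ℓ ≤ 1})] fun x => x.S.M ^ 2 * x.ℓ ^ (2 * α) := by
  have h0 := fun i => isBigO_dl_uc i (Adm.slab (d := d) (α := α))
  obtain ⟨C, hC, h⟩ := (isBigO_principal_iff fun x _ => mul_nonneg
    (mul_nonneg x.S.M_pos.le (Real.rpow_nonneg (norm_nonneg _) _))
    (mul_nonneg x.S.M_pos.le (Real.rpow_nonneg (norm_nonneg _) _))).1 ((h0 i).mul (h0 l))
  refine (isBigO_principal_iff fun x hx => mul_nonneg (sq_nonneg _)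
    (Real.rpow_nonneg hx.2.1.le _)).2 ⟨C * kw (kd l (gauss d)) 2, mul_nonneg hC (kw_nonneg _ _),
    fun x hx => ?_⟩
  have hM := x.S.M_pos
  have hℓ := hx.2.1
  refine (abs_moll_le (c := C * (x.S.M ^ 2 * x.ℓ ^ (2 * α))) _ 2 fun z => ?_).trans_eq (by ring)
  refine (h {x with z := x.ℓ • z} hx.1).trans ?_
  simp only [norm_smul_rpow hℓ]
  have hz : ‖z‖ ^ α ≤ 1 + ‖z‖ := rpow_le_one_add (norm_nonneg _) hα.le hα1.le
  rw [two_mul, Real.rpow_add hℓ]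
  calc C * (x.S.M * (x.ℓ ^ α * ‖z‖ ^ α) * (x.S.M * (x.ℓ ^ α * ‖z‖ ^ α)))
      = C * (x.S.M ^ 2 * (x.ℓ ^ α * x.ℓ ^ α)) * (‖z‖ ^ α) ^ 2 := by ring
    _ ≤ _ := by gcongr

lemma isBigO_viscous (hα : 0 < α) (hα1 : α < 1) (hK : hexp α 1 = 0) (i l : Fin d) :
    (fun x : Cfg d α => x.S.ν * moll (gauss d) x.ℓ (pd l (pd l (uc i x.S))) x.q)
      =O[𝓟 (Adm d α)] amp 1 1 0 := by
  obtain ⟨C, hC, h⟩ := (isBigO_principal_iff fun x hx => mul_nonneg (amp_pos hx).le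
    (Real.rpow_nonneg hx.1.le _)).1 ((est_zero hα hα1 _ _ (((Word.base i).pd l).pd l)).2 (by omega))
  refine (isBigO_principal_iff fun x hx => (amp_pos hx).le).2
    ⟨C * kw (gauss d) 0, mul_nonneg hC (kw_nonneg _ _), fun x hx => ?_⟩
  have hM := x.S.M_pos
  have hR := hx.1
  have hν := x.S.ν_pos
  have h1 : |moll (gauss d) x.ℓ (pd l (pd l (uc i x.S))) x.q|
      ≤ C * (amp 1 0 2 x * x.R ^ hexp α 0) * kw (gauss d) 0 :=
    abs_moll_le _ 0 fun z => by
      rw [pow_zero, mul_one]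
      exact h {x with q := x.q + (0, x.ℓ • z)} (Adm.translate x hx (x.ℓ • z))
  have h2 : x.S.ν * (amp 1 0 2 x * x.R ^ hexp α 0) ≤ amp 1 1 0 x := by
    have e : x.R ^ (1 + α) * x.R ^ α = x.R ^ 2 := by
      rw [← Real.rpow_add hR, ← Real.rpow_natCast]
      congr 1
      simp only [hexp] at hK
      push_cast at hK ⊢
      linarith
    rw [hexp_zero]
    simp only [amp, pow_one, pow_zero, mul_one, div_one]
    calc x.S.ν * (x.S.M / x.R ^ 2 * x.R ^ α)
        ≤ (x.κ * x.R ^ (1 + α)) * (x.S.M / x.R ^ 2 * x.R ^ α) := by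
          gcongr
          exact hx.2.2.1
      _ = x.S.M * x.κ / x.R ^ 2 * (x.R ^ (1 + α) * x.R ^ α) := by ring
      _ = x.S.M * x.κ := by rw [e]; field_simp
  rw [abs_mul, abs_of_pos hν]
  calc _ ≤ x.S.ν * (C * (amp 1 0 2 x * x.R ^ hexp α 0) * kw (gauss d) 0) := by gcongr
    _ = C * kw (gauss d) 0 * (x.S.ν * (amp 1 0 2 x * x.R ^ hexp α 0)) := by ring
    _ ≤ _ := mul_le_mul_of_nonneg_left h2 (mul_nonneg hC (kw_nonneg _ _))

lemma exists_approx_zero (hα : 0 < α) (hα1 : α < 1) (hK : hexp α 1 = 0) (i : Fin d) :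
    ∃ G G', Approx (α := α) 0 (uc i) G G' := by
  have hα2 : α = 1 - α := by
    simp only [hexp] at hK
    push_cast at hK
    linarith
  have h2α : 2 * α = 1 := by linarith
  obtain ⟨P, hP, hPe⟩ := exists_sing_pressure (d := d) (α := α) 0 [i] rfl
  have hD : ∀ (S : Flow d α) (ℓ : ℝ), ∀ q ∈ slab d S.T, ∃ L : Pt d →L[ℝ] ℝ,
      HasFDerivAt (moll (gauss d) ℓ (uc i S)) L q ∧ L (1, S.u q)
        = ∫ z, gauss d z * fderiv ℝ (uc i S) (q + (0, ℓ • z)) (1, S.u q) := fun S ℓ q hq => by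
    obtain ⟨L, h, hL⟩ := moll_hasFDerivAt (gauss d) (field_uc S i) hq ℓ
    refine ⟨L.comp (.inl ℝ (Pt d) ℝ), HasFDerivAt.comp (f := fun q => (q, ℓ))
      (g := fun r : Pt d × ℝ => moll (gauss d) r.2 (uc i S) r.1) q h
      (hasFDerivAt_prodMk_left q ℓ), ?_⟩
    simpa using (hL (1, S.u q) 0).2
  refine ⟨fun S ℓ q => moll (gauss d) ℓ (uc i S) q,
    fun S ℓ q => ∑ l, S.ν * moll (gauss d) ℓ (pd l (pd l (uc i S))) q - P S ℓ q
      + ℓ⁻¹ * ∑ l, ∫ z, kd l (gauss d) z * (dl (uc i S) q (ℓ • z) * dl (uc l S) q (ℓ • z)),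
    ⟨fun S ℓ _ q hq => ?_, fun S ℓ hℓ q hq => ?_, ?_, ?_⟩⟩
  · obtain ⟨L, h, -⟩ := hD S ℓ q hq
    exact h.differentiableAt
  · obtain ⟨L, h, hL⟩ := hD S ℓ q hq
    have hu := field_uc S i
    have hΔ : IsField S.T fun q => ∑ l, pd l (pd l (uc i S)) q := .sum fun l => (hu.pd l).pd l
    have hp : IsField S.T (pdl [i] S.p) := S.field_p.pd i
    have e1 : moll (gauss d) ℓ (md S (uc i S)) q
        = ∑ l, S.ν * moll (gauss d) ℓ (pd l (pd l (uc i S))) q - P S ℓ q := by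
      rw [moll_congr (h := fun q => S.ν * ∑ l, pd l (pd l (uc i S)) q + -1 * pdl [i] S.p q)
        (fun q hq => (md_uc i hq).trans (by simp only [pdl, List.foldr]; ring)) _ hq,
        moll_add ((IsField.const S.ν).mul hΔ) ((IsField.const (-1)).mul hp) _ hq,
        moll_const_mul, moll_const_mul, moll_sum (fun l => (hu.pd l).pd l) _ hq, Finset.mul_sum,
        hPe S ℓ hℓ.le (Or.inr rfl) q hq]
      ring
    rw [h.fderiv, hL, moll_transport _ hu hq hℓ, e1]
  · refine (isBigO_sub_moll hα hα1 i).congr_right fun x => ?_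
    rw [← hα2]
    simp [amp]
  · have h1 : (fun x : Cfg d α => ∑ l, x.S.ν * moll (gauss d) x.ℓ (pd l (pd l (uc i x.S))) x.q)
        =O[𝓟 (Adm d α ∩ {x | 0 < x.ℓ ∧ x.ℓ ≤ 1})] amp 1 1 0 :=
      IsBigO.fun_sum fun l _ => (isBigO_viscous hα hα1 hK i l).mono
        (principal_mono.2 inter_subset_left)
    have h2 : (fun x : Cfg d α => x.ℓ⁻¹ * ∑ l, ∫ z, kd l (gauss d) z
          * (dl (uc i x.S) x.q (x.ℓ • z) * dl (uc l x.S) x.q (x.ℓ • z)))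
        =O[𝓟 (Adm d α ∩ {x | 0 < x.ℓ ∧ x.ℓ ≤ 1})] amp 1 1 0 := by
      have h3 := (isBigO_refl (fun x : Cfg d α => x.ℓ⁻¹)
        (𝓟 (Adm d α ∩ {x | 0 < x.ℓ ∧ x.ℓ ≤ 1}))).mul
        (IsBigO.fun_sum fun l (_ : l ∈ Finset.univ) => isBigO_moll_quadratic hα hα1 i l)
      refine h3.trans ((isBigO_principal_iff fun x hx => (amp_pos hx.1).le).2
        ⟨1, zero_le_one, fun x hx => ?_⟩)
      have hM := x.S.M_pos
      have hℓ := hx.2.1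
      rw [h2α, Real.rpow_one, abs_of_nonneg (by positivity)]
      simp only [amp, pow_one, pow_zero, one_mul, div_one]
      calc x.ℓ⁻¹ * (x.S.M ^ 2 * x.ℓ) = x.S.M * x.S.M := by field_simp
        _ ≤ _ := mul_le_mul_of_nonneg_left hx.1.2.1 hM.le
    have hest : ∀ k ≤ 0, Est d α k := fun k hk => by
      obtain rfl : k = 0 := by omega
      exact est_zero hα hα1
    exact ((h1.trans (isBigO_one_add_log 1)).sub
      (hP.isBigO_log hα hα1 hest hK)).add (h2.trans (isBigO_one_add_log 1))

lemma exists_approx (hα : 0 < α) (hα1 : α < 1) {K : ℕ} (hK : hexp α (K + 1) = 0)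
    {F : Flow d α → Pt d → ℝ} (hF : Word K 0 F) : ∃ G G', Approx K F G G' := by
  cases K with
  | zero =>
    obtain ⟨i, rfl⟩ := hF.eq_uc
    exact exists_approx_zero hα hα1 hK i
  | succ K => exact exists_approx_succ hα hα1 hK hF

end Approximation

section Trajectories

variable {d : ℕ} {α : ℝ}

/-- Particle trajectories of the flow `S`. -/
def IsTraj (S : Flow d α) (γ : ℝ → Sp d) : Prop :=
  ∀ t ∈ Ioo 0 S.T, HasDerivAt γ (S.u (t, γ t)) t

lemma IsTraj.hasDerivAt {S : Flow d α} {γ : ℝ → Sp d} (hγ : IsTraj S γ) {F : Pt d → ℝ} {t : ℝ}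
    (ht : t ∈ Ioo 0 S.T) (hF : DifferentiableAt ℝ F (t, γ t)) :
    HasDerivAt (fun t => F (t, γ t)) (md S F (t, γ t)) t :=
  hF.hasFDerivAt.comp_hasDerivAt t ((hasDerivAt_id t).prodMk (hγ t ht))

lemma Approx.abs_sub_le {K : ℕ} {F : Flow d α → Pt d → ℝ} {G G' : Flow d α → ℝ → Pt d → ℝ}
    (h : Approx K F G G') : ∃ C : ℝ, 0 ≤ C ∧ ∀ (S : Flow d α) (R κ : ℝ) (γ : ℝ → Sp d),
      0 < R → S.M ≤ κ → S.ν ≤ κ * R ^ (1 + α) → S.M * R ^ (1 + α) ≤ S.ν → IsTraj S γ →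
      ∀ t₁ t₂ ℓ : ℝ, t₁ ≤ t₂ → t₁ ∈ Ioo 0 S.T → t₂ ∈ Ioo 0 S.T → R ^ 2 ≤ S.ν * t₁ →
        0 < ℓ → ℓ ≤ 1 → |F S (t₂, γ t₂) - F S (t₁, γ t₁)|
          ≤ C * (S.M * κ ^ K * (ℓ ^ (1 - α) + κ * (1 + Real.log (1 / ℓ)) * (t₂ - t₁))) := by
  obtain ⟨C₁, hC₁, h1⟩ := (isBigO_principal_iff fun x hx =>
    mul_nonneg (amp_pos hx.1).le (Real.rpow_nonneg hx.2.1.le _)).1 h.error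
  obtain ⟨C₂, hC₂, h2⟩ := (isBigO_principal_iff fun x hx =>
    mul_nonneg (amp_pos hx.1).le (by linarith [Adm.log_nonneg x hx])).1 h.growth
  refine ⟨2 * C₁ + C₂, by positivity,
    fun S R κ γ hR hMκ hνκ hMν hγ t₁ t₂ ℓ h12 ht₁ ht₂ hRt hℓ hℓ1 => ?_⟩
  have hM := S.M_pos
  have hν := S.ν_pos
  have hκ : 0 < κ := hM.trans_le hMκ
  have hlog : 0 ≤ Real.log (1 / ℓ) := Real.log_nonneg (by rw [le_div_iff₀ hℓ]; linarith)
  let x : ℝ → Cfg d α := fun t => ⟨S, R, κ, ℓ, (t, γ t), 0, 0⟩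
  have hsub : Icc t₁ t₂ ⊆ Ioo 0 S.T := fun t ht => ⟨ht₁.1.trans_le ht.1, ht.2.trans_lt ht₂.2⟩
  have hx : ∀ t ∈ Icc t₁ t₂, x t ∈ Adm d α ∩ {x | 0 < x.ℓ ∧ x.ℓ ≤ 1} := fun t ht =>
    ⟨⟨hR, hMκ, hνκ, hMν, mem_slab.2 (hsub ht),
      hRt.trans (mul_le_mul_of_nonneg_left ht.1 hν.le)⟩, hℓ, hℓ1⟩
  have e1 := h1 _ (hx t₁ (left_mem_Icc.2 h12))
  have e2 := h1 _ (hx t₂ (right_mem_Icc.2 h12))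
  have e3 := (convex_Icc t₁ t₂).norm_image_sub_le_of_norm_hasDerivWithin_le
    (f := fun t => G S ℓ (t, γ t)) (f' := fun t => G' S ℓ (t, γ t))
    (C := C₂ * (S.M * κ ^ (K + 1) * (1 + Real.log (1 / ℓ))))
    (fun t ht => by
      have hq : (t, γ t) ∈ slab d S.T := mem_slab.2 (hsub ht)
      refine ((hγ.hasDerivAt (hsub ht) (h.differentiable S ℓ hℓ _ hq)).congr_deriv
        (h.fderiv_eq S ℓ hℓ _ hq)).hasDerivWithinAt)
    (fun t ht => by simpa [x, amp] using h2 _ (hx t ht))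
    (left_mem_Icc.2 h12) (right_mem_Icc.2 h12)
  simp only [x, amp, pow_one, pow_zero, div_one] at e1 e2
  rw [Real.norm_eq_abs, Real.norm_of_nonneg (sub_nonneg.2 h12)] at e3
  have e4 : |F S (t₂, γ t₂) - F S (t₁, γ t₁)| ≤ |F S (t₂, γ t₂) - G S ℓ (t₂, γ t₂)|
      + |G S ℓ (t₂, γ t₂) - G S ℓ (t₁, γ t₁)| + |F S (t₁, γ t₁) - G S ℓ (t₁, γ t₁)| := by
    rw [abs_sub_comm (F S (t₁, γ t₁))]
    exact (_root_.abs_sub_le _ _ _).trans (add_le_add_left (_root_.abs_sub_le _ _ _) _)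
  have h5 : 0 ≤ S.M * κ ^ K * ℓ ^ (1 - α) := by positivity
  have h6 : 0 ≤ S.M * κ ^ K * (κ * (1 + Real.log (1 / ℓ)) * (t₂ - t₁)) := by
    have := sub_nonneg.2 h12
    positivity
  rw [pow_succ] at e3
  nlinarith [mul_nonneg hC₁ h6, mul_nonneg hC₂ h5]

lemma Word.abs_sub_le (hα : 0 < α) (hα1 : α < 1) {K : ℕ} (hK : hexp α (K + 1) = 0)
    {F : Flow d α → Pt d → ℝ} (hF : Word K 0 F) : ∃ C : ℝ, 0 ≤ C ∧
      ∀ (S : Flow d α) (R κ : ℝ) (γ : ℝ → Sp d),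
      0 < R → S.M ≤ κ → S.ν ≤ κ * R ^ (1 + α) → S.M * R ^ (1 + α) ≤ S.ν → IsTraj S γ →
      ∀ t₁ t₂ : ℝ, t₁ ≤ t₂ → t₁ ∈ Ioo 0 S.T → t₂ ∈ Ioo 0 S.T → R ^ 2 ≤ S.ν * t₁ →
        |F S (t₂, γ t₂) - F S (t₁, γ t₁)|
          ≤ C * (S.M * κ ^ (K + 1) * (t₂ - t₁) * (1 - min (Real.log (S.M * (t₂ - t₁))) 0)) := by
  obtain ⟨G, G', h⟩ := exists_approx hα hα1 hK hF
  obtain ⟨C, hC, h⟩ := h.abs_sub_le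
  refine ⟨C * (K + 3), by positivity, fun S R κ γ hR hMκ hνκ hMν hγ t₁ t₂ h12 ht₁ ht₂ hRt => ?_⟩
  have hM := S.M_pos
  have hκ : 0 < κ := hM.trans_le hMκ
  rcases h12.eq_or_lt with rfl | h12
  · simp
  have hs := sub_pos.2 h12
  set s := t₂ - t₁
  set r := min (S.M * s) 1
  have hr : 0 < r := lt_min (by positivity) one_pos
  have hr1 : r ≤ 1 := min_le_right _ _
  have hlog : Real.log r = min (Real.log (S.M * s)) 0 := by
    have h0 : 0 < S.M * s := by positivity
    rcases le_total (S.M * s) 1 with h | h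
    · rw [show r = S.M * s from min_eq_left h, min_eq_left (Real.log_nonpos h0.le h)]
    · rw [show r = 1 from min_eq_right h, min_eq_right (Real.log_nonneg h), Real.log_one]
  have hmin : min (Real.log (S.M * s)) 0 ≤ 0 := min_le_right _ _
  rw [← hlog] at hmin ⊢
  refine (h S R κ γ hR hMκ hνκ hMν hγ t₁ t₂ (r ^ (K + 2)) h12.le ht₁ ht₂ hRt (by positivity)
    (pow_le_one₀ hr.le hr1)).trans ?_
  have h1 : (r ^ (K + 2)) ^ (1 - α) = r := by
    rw [← Real.rpow_natCast, ← Real.rpow_mul hr.le]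
    have : ((K + 2 : ℕ) : ℝ) * (1 - α) = 1 := by
      simp only [hexp] at hK
      push_cast at hK ⊢
      linarith
    rw [this, Real.rpow_one]
  have h2 : Real.log (1 / r ^ (K + 2)) = -((K + 2) * Real.log r) := by
    rw [one_div, Real.log_inv, Real.log_pow]
    push_cast
    ring
  rw [h1, h2]
  have h3 : r ≤ κ * s := (min_le_left _ _).trans (mul_le_mul_of_nonneg_right hMκ hs.le)
  have h4 : κ * s ≤ κ * s * (1 - Real.log r) := le_mul_of_one_le_right (by positivity) (by linarith)
  have h5 : 1 + -((K + 2) * Real.log r) ≤ (K + 2) * (1 - Real.log r) := by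
    have : (0 : ℝ) ≤ K := by positivity
    linarith
  have h6 : κ * (1 + -((K + 2) * Real.log r)) * s ≤ (K + 2) * (κ * s * (1 - Real.log r)) :=
    calc κ * (1 + -((K + 2) * Real.log r)) * s = κ * s * (1 + -((K + 2) * Real.log r)) := by ring
      _ ≤ κ * s * ((K + 2) * (1 - Real.log r)) := by gcongr
      _ = _ := by ring
  calc _ ≤ C * (S.M * κ ^ K * ((K + 3) * (κ * s * (1 - Real.log r)))) := by
        gcongr
        linarith
    _ = _ := by ring

end Trajectories

section Iterates

variable {d : ℕ} {α : ℝ}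

lemma word_iterate (i : Fin d) (k : ℕ) :
    Word k 0 fun S : Flow d α => (md S)^[k] (uc i S) := by
  induction k with
  | zero => exact .base i
  | succ k ih => simpa only [Function.iterate_succ_apply'] using ih.md

lemma hasDerivAt_toLp {f : ℝ → Fin d → ℝ} {f' : Fin d → ℝ} {t : ℝ}
    (h : ∀ i, HasDerivAt (fun t => f t i) (f' i) t) :
    HasDerivAt (fun t => WithLp.toLp 2 (f t)) (WithLp.toLp 2 f') t :=
  (EuclideanSpace.equiv (Fin d) ℝ).symm.hasFDerivAt.comp_hasDerivAt t (hasDerivAt_pi.2 h)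

lemma iteratedDeriv_traj {S : Flow d α} {γ : ℝ → Sp d} (hγ : IsTraj S γ) (k : ℕ) :
    ∀ t ∈ Ioo 0 S.T, ∀ i, iteratedDeriv (k + 1) γ t i = (md S)^[k] (uc i S) (t, γ t) := by
  induction k with
  | zero =>
    intro t ht i
    rw [zero_add, iteratedDeriv_one, (hγ t ht).deriv]
    rfl
  | succ k ih =>
    intro t ht i
    have h1 : HasDerivAt (iteratedDeriv (k + 1) γ)
        (WithLp.toLp 2 fun i => (md S)^[k + 1] (uc i S) (t, γ t)) t := by
      have h2 : HasDerivAt (fun t => WithLp.toLp 2 fun i => (md S)^[k] (uc i S) (t, γ t))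
          (WithLp.toLp 2 fun i => (md S)^[k + 1] (uc i S) (t, γ t) : Sp d) t := by
        refine hasDerivAt_toLp fun i => ?_
        simp only [Function.iterate_succ_apply']
        exact hγ.hasDerivAt ht (((word_iterate i k).isField S).differentiableAt (mem_slab.2 ht))
      refine h2.congr_of_eventuallyEq ?_
      filter_upwards [isOpen_Ioo.mem_nhds ht] with s hs
      ext i
      exact ih s hs i
    rw [iteratedDeriv_succ, h1.deriv]

lemma norm_le_sum_abs (v : Sp d) : ‖v‖ ≤ ∑ i, |v i| := by
  calc ‖v‖ = ‖∑ i, v i • unit i‖ := by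
        congr 1
        ext j
        simp [unit, Pi.single_apply]
    _ ≤ ∑ i, ‖v i • unit i‖ := norm_sum_le _ _
    _ = _ := by simp [norm_smul, norm_unit]

end Iterates

section Setup

variable {d : ℕ}

lemma deriv_slice {F : Pt d → ℝ} {q : Pt d} (hF : DifferentiableAt ℝ F q) :
    deriv (fun s => F (s, q.2)) q.1 = fderiv ℝ F q (1, 0) :=
  (hF.hasFDerivAt.comp_hasDerivAt (f := fun s => (s, q.2)) q.1
    ((hasDerivAt_id q.1).prodMk (hasDerivAt_const q.1 q.2))).deriv

lemma fderiv_slice {F : Pt d → ℝ} {q : Pt d} (hF : DifferentiableAt ℝ F q) (l : Fin d) :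
    fderiv ℝ (fun y => F (q.1, y)) q.2 (EuclideanSpace.single l 1) = pd l F q := by
  have h : HasFDerivAt (fun y => F (q.1, y)) ((fderiv ℝ F q).comp (.inr ℝ ℝ (Sp d))) q.2 :=
    hF.hasFDerivAt.comp (f := fun y => (q.1, y)) q.2 (hasFDerivAt_prodMk_right q.1 q.2)
  rw [h.fderiv]
  rfl

lemma fderiv_one_apply (F : Pt d → ℝ) (q : Pt d) (v : Sp d) :
    fderiv ℝ F q (1, v) = fderiv ℝ F q (1, 0) + ∑ l, v l * pd l F q := by
  have h : ((1, v) : Pt d) = (1, 0) + (0, v) := by simp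
  rw [h, map_add, apply_zero_right]
  rfl

/-- The flow determined by a classical solution. -/
noncomputable def Flow.ofSolution {α T ν M : ℝ} {u : ℝ → Sp d → Sp d} {p : ℝ → Sp d → ℝ}
    (hν : 0 < ν) (hM : 0 < M)
    (hu : IsField T fun q : Pt d => u q.1 q.2) (hp : IsField T fun q : Pt d => p q.1 q.2)
    (hmom : ∀ t ∈ Ioo (0 : ℝ) T, ∀ (x : Sp d) (i : Fin d),
      deriv (fun s => u s x i) t
          + ∑ j, u t x j * fderiv ℝ (fun y => u t y i) x (EuclideanSpace.single j 1)
          + fderiv ℝ (fun y => p t y) x (EuclideanSpace.single i 1)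
        = ν * ∑ j, fderiv ℝ (fun y => fderiv ℝ (fun z => u t z i) y
            (EuclideanSpace.single j 1)) x (EuclideanSpace.single j 1))
    (hdiv : ∀ t ∈ Ioo (0 : ℝ) T, ∀ x : Sp d,
      ∑ i, fderiv ℝ (fun y => u t y i) x (EuclideanSpace.single i 1) = 0)
    (hhol : ∀ q ∈ slab d T, ∀ z, ‖u q.1 (q.2 + z) - u q.1 q.2‖ ≤ M * ‖z‖ ^ α) : Flow d α :=
  have hui : ∀ i, IsField T fun q : Pt d => u q.1 q.2 i := fun i =>
    hu.clm_comp (EuclideanSpace.proj i : Sp d →L[ℝ] ℝ)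
  have h1 : ∀ i j, ∀ q ∈ slab d T, fderiv ℝ (fun y => u q.1 y i) q.2 (EuclideanSpace.single j 1)
      = pd j (fun q : Pt d => u q.1 q.2 i) q := fun i j q hq =>
    fderiv_slice ((hui i).differentiableAt hq) j
  { T := T
    ν := ν
    M := M
    u := fun q => u q.1 q.2
    p := fun q => p q.1 q.2
    ν_pos := hν
    M_pos := hM
    field_u := hu
    field_p := hp
    momentum := fun i q hq => by
      have h2 := hmom q.1 (mem_slab.1 hq) q.2 i
      rw [deriv_slice (F := fun q : Pt d => u q.1 q.2 i) ((hui i).differentiableAt hq),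
        fderiv_slice (hp.differentiableAt hq)] at h2
      simp only [h1 _ _ q hq] at h2
      rw [fderiv_one_apply, h2]
      congr 1
      refine Finset.sum_congr rfl fun j _ => ?_
      rw [← fderiv_slice (((hui i).pd j).differentiableAt hq)]
      congr 2
      funext y
      exact h1 i j (q.1, y) (mem_slab.2 (mem_slab.1 hq))
    divergence := fun q hq => by
      rw [← hdiv q.1 (mem_slab.1 hq) q.2]
      exact Finset.sum_congr rfl fun i _ => (h1 i i q hq).symm
    holder := fun q hq z => by simpa using hhol q hq z }

/-- Given `a`, the scale `R = √(min a 1) (ν / M) ^ (1 / (1 + α))` and the rate `κ = M / min a 1`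
are admissible from time `a M ^ (-2 / (1 + α)) ν ^ ((1 - α) / (1 + α))` on. -/
lemma exists_scales {α ν M a : ℝ} (hα : 0 < α) (hα1 : α < 1) (hν : 0 < ν) (hM : 0 < M)
    (ha : 0 < a) (m : ℕ) : ∃ R κ : ℝ, 0 < R ∧ M ≤ κ ∧ ν ≤ κ * R ^ (1 + α) ∧ M * R ^ (1 + α) ≤ ν ∧
      R ^ 2 ≤ ν * (a * M ^ (-2 / (1 + α)) * ν ^ ((1 - α) / (1 + α))) ∧
      κ ^ m ≤ (a ^ (-(m : ℝ)) + 1) * M ^ m := by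
  have hα2 : (0 : ℝ) < 1 + α := by linarith
  set e := min a 1
  have he : 0 < e := lt_min ha one_pos
  have he1 : e ≤ 1 := min_le_right _ _
  have hb : 0 < ν / M := div_pos hν hM
  have h1 : (e ^ (1 / 2 : ℝ) * (ν / M) ^ (1 / (1 + α))) ^ (1 + α)
      = e ^ ((1 + α) / 2) * (ν / M) := by
    rw [Real.mul_rpow (by positivity) (by positivity), ← Real.rpow_mul he.le,
      ← Real.rpow_mul hb.le, one_div_mul_cancel hα2.ne', Real.rpow_one]
    congr 2
    ring
  refine ⟨e ^ (1 / 2 : ℝ) * (ν / M) ^ (1 / (1 + α)), M / e, by positivity, ?_, ?_, ?_, ?_, ?_⟩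
  · rw [le_div_iff₀ he]
    exact mul_le_of_le_one_right hM.le he1
  · have h2 : e ≤ e ^ ((1 + α) / 2) := by
      simpa using Real.rpow_le_rpow_of_exponent_ge he he1 (show (1 + α) / 2 ≤ 1 by linarith)
    rw [h1]
    calc ν = M / e * (e * (ν / M)) := by field_simp
      _ ≤ _ := by gcongr
  · rw [h1]
    have h2 : e ^ ((1 + α) / 2) ≤ 1 := Real.rpow_le_one he.le he1 (by positivity)
    calc M * (e ^ ((1 + α) / 2) * (ν / M)) ≤ M * (1 * (ν / M)) := by gcongr
      _ = ν := by field_simp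
  · have h2 : ((ν / M) ^ (1 / (1 + α))) ^ 2
        = ν * (M ^ (-2 / (1 + α)) * ν ^ ((1 - α) / (1 + α))) := by
      have h3 : ν * ν ^ ((1 - α) / (1 + α)) = ν ^ (2 / (1 + α)) := by
        nth_rewrite 1 [← Real.rpow_one ν]
        rw [← Real.rpow_add hν]
        congr 1
        field_simp
        ring
      rw [mul_left_comm, h3, ← Real.rpow_natCast, ← Real.rpow_mul hb.le,
        Real.div_rpow hν.le hM.le, neg_div, Real.rpow_neg hM.le, div_eq_inv_mul]
      push_cast
      rw [one_div_mul_eq_div]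
    rw [mul_pow, h2, ← Real.rpow_natCast, ← Real.rpow_mul he.le]
    norm_num only [Nat.cast_ofNat, Real.rpow_one]
    calc e * (ν * (M ^ (-2 / (1 + α)) * ν ^ ((1 - α) / (1 + α))))
        ≤ a * (ν * (M ^ (-2 / (1 + α)) * ν ^ ((1 - α) / (1 + α)))) := by
          gcongr
          exact min_le_left _ _
      _ = _ := by ring
  · rw [div_pow, div_eq_inv_mul]
    gcongr
    rw [Real.rpow_neg ha.le, Real.rpow_natCast]
    rcases le_total a 1 with h | h
    · rw [show e = a from min_eq_left h]
      linarith
    · rw [show e = 1 from min_eq_right h, one_pow, inv_one]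
      linarith [inv_pos.2 (pow_pos ha m)]

end Setup

end Lagrangian

open Lagrangian

/-- Lagrangian estimate, integer case `1/(1−α) = m+1`, with logarithmic loss. -/
theorem stmt3 (d : ℕ) (hd : 2 ≤ d) (α : ℝ) (hα : 0 < α) (hα1 : α < 1)
    (m : ℕ) (hm1 : 1 ≤ m) (hm : 1 / (1 - α) = (m : ℝ) + 1) :
    ∃ C : ℝ, 0 < C ∧
      ∀ T ν : ℝ, 0 < T → 0 < ν →
      ∀ (u : ℝ → EuclideanSpace ℝ (Fin d) → EuclideanSpace ℝ (Fin d)) (p : ℝ → EuclideanSpace ℝ (Fin d) → ℝ),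
        ContinuousOn (fun q : ℝ × EuclideanSpace ℝ (Fin d) => u q.1 q.2) (Ico 0 T ×ˢ univ) →
        ContDiffOn ℝ (⊤ : ℕ∞) (fun q : ℝ × EuclideanSpace ℝ (Fin d) => u q.1 q.2) (Ioo 0 T ×ˢ univ) →
        ContDiffOn ℝ (⊤ : ℕ∞) (fun q : ℝ × EuclideanSpace ℝ (Fin d) => p q.1 q.2) (Ioo 0 T ×ˢ univ) →
        (∀ (t : ℝ) (x : EuclideanSpace ℝ (Fin d)) (n : Fin d → ℤ), u t (x + (EuclideanSpace.equiv (Fin d) ℝ).symm (fun i => (n i : ℝ))) = u t x) →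
        (∀ (t : ℝ) (x : EuclideanSpace ℝ (Fin d)) (n : Fin d → ℤ), p t (x + (EuclideanSpace.equiv (Fin d) ℝ).symm (fun i => (n i : ℝ))) = p t x) →
        (∀ t ∈ Ioo (0 : ℝ) T, ∀ (x : EuclideanSpace ℝ (Fin d)) (i : Fin d),
          deriv (fun s => u s x i) t
              + ∑ j, u t x j * fderiv ℝ (fun y => u t y i) x (EuclideanSpace.single j 1)
              + fderiv ℝ (fun y => p t y) x (EuclideanSpace.single i 1)
            = ν * ∑ j, fderiv ℝ (fun y => fderiv ℝ (fun z => u t z i) y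
                (EuclideanSpace.single j 1)) x (EuclideanSpace.single j 1)) →
        (∀ t ∈ Ioo (0 : ℝ) T, ∀ x : EuclideanSpace ℝ (Fin d),
          ∑ i, fderiv ℝ (fun y => u t y i) x (EuclideanSpace.single i 1) = 0) →
        (∃ M₀ : ℝ, ∀ t ∈ Ico (0 : ℝ) T, ∀ x, ‖u t x‖ ≤ M₀) →
        ∀ M₁ : ℝ,
          IsLUB {r : ℝ | ∃ t ∈ Ico (0 : ℝ) T, ∃ x y : EuclideanSpace ℝ (Fin d),
            x ≠ y ∧ r = ‖u t x - u t y‖ / ‖x - y‖ ^ α} M₁ →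
          0 < M₁ →
          ∀ x : ℝ → EuclideanSpace ℝ (Fin d),
            ContDiffOn ℝ (⊤ : ℕ∞) x (Ioo 0 T) →
            (∀ t ∈ Ioo (0 : ℝ) T, HasDerivAt x (u t (x t)) t) →
            ∀ a : ℝ, 0 < a →
              ∀ t₁ t₂ : ℝ,
                t₁ ∈ Ico (a * M₁ ^ (-2 / (1 + α)) * ν ^ ((1 - α) / (1 + α))) T →
                t₂ ∈ Ico (a * M₁ ^ (-2 / (1 + α)) * ν ^ ((1 - α) / (1 + α))) T →
                  ‖iteratedDeriv m x t₁ - iteratedDeriv m x t₂‖ ≤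
                    C * (a ^ (-(m : ℝ)) + 1) * M₁ ^ (1 / (1 - α)) * |t₁ - t₂| *
                      (1 - min (Real.log (M₁ * |t₁ - t₂|)) 0) := by
  obtain ⟨K, rfl⟩ := Nat.exists_eq_add_of_le' hm1
  have h1α : 0 < 1 - α := sub_pos.2 hα1
  have hK : hexp α (K + 1) = 0 := by
    rw [div_eq_iff h1α.ne'] at hm
    simp only [hexp]
    linarith
  choose C hC hest using fun i : Fin d =>
    Word.abs_sub_le hα hα1 hK (word_iterate (α := α) i K)
  have hC0 : 0 ≤ ∑ i, C i := Finset.sum_nonneg fun i _ => hC i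
  refine ⟨∑ i, C i + 1, by positivity, fun T ν hT hν u p _ hu hp hup hpp hmom hdiv _ M hM hM0
    x _ hx a ha t₁ t₂ ht₁ ht₂ => ?_⟩
  have hhol : ∀ q ∈ slab d T, ∀ z, ‖u q.1 (q.2 + z) - u q.1 q.2‖ ≤ M * ‖z‖ ^ α :=
    fun q hq z => by
      rcases eq_or_ne z 0 with rfl | hz
      · simp [hα.ne']
      have hz' : 0 < ‖z‖ ^ α := Real.rpow_pos_of_pos (norm_pos_iff.2 hz) _
      rw [← div_le_iff₀ hz']
      exact hM.1 ⟨q.1, Ioo_subset_Ico_self (mem_slab.1 hq), q.2 + z, q.2, by simpa, by simp⟩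
  let S : Flow d α := .ofSolution hν hM0 ⟨hu, fun q n => by simpa [lat] using hup q.1 q.2 n⟩
    ⟨hp, fun q n => by simpa [lat] using hpp q.1 q.2 n⟩ hmom hdiv hhol
  have hx' : IsTraj S x := hx
  obtain ⟨R, κ, hR, hMκ, hνκ, hMν, hRt, hκ⟩ := exists_scales hα hα1 hν hM0 ha (K + 1)
  have hτ : 0 < a * M ^ (-2 / (1 + α)) * ν ^ ((1 - α) / (1 + α)) := by positivity
  have key : ∀ s₁ ∈ Ico (a * M ^ (-2 / (1 + α)) * ν ^ ((1 - α) / (1 + α))) T,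
      ∀ s₂ ∈ Ico (a * M ^ (-2 / (1 + α)) * ν ^ ((1 - α) / (1 + α))) T, s₁ ≤ s₂ →
      ‖iteratedDeriv (K + 1) x s₂ - iteratedDeriv (K + 1) x s₁‖ ≤
        (∑ i, C i + 1) * (a ^ (-((K + 1 : ℕ) : ℝ)) + 1) * M ^ (1 / (1 - α)) * (s₂ - s₁)
          * (1 - min (Real.log (M * (s₂ - s₁))) 0) := by
    intro s₁ hs₁ s₂ hs₂ hs
    have h₁ : s₁ ∈ Ioo 0 S.T := ⟨hτ.trans_le hs₁.1, hs₁.2⟩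
    have h₂ : s₂ ∈ Ioo 0 S.T := ⟨hτ.trans_le hs₂.1, hs₂.2⟩
    have hs0 : 0 ≤ s₂ - s₁ := sub_nonneg.2 hs
    have hmin : 0 ≤ 1 - min (Real.log (M * (s₂ - s₁))) 0 := by
      linarith [min_le_right (Real.log (M * (s₂ - s₁))) 0]
    have hκ0 : 0 < κ := hM0.trans_le hMκ
    have hpow : M ^ (1 / (1 - α)) = M * M ^ (K + 1) := by
      rw [hm, ← pow_succ', ← Real.rpow_natCast]
      push_cast
      rfl
    calc _ ≤ ∑ i, |(iteratedDeriv (K + 1) x s₂ - iteratedDeriv (K + 1) x s₁) i| :=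
          norm_le_sum_abs _
      _ ≤ ∑ i, C i * (M * κ ^ (K + 1) * (s₂ - s₁)
            * (1 - min (Real.log (M * (s₂ - s₁))) 0)) := by
          refine Finset.sum_le_sum fun i _ => ?_
          rw [PiLp.sub_apply, iteratedDeriv_traj hx' K s₂ h₂, iteratedDeriv_traj hx' K s₁ h₁]
          exact hest i S R κ x hR hMκ hνκ hMν hx' s₁ s₂ hs h₁ h₂
            (hRt.trans (mul_le_mul_of_nonneg_left hs₁.1 hν.le))
      _ ≤ (∑ i, C i + 1) * (M * ((a ^ (-((K + 1 : ℕ) : ℝ)) + 1) * M ^ (K + 1)) * (s₂ - s₁)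
            * (1 - min (Real.log (M * (s₂ - s₁))) 0)) := by
          rw [← Finset.sum_mul]
          gcongr
          linarith
      _ = _ := by
          rw [hpow]
          ring
  rcases le_total t₁ t₂ with h | h
  · rw [norm_sub_rev, abs_sub_comm, abs_of_nonneg (sub_nonneg.2 h)]
    exact key t₁ ht₁ t₂ ht₂ h
  · rw [abs_of_nonneg (sub_nonneg.2 h)]
    exact key t₂ ht₂ t₁ ht₁ h
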